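/- arXiv:2006.11230 — 7 statements merged into one kernel-verified Lean document; each statement's English description precedes it below -/
import Mathlib

section
/- Let m be a squarefree rational integer with m ∉ {0, 1, -1}, α a complex root of the irreducible polynomial x^12 − m, K = ℚ(α), and Z_K the ring of integers of K. If m ≡ −1 (mod 9), then 3Z_K = 𝔭₁𝔭₂²𝔮₁𝔮₂², where 𝔭₁, 𝔭₂, 𝔮₁, 𝔮₂ are four pairwise distinct prime ideals of Z_K, each with residue degree 2. -/
open Polynomial NumberField

namespace FactThree

lemma irr (m : ℤ) (hsf : Squarefree m) (h1 : m ≠ 1) (h2 : m ≠ -1) :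
    Irreducible (X ^ 12 - C (m : ℚ)) := by
  have hu : ¬ IsUnit m := by
    rw [Int.isUnit_iff]; tauto
  obtain ⟨p, hp, hpm⟩ := WfDvdMonoid.exists_irreducible_factor hu hsf.ne_zero
  have hpp : Prime p := hp.prime
  have hmon : (X ^ 12 - C m : ℤ[X]).Monic := monic_X_pow_sub_C m (by norm_num)
  have hirr : Irreducible (X ^ 12 - C m : ℤ[X]) := by
    have he : (X ^ 12 - C m : ℤ[X]).IsEisensteinAt (Ideal.span {p}) := by
      refine ⟨?_, ?_, ?_⟩
      · rw [hmon.leadingCoeff, Ideal.mem_span_singleton]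
        exact fun h => hpp.not_isUnit (isUnit_of_dvd_one h)
      · intro n hn
        rw [natDegree_X_pow_sub_C] at hn
        rw [Ideal.mem_span_singleton, coeff_sub, coeff_X_pow, coeff_C, if_neg (by omega)]
        split_ifs
        · simpa using hpm
        · simp
      · rw [Ideal.span_singleton_pow, Ideal.mem_span_singleton]
        simp only [coeff_sub, coeff_X_pow, coeff_C]
        norm_num
        intro h
        exact hpp.not_isUnit (hsf p (by rwa [← sq]))
    refine he.irreducible ?_ hmon.isPrimitive ?_
    · rwa [Ideal.span_singleton_prime hpp.ne_zero]
    · rw [natDegree_X_pow_sub_C]; norm_num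
  have := (hmon.irreducible_iff_irreducible_map_fraction_map (K := ℚ)).1 hirr
  simpa using this

lemma not_cube (m : ℤ) (hsf : Squarefree m) (h1 : m ≠ 1) (h2 : m ≠ -1) (s : ℚ) :
    s ^ 3 ≠ (m : ℚ) := by
  intro hs
  have hint : IsIntegral ℤ s := by
    refine ⟨X ^ 3 - C m, monic_X_pow_sub_C m (by norm_num), ?_⟩
    rw [eval₂_sub, eval₂_pow, eval₂_X, eval₂_C]; simp [hs]
  obtain ⟨z, rfl⟩ := IsIntegrallyClosed.isIntegral_iff.1 hint
  have hz : z ^ 3 = m := by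
    have : (z : ℚ) ^ 3 = m := by simpa using hs
    exact_mod_cast this
  have hzu : IsUnit z := hsf z ⟨z, by rw [← hz]; ring⟩
  rcases Int.isUnit_iff.1 hzu with rfl | rfl <;> norm_num at hz <;> omega

lemma trace_cube {K : Type*} [Field K] [NumberField K] (c : K) (r : ℚ)
    (hc : c ^ 3 = algebraMap ℚ K r) (hr : ∀ s : ℚ, s ^ 3 ≠ r) :
    Algebra.trace ℚ K c = 0 := by
  have hirr : Irreducible (X ^ 3 - C r) :=
    X_pow_sub_C_irreducible_of_prime (by norm_num) hr
  have hmin : minpoly ℚ c = X ^ 3 - C r := by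
    refine (minpoly.eq_of_irreducible_of_monic hirr ?_ (monic_X_pow_sub_C r (by norm_num))).symm
    simp [hc]
  rw [trace_eq_finrank_mul_minpoly_nextCoeff, hmin]
  rw [nextCoeff_of_natDegree_pos (by rw [natDegree_X_pow_sub_C]; norm_num), natDegree_X_pow_sub_C]
  simp [coeff_X_pow, coeff_C]

lemma finrank_eq (m : ℤ) (hsf : Squarefree m) (h1 : m ≠ 1) (h2 : m ≠ -1)
    (K : Type*) [Field K] [NumberField K] (α : K)
    (hroot : α ^ 12 = (m : K)) (hgen : IntermediateField.adjoin ℚ {α} = ⊤) :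
    Module.finrank ℚ K = 12 ∧ ∃ σ : K →ₐ[ℚ] K, σ α = -α := by
  have hmin : minpoly ℚ α = X ^ 12 - C (m : ℚ) := by
    refine (minpoly.eq_of_irreducible_of_monic (irr m hsf h1 h2) ?_
      (monic_X_pow_sub_C _ (by norm_num))).symm
    simp [hroot]
  have hint : IsIntegral ℚ α := Algebra.IsIntegral.isIntegral α
  constructor
  · have := IntermediateField.adjoin.finrank hint
    rw [hgen, hmin, natDegree_X_pow_sub_C, IntermediateField.finrank_top'] at this
    exact this
  · let f : IntermediateField.adjoin ℚ {α} →ₐ[ℚ] K :=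
      (IntermediateField.adjoin.powerBasis hint).lift (-α) (by
        rw [IntermediateField.adjoin.powerBasis_gen, IntermediateField.minpoly_gen, hmin]
        simp only [map_sub, map_pow, aeval_X, aeval_C, map_intCast]
        rw [← hroot]; ring)
    let e : K →ₐ[ℚ] IntermediateField.adjoin ℚ {α} :=
      ((IntermediateField.equivOfEq hgen).trans IntermediateField.topEquiv).symm.toAlgHom
    refine ⟨f.comp e, ?_⟩
    have he : e α = IntermediateField.AdjoinSimple.gen ℚ α := by
      apply Subtype.ext
      rfl
    rw [AlgHom.comp_apply, he]
    have := (IntermediateField.adjoin.powerBasis hint).lift_gen (-α) (by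
        rw [IntermediateField.adjoin.powerBasis_gen, IntermediateField.minpoly_gen, hmin]
        simp only [map_sub, map_pow, aeval_X, aeval_C, map_intCast]
        rw [← hroot]; ring)
    exact this

/-- The trace of `3δ` is divisible by three. -/
lemma trace_three {K : Type*} [Field K] [NumberField K] (d : 𝓞 K) :
    ∃ z : ℤ, Algebra.trace ℚ K (3 * (d : K)) = 3 * z := by
  have h : IsIntegral ℤ (Algebra.trace ℚ K (d : K)) :=
    Algebra.isIntegral_trace d.isIntegral_coe
  obtain ⟨z, hz⟩ := IsIntegrallyClosed.isIntegral_iff.1 h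
  refine ⟨z, ?_⟩
  have : (3 * (d : K)) = (3 : ℚ) • (d : K) := by
    rw [Algebra.smul_def]; simp
  rw [this, map_smul, ← hz]; simp

section
variable {R : Type*} [CommRing R]

/-- facts about primes containing three -/
lemma t_mem {a g k : R} (hg : 3 * g = a ^ 8 - a ^ 4 + 1) (ha : a ^ 12 = -1 - 9 * k)
    (P : Ideal R) [P.IsPrime] (h3 : (3 : R) ∈ P) : a ^ 4 + 1 ∈ P := by
  have : (a ^ 4 + 1) ^ 3 = 3 * (a ^ 8 + a ^ 4 - 3 * k) := by linear_combination ha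
  refine Ideal.IsPrime.mem_of_pow_mem ‹_› 3 ?_
  rw [this]; exact P.mul_mem_right _ h3

lemma sq_mem {a g k : R} (hg : 3 * g = a ^ 8 - a ^ 4 + 1) (ha : a ^ 12 = -1 - 9 * k)
    (P : Ideal R) [P.IsPrime] (h3 : (3 : R) ∈ P) (hgP : g ∈ P) : (3 : R) ∈ P ^ 2 := by
  have ht := t_mem hg ha P h3
  have e : (3 : R) = 3 * (g + (a ^ 4 + 1)) - (a ^ 4 + 1) * (a ^ 4 + 1) := by
    linear_combination (-1 : R) * hg
  rw [e, sq]
  exact sub_mem (Ideal.mul_mem_mul h3 (add_mem hgP ht)) (Ideal.mul_mem_mul ht ht)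

lemma exists_pair {a g k x : R} (hg : 3 * g = a ^ 8 - a ^ 4 + 1) (ha : a ^ 12 = -1 - 9 * k)
    (σ : R →+* R) (hσ : σ a = -a) (hx : σ x = x)
    (P : Ideal R) [hP : P.IsPrime] (h3 : (3 : R) ∈ P) (hxP : x ∈ P) :
    ∃ Q₁ Q₂ : Ideal R, Q₁.IsPrime ∧ Q₂.IsPrime ∧ 3 ∈ Q₁ ∧ 3 ∈ Q₂ ∧ x ∈ Q₁ ∧ x ∈ Q₂ ∧
      a ^ 2 + a + 2 ∈ Q₁ ∧ a ^ 2 + 2 * a + 2 ∈ Q₂ := by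
  have ht := t_mem hg ha P h3
  have hprod : (a ^ 2 + a + 2) * (a ^ 2 + 2 * a + 2) ∈ P := by
    have : (a ^ 2 + a + 2) * (a ^ 2 + 2 * a + 2)
      = (a ^ 4 + 1) + 3 * (a ^ 3 + 2 * a ^ 2 + 2 * a + 1) := by ring
    rw [this]
    exact add_mem ht (P.mul_mem_right _ h3)
  have h3' : (3 : R) ∈ P.comap σ := by rw [Ideal.mem_comap, map_ofNat σ 3]; exact h3
  have hx' : x ∈ P.comap σ := by rw [Ideal.mem_comap, hx]; exact hxP
  rcases hP.mem_or_mem hprod with h | h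
  · refine ⟨P, P.comap σ, hP, inferInstance, h3, h3', hxP, hx', h, ?_⟩
    rw [Ideal.mem_comap]
    have : σ (a ^ 2 + 2 * a + 2) = (a ^ 2 + a + 2) - 3 * a := by
      simp only [map_add, map_mul, map_pow, hσ, map_ofNat σ 2]; ring
    rw [this]
    exact sub_mem h (P.mul_mem_right _ h3)
  · refine ⟨P.comap σ, P, inferInstance, hP, h3', h3, hx', hxP, ?_, h⟩
    rw [Ideal.mem_comap]
    have : σ (a ^ 2 + a + 2) = (a ^ 2 + 2 * a + 2) - 3 * a := by
      simp only [map_add, map_mul, map_pow, hσ, map_ofNat σ 2]; ring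
    rw [this]
    exact sub_mem h (P.mul_mem_right _ h3)

lemma a_notMem {a k : R} (ha : a ^ 12 = -1 - 9 * k)
    (P : Ideal R) [hP : P.IsPrime] (h3 : (3 : R) ∈ P) : a ∉ P := by
  intro h
  apply hP.ne_top
  rw [Ideal.eq_top_iff_one]
  have : (1 : R) = 3 * (-3 * k) - a * a ^ 11 := by linear_combination ha
  rw [this]
  exact sub_mem (P.mul_mem_right _ h3) (P.mul_mem_right _ h)

end

lemma norm_ge {K : Type*} [Field K] [NumberField K] (hK : Module.finrank ℚ K = 12)
    {a k : 𝓞 K} (ha : a ^ 12 = -1 - 9 * k)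
    (P : Ideal (𝓞 K)) [hP : P.IsPrime] (h3 : (3 : 𝓞 K) ∈ P)
    (hq : a ^ 2 + a + 2 ∈ P ∨ a ^ 2 + 2 * a + 2 ∈ P) : 9 ≤ Ideal.absNorm P := by
  have hdvd : Ideal.absNorm P ∣ 3 ^ 12 := by
    have h := Ideal.absNorm_dvd_absNorm_of_le
      ((Ideal.span_singleton_le_iff_mem P).2 h3)
    have h' : Ideal.absNorm (Ideal.span {(3 : 𝓞 K)}) = 3 ^ 12 := by
      have := Ideal.absNorm_span_natCast (S := 𝓞 K) 3
      rw [RingOfIntegers.rank, hK] at this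
      simpa using this
    rwa [h'] at h
  obtain ⟨i, -, hi⟩ := (Nat.dvd_prime_pow Nat.prime_three).1 hdvd
  have hane := a_notMem ha P h3
  match i, hi with
  | 0, hi =>
    exact absurd (Ideal.absNorm_eq_one_iff.1 (by simpa using hi)) hP.ne_top
  | 1, hi =>
    exfalso
    have hcube : a ^ 3 - a ∈ P := by
      have hPm : P.IsMaximal := hP.isMaximal (by
        rintro rfl
        simp at hi)
      letI : Field (𝓞 K ⧸ P) := Ideal.Quotient.field P
      have hcard : Nat.card (𝓞 K ⧸ P) = 3 := by
        rw [← Submodule.cardQuot_apply, ← Ideal.absNorm_apply, hi]; norm_num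
      haveI : Finite (𝓞 K ⧸ P) := Nat.finite_of_card_ne_zero (by rw [hcard]; norm_num)
      letI : Fintype (𝓞 K ⧸ P) := Fintype.ofFinite _
      have := FiniteField.pow_card (Ideal.Quotient.mk P a)
      rw [← Nat.card_eq_fintype_card, hcard] at this
      rw [← Ideal.Quotient.eq_zero_iff_mem, map_sub, map_pow, this, sub_self]
    have h1 : a ^ 2 - 1 ∈ P := by
      have : a * (a ^ 2 - 1) ∈ P := by convert hcube using 1; ring
      exact (hP.mem_or_mem this).resolve_left hane
    apply hane
    rcases hq with h | h
    · have : a = (a ^ 2 + a + 2) - (a ^ 2 - 1) - 3 * 1 := by ring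
      rw [this]
      exact sub_mem (sub_mem h h1) (P.mul_mem_right _ h3)
    · have : a = 3 * (a + 1) - ((a ^ 2 + 2 * a + 2) - (a ^ 2 - 1)) := by ring
      rw [this]
      exact sub_mem (P.mul_mem_right _ h3) (sub_mem h h1)
  | (n + 2), hi =>
    rw [hi, pow_add]
    have := Nat.one_le_pow n 3 (by norm_num)
    omega

end FactThree

/-- If `m ≡ −1 (mod 9)` (with `m` squarefree, `m ∉ {0,1,-1}`, `K = ℚ(α)`, `α^12 = m`),
then `3 Z_K = 𝔭₁𝔭₂²𝔮₁𝔮₂²` with four pairwise distinct prime ideals, each of residue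
degree `2` (absolute norm `9`). -/
theorem factorization_three_of_neg_one_mod_nine (m : ℤ) (hsf : Squarefree m)
    (h0 : m ≠ 0) (h1 : m ≠ 1) (h2 : m ≠ -1)
    (K : Type*) [Field K] [NumberField K] (α : K)
    (hroot : α ^ 12 = (m : K))
    (hgen : IntermediateField.adjoin ℚ {α} = ⊤)
    (hmod : m ≡ -1 [ZMOD 9]) :
    ∃ p₁ p₂ q₁ q₂ : Ideal (𝓞 K),
      [p₁, p₂, q₁, q₂].Pairwise (· ≠ ·) ∧
      p₁.IsPrime ∧ p₂.IsPrime ∧ q₁.IsPrime ∧ q₂.IsPrime ∧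
      Ideal.absNorm p₁ = 3 ^ 2 ∧ Ideal.absNorm p₂ = 3 ^ 2 ∧
      Ideal.absNorm q₁ = 3 ^ 2 ∧ Ideal.absNorm q₂ = 3 ^ 2 ∧
      Ideal.span {(3 : 𝓞 K)} = p₁ * p₂ ^ 2 * q₁ * q₂ ^ 2 := by
  obtain ⟨hK, τ, hτ⟩ := FactThree.finrank_eq m hsf h1 h2 K α hroot hgen
  obtain ⟨k, hk⟩ : ∃ k : ℤ, m = -1 - 9 * k := by
    obtain ⟨c, hc⟩ := hmod.dvd
    exact ⟨c, by omega⟩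
  have hα : IsIntegral ℤ α := by
    refine ⟨X ^ 12 - C m, monic_X_pow_sub_C m (by norm_num), ?_⟩
    rw [eval₂_sub, eval₂_pow, eval₂_X, eval₂_C]; simp [hroot]
  have hα12 : α ^ 12 = -1 - 9 * (k : K) := by rw [hroot, hk]; push_cast; ring
  set γ : K := (α ^ 8 - α ^ 4 + 1) / 3 with hγ
  have h3γ : 3 * γ = α ^ 8 - α ^ 4 + 1 := by rw [hγ]; field_simp
  have hcub : γ ^ 3 - γ ^ 2 - 3 * k * γ - 3 * k ^ 2 = 0 := by
    have h27 : (27 : K) * (γ ^ 3 - γ ^ 2 - 3 * k * γ - 3 * k ^ 2) = 0 := by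
      have : (27 : K) * (γ ^ 3 - γ ^ 2 - 3 * k * γ - 3 * k ^ 2)
        = (3 * γ) ^ 3 - 3 * (3 * γ) ^ 2 - 27 * k * (3 * γ) - 81 * k ^ 2 := by ring
      rw [this, h3γ]
      have hk9 : (k : K) = (-1 - α ^ 12) / 9 := by rw [hα12]; field_simp; ring
      rw [hk9]; field_simp; ring
    simpa using h27
  have hγint : IsIntegral ℤ γ := by
    refine ⟨X ^ 3 - X ^ 2 - C (3 * k) * X - C (3 * k ^ 2), by monicity!, ?_⟩
    simp only [eval₂_sub, eval₂_mul, eval₂_pow, eval₂_X, eval₂_C]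
    simpa using hcub
  obtain ⟨a, rfl⟩ : ∃ a : 𝓞 K, (a : K) = α := ⟨⟨α, hα⟩, rfl⟩
  obtain ⟨g, hgγ⟩ : ∃ g : 𝓞 K, (g : K) = γ := ⟨⟨γ, hγint⟩, rfl⟩
  have hg : 3 * g = a ^ 8 - a ^ 4 + 1 := by
    apply RingOfIntegers.ext
    push_cast
    have h := h3γ
    rw [← hgγ] at h; exact h
  have ha : a ^ 12 = -1 - 9 * (k : 𝓞 K) := by
    apply RingOfIntegers.ext
    push_cast
    exact hα12
  have hcubg : g ^ 2 * (g - 1) = 3 * (k * g + k ^ 2) := by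
    apply RingOfIntegers.ext
    push_cast
    have h : γ ^ 2 * (γ - 1) = 3 * (k * γ + k ^ 2) := by linear_combination hcub
    rw [← hgγ] at h; exact h
  -- the endomorphism
  let σ : 𝓞 K →+* 𝓞 K := RingOfIntegers.mapRingHom (τ : K →+* K)
  have hσ : σ a = -a := by
    apply RingOfIntegers.ext
    push_cast
    exact hτ
  have h3ne : (3 : 𝓞 K) ≠ 0 := by norm_num
  have hσg : σ g = g := by
    apply mul_left_cancel₀ h3ne
    have : 3 * σ g = σ (3 * g) := by rw [map_mul, map_ofNat σ 3]
    rw [this, hg]; simp [hσ]; ring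
  have hσg1 : σ (g - 1) = g - 1 := by simp [hσg]
  -- traces
  have hnc := FactThree.not_cube m hsf h1 h2
  have hmQ : (m : ℚ) ≠ 0 := by exact_mod_cast h0
  have tr4 : Algebra.trace ℚ K ((a : K) ^ 4) = 0 :=
    FactThree.trace_cube _ m (by rw [← pow_mul, hroot]; simp) hnc
  have tr8 : Algebra.trace ℚ K ((a : K) ^ 8) = 0 := by
    refine FactThree.trace_cube _ ((m : ℚ) ^ 2) ?_ ?_
    · rw [← pow_mul, map_pow]
      simp only [map_intCast]
      rw [← hroot]; ring
    · intro s hs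
      have hs0 : s ≠ 0 := by
        rintro rfl
        have : (m : ℚ) ^ 2 ≠ 0 := pow_ne_zero _ hmQ
        exact this (by rw [← hs]; norm_num)
      apply hnc (m / s)
      rw [div_pow, hs]; field_simp
  have trq : ∀ q : ℚ, Algebra.trace ℚ K (algebraMap ℚ K q) = 12 * q := by
    intro q; rw [Algebra.trace_algebraMap, hK]; simp
  have trlin : ∀ x y z : ℚ, Algebra.trace ℚ K
      (x • (a : K) ^ 8 + y • (a : K) ^ 4 + algebraMap ℚ K z) = 12 * z := by
    intro x y z
    rw [map_add, map_add, map_smul, map_smul, tr4, tr8, trq]; simp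
  have ex0 : ∃ P : Ideal (𝓞 K), P.IsPrime ∧ 3 ∈ P ∧ g ∈ P := by
    by_contra hcon
    have htop : Ideal.span {(3 : 𝓞 K), g} = ⊤ := by
      by_contra hne
      obtain ⟨M, hM, hle⟩ := Ideal.exists_le_maximal _ hne
      exact hcon ⟨M, hM.isPrime, hle (Ideal.subset_span (by simp)),
        hle (Ideal.subset_span (by simp))⟩
    rw [Ideal.eq_top_iff_one, Ideal.mem_span_pair] at htop
    obtain ⟨x, y, hxy⟩ := htop
    have key : ∃ d : 𝓞 K, g - 1 = 3 * d := by
      refine ⟨(g - 1) * (x * (x * 3 + y * g) + y * g * x) + y ^ 2 * (k * g + k ^ 2), ?_⟩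
      linear_combination y ^ 2 * hcubg - (g - 1) * (x * 3 + y * g + 1) * hxy
    obtain ⟨d, hd⟩ := key
    obtain ⟨z, hz⟩ := FactThree.trace_three d
    have hdK : (3 * (d : K)) = (1/3 : ℚ) • (a : K) ^ 8 + (-1/3 : ℚ) • (a : K) ^ 4
        + algebraMap ℚ K (-2/3) := by
      have : (3 * (d : K)) = γ - 1 := by
        rw [← hgγ]; 
        have h := congrArg (algebraMap (𝓞 K) K) hd
        simp only [map_mul, map_sub, map_one, map_pow, map_ofNat (algebraMap (𝓞 K) K) 3] at h
        exact h.symm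
      rw [this, hγ]; simp only [Algebra.smul_def]; simp; ring
    rw [hdK, trlin] at hz
    have : (-8 : ℤ) = 3 * z := by
      have : (-8 : ℚ) = 3 * z := by rw [← hz]; norm_num
      exact_mod_cast this
    omega
  have ex1 : ∃ P : Ideal (𝓞 K), P.IsPrime ∧ 3 ∈ P ∧ g - 1 ∈ P := by
    by_contra hcon
    have htop : Ideal.span {(3 : 𝓞 K), g - 1} = ⊤ := by
      by_contra hne
      obtain ⟨M, hM, hle⟩ := Ideal.exists_le_maximal _ hne
      exact hcon ⟨M, hM.isPrime, hle (Ideal.subset_span (by simp)),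
        hle (Ideal.subset_span (by simp))⟩
    rw [Ideal.eq_top_iff_one, Ideal.mem_span_pair] at htop
    obtain ⟨x, y, hxy⟩ := htop
    have key : ∃ d : 𝓞 K, g ^ 2 = 3 * d := by
      refine ⟨g ^ 2 * x + y * (k * g + k ^ 2), ?_⟩
      linear_combination y * hcubg - g ^ 2 * hxy
    obtain ⟨d, hd⟩ := key
    obtain ⟨z, hz⟩ := FactThree.trace_three d
    have hdK : (3 * (d : K)) = (1/3 : ℚ) • (a : K) ^ 8 + (-1/3 - k : ℚ) • (a : K) ^ 4
        + algebraMap ℚ K (1/3 + 2 * k) := by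
      have : (3 * (d : K)) = γ ^ 2 := by
        rw [← hgγ]; 
        have h := congrArg (algebraMap (𝓞 K) K) hd
        simp only [map_mul, map_sub, map_one, map_pow, map_ofNat (algebraMap (𝓞 K) K) 3] at h
        exact h.symm
      rw [this, hγ]; simp only [Algebra.smul_def]; simp
      linear_combination ((a : K) ^ 4 - 2) / 9 * hα12
    rw [hdK, trlin] at hz
    have : (4 + 24 * k : ℤ) = 3 * z := by
      have : (4 + 24 * k : ℚ) = 3 * z := by rw [← hz]; ring
      exact_mod_cast this
    omega
  obtain ⟨P, hP, hP3, hPg⟩ := ex0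
  obtain ⟨Q, hQ, hQ3, hQg⟩ := ex1
  obtain ⟨p₂, q₂, hp₂, hq₂, hp₂3, hq₂3, hp₂g, hq₂g, hp₂a, hq₂a⟩ :=
    FactThree.exists_pair hg ha σ hσ hσg P hP3 hPg
  obtain ⟨p₁, q₁, hp₁, hq₁, hp₁3, hq₁3, hp₁g, hq₁g, hp₁a, hq₁a⟩ :=
    FactThree.exists_pair hg ha σ hσ hσg1 Q hQ3 hQg
  have hmax : ∀ I : Ideal (𝓞 K), I.IsPrime → 3 ∈ I → I.IsMaximal := by
    intro I hI h3
    refine hI.isMaximal ?_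
    rintro rfl
    exact h3ne (by simpa using h3)
  have neG : ∀ I J : Ideal (𝓞 K), I.IsPrime → g - 1 ∈ I → g ∈ J → I ≠ J := by
    rintro I J hI h h' rfl
    apply hI.ne_top
    rw [Ideal.eq_top_iff_one]
    have := sub_mem h' h
    simpa using this
  have neA : ∀ I J : Ideal (𝓞 K), I.IsPrime → 3 ∈ I → a ^ 2 + a + 2 ∈ I →
      a ^ 2 + 2 * a + 2 ∈ J → I ≠ J := by
    rintro I J hI h3 h h' rfl
    apply FactThree.a_notMem ha I h3
    have := sub_mem h' h
    convert this using 1; ring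
  have n12 := neG p₁ p₂ hp₁ hp₁g hp₂g
  have n1q1 := neA p₁ q₁ hp₁ hp₁3 hp₁a hq₁a
  have n1q2 := neG p₁ q₂ hp₁ hp₁g hq₂g
  have n2q1 := (neG q₁ p₂ hq₁ hq₁g hp₂g).symm
  have n2q2 := neA p₂ q₂ hp₂ hp₂3 hp₂a hq₂a
  have nq := neG q₁ q₂ hq₁ hq₁g hq₂g
  have cop : ∀ I J : Ideal (𝓞 K), I.IsMaximal → J.IsMaximal → I ≠ J → IsCoprime I J :=
    fun I J hI hJ h => Ideal.isCoprime_iff_sup_eq.2 (hI.coprime_of_ne hJ h)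
  have mp₁ := hmax p₁ hp₁ hp₁3
  have mp₂ := hmax p₂ hp₂ hp₂3
  have mq₁ := hmax q₁ hq₁ hq₁3
  have mq₂ := hmax q₂ hq₂ hq₂3
  have np₁ := FactThree.norm_ge hK ha p₁ hp₁3 (Or.inl hp₁a)
  have np₂ := FactThree.norm_ge hK ha p₂ hp₂3 (Or.inl hp₂a)
  have nq₁ := FactThree.norm_ge hK ha q₁ hq₁3 (Or.inr hq₁a)
  have nq₂ := FactThree.norm_ge hK ha q₂ hq₂3 (Or.inr hq₂a)
  have hdvd : p₁ * p₂ ^ 2 * q₁ * q₂ ^ 2 ∣ Ideal.span {(3 : 𝓞 K)} := by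
    have d1 : p₁ ∣ Ideal.span {(3 : 𝓞 K)} := Ideal.dvd_span_singleton.2 hp₁3
    have d2 : p₂ ^ 2 ∣ Ideal.span {(3 : 𝓞 K)} :=
      Ideal.dvd_span_singleton.2 (FactThree.sq_mem hg ha p₂ hp₂3 hp₂g)
    have d3 : q₁ ∣ Ideal.span {(3 : 𝓞 K)} := Ideal.dvd_span_singleton.2 hq₁3
    have d4 : q₂ ^ 2 ∣ Ideal.span {(3 : 𝓞 K)} :=
      Ideal.dvd_span_singleton.2 (FactThree.sq_mem hg ha q₂ hq₂3 hq₂g)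
    have c12 := cop _ _ mp₁ mp₂ n12
    have c1q1 := cop _ _ mp₁ mq₁ n1q1
    have c1q2 := cop _ _ mp₁ mq₂ n1q2
    have c2q1 := cop _ _ mp₂ mq₁ n2q1
    have c2q2 := cop _ _ mp₂ mq₂ n2q2
    have cq := cop _ _ mq₁ mq₂ nq
    refine IsCoprime.mul_dvd ?_ (IsCoprime.mul_dvd ?_ (IsCoprime.mul_dvd ?_ d1 d2) d3) d4
    · exact ((c1q2.mul_left c2q2.pow_left).mul_left cq).pow_right
    · exact c1q1.mul_left c2q1.pow_left
    · exact c12.pow_right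
  have h3norm : Ideal.absNorm (Ideal.span {(3 : 𝓞 K)}) = 3 ^ 12 := by
    have := Ideal.absNorm_span_natCast (S := 𝓞 K) 3
    rw [RingOfIntegers.rank, hK] at this
    simpa using this
  obtain ⟨J, hJ⟩ := hdvd
  have hN := congrArg Ideal.absNorm hJ
  rw [h3norm] at hN
  simp only [map_mul, map_pow] at hN
  set A := Ideal.absNorm p₁
  set B := Ideal.absNorm p₂
  set C' := Ideal.absNorm q₁
  set D := Ideal.absNorm q₂
  set E := Ideal.absNorm J with hE
  have hE1 : 1 ≤ E := by
    rcases Nat.eq_zero_or_pos E with h | h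
    · rw [h] at hN; norm_num at hN
    · exact h
  have bound : ∀ x y z w e : ℕ, 9 ≤ x → 9 ≤ y → 9 ≤ z → 9 ≤ w → 1 ≤ e →
      9 * 9 ^ 2 * 9 * 9 ^ 2 * 1 ≤ x * y ^ 2 * z * w ^ 2 * e := by
    intro x y z w e hx hy hz hw he
    gcongr
  have hA : A = 9 := by
    by_contra h
    have h' : 10 ≤ A := by omega
    have : 10 * 9 ^ 2 * 9 * 9 ^ 2 * 1 ≤ A * B ^ 2 * C' * D ^ 2 * E := by gcongr
    omega
  have hB : B = 9 := by
    by_contra h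
    have h' : 10 ≤ B := by omega
    have : 9 * 10 ^ 2 * 9 * 9 ^ 2 * 1 ≤ A * B ^ 2 * C' * D ^ 2 * E := by gcongr
    omega
  have hC : C' = 9 := by
    by_contra h
    have h' : 10 ≤ C' := by omega
    have : 9 * 9 ^ 2 * 10 * 9 ^ 2 * 1 ≤ A * B ^ 2 * C' * D ^ 2 * E := by gcongr
    omega
  have hD : D = 9 := by
    by_contra h
    have h' : 10 ≤ D := by omega
    have : 9 * 9 ^ 2 * 9 * 10 ^ 2 * 1 ≤ A * B ^ 2 * C' * D ^ 2 * E := by gcongr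
    omega
  have hE' : E = 1 := by
    rw [hA, hB, hC, hD] at hN
    omega
  have hJ1 : J = 1 := by
    rw [Ideal.one_eq_top]; exact Ideal.absNorm_eq_one_iff.1 hE'
  refine ⟨p₁, p₂, q₁, q₂, ?_, hp₁, hp₂, hq₁, hq₂, hA.trans (by norm_num), hB.trans (by norm_num),
    hC.trans (by norm_num), hD.trans (by norm_num), ?_⟩
  · simp [n12, n1q1, n1q2, n2q1, n2q2, nq]
  · rw [hJ, hJ1, mul_one]
end

section
/- Let m be a squarefree rational integer with m ∉ {0, 1, -1}, α a complex root of the irreducible polynomial x^12 − m, K = ℚ(α), and Z_K the ring of integers of K. If m ≡ 3 (mod 4), then 2 does not divide the index (Z_K : ℤ[α]). -/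
open Polynomial NumberField

theorem aux_radical {R : Type*} [CommRing R] (b : R)
    (J : Ideal (Algebra.adjoin ℤ {b})) (h2 : (2 : Algebra.adjoin ℤ {b}) ∈ J)
    (hθ : (⟨b, Algebra.self_mem_adjoin_singleton ℤ b⟩ : Algebra.adjoin ℤ {b}) ^ 3 - 1 ∈ J) :
    J.IsRadical := by
  have key : ∀ x (hx : x ∈ Algebra.adjoin ℤ {b}),
      (⟨x, hx⟩ : Algebra.adjoin ℤ {b}) ^ 4 - ⟨x, hx⟩ ∈ J := by
    intro x hx
    induction hx using Algebra.adjoin_induction with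
    | mem x hx =>
      obtain rfl : x = b := hx
      have := J.mul_mem_left ⟨x, Algebra.self_mem_adjoin_singleton ℤ x⟩ hθ
      convert this using 1
      ring
    | algebraMap r =>
      have h : ∃ k : ℤ, r ^ 4 - r = 2 * k := by
        have : (2 : ℤ) ∣ r ^ 4 - r := by
          rcases Int.even_or_odd' r with ⟨k, rfl | rfl⟩
          · exact ⟨8 * k ^ 4 - k, by ring⟩
          · exact ⟨8 * k ^ 4 + 16 * k ^ 3 + 12 * k ^ 2 + 3 * k, by ring⟩
        exact this
      obtain ⟨k, hk⟩ := h
      have h3 := J.mul_mem_left (algebraMap ℤ (Algebra.adjoin ℤ {b}) k) h2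
      convert h3 using 1
      apply Subtype.ext
      have := congrArg (algebraMap ℤ R) hk
      simp only [map_sub, map_pow, map_mul, map_ofNat] at this
      change (algebraMap ℤ R r) ^ 4 - algebraMap ℤ R r = algebraMap ℤ R k * 2
      rw [this]; ring
    | add x y hx hy ihx ihy =>
      set X : Algebra.adjoin ℤ {b} := ⟨x, hx⟩
      set Y : Algebra.adjoin ℤ {b} := ⟨y, hy⟩
      have : (⟨x + y, add_mem hx hy⟩ : Algebra.adjoin ℤ {b}) = X + Y := rfl
      rw [this]
      have h3 := J.add_mem (J.add_mem ihx ihy)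
        (J.mul_mem_left (2 * X ^ 3 * Y + 3 * X ^ 2 * Y ^ 2 + 2 * X * Y ^ 3) h2)
      convert h3 using 1
      ring
    | mul x y hx hy ihx ihy =>
      set X : Algebra.adjoin ℤ {b} := ⟨x, hx⟩
      set Y : Algebra.adjoin ℤ {b} := ⟨y, hy⟩
      have : (⟨x * y, mul_mem hx hy⟩ : Algebra.adjoin ℤ {b}) = X * Y := rfl
      rw [this]
      have h3 := J.add_mem (J.mul_mem_left (Y ^ 4) ihx) (J.mul_mem_left X ihy)
      convert h3 using 1
      ring
  rw [Ideal.isRadical_iff_pow_one_lt 4 (by norm_num)]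
  intro r hr
  have := J.sub_mem hr (key r.1 r.2)
  simpa using this

/-- if `a ∈ A` lies in `2 R`, `R` integral over `ℤ`, then a power of `a` lies in `2 A`. -/
theorem aux_pow {R : Type*} [CommRing R] (A : Subalgebra ℤ R) (a : A) (z : R)
    (hz : IsIntegral ℤ z) (h : (a : R) = 2 * z) : ∃ n : ℕ, ∃ c : A, a ^ n = 2 * c := by
  obtain ⟨p, hp, hpz⟩ := hz
  have h1 := Polynomial.scaleRoots_eval₂_mul (p := p) (f := algebraMap ℤ R) (r := z) (s := 2)
  rw [hpz, mul_zero] at h1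
  have e : (algebraMap ℤ R) 2 * z = a := by simp [h]
  rw [e] at h1
  have h2 : Polynomial.eval₂ (algebraMap ℤ A) a (p.scaleRoots 2) = 0 := by
    apply Subtype.ext
    have : ((Polynomial.eval₂ (algebraMap ℤ A) a (p.scaleRoots 2) : A) : R)
      = Polynomial.eval₂ (algebraMap ℤ R) a (p.scaleRoots 2) := by
      exact Polynomial.hom_eval₂ (p.scaleRoots 2) (algebraMap ℤ A) A.val.toRingHom a
    rw [this, h1]; rfl
  refine ⟨p.natDegree, ?_⟩
  rw [Polynomial.eval₂_eq_sum_range, Polynomial.natDegree_scaleRoots, Finset.sum_range_succ] at h2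
  simp only [Polynomial.coeff_scaleRoots, hp.coeff_natDegree, tsub_self, pow_zero, mul_one,
    map_one, one_mul] at h2
  have h3 : (2 : A) ∣ ∑ i ∈ Finset.range p.natDegree,
      (algebraMap ℤ A) (p.coeff i * 2 ^ (p.natDegree - i)) * a ^ i := by
    apply Finset.dvd_sum
    intro i hi
    rw [Finset.mem_range] at hi
    apply Dvd.dvd.mul_right
    rw [map_mul, map_pow]
    apply Dvd.dvd.mul_left
    have : (algebraMap ℤ A) 2 = 2 := by simp
    rw [this]
    exact dvd_pow_self _ (by omega)
  have h4 : a ^ p.natDegree = - ∑ i ∈ Finset.range p.natDegree,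
      (algebraMap ℤ A) (p.coeff i * 2 ^ (p.natDegree - i)) * a ^ i := by
    rw [eq_neg_iff_add_eq_zero, add_comm]; exact h2
  rw [h4]
  exact (dvd_neg.mpr h3)

theorem aux_main {R : Type*} [CommRing R] [IsDomain R] [CharZero R] [Algebra.IsIntegral ℤ R]
    (b : R) (t : ℤ) (hb : b ^ 12 = 4 * t + 3) : ∀ (y : Algebra.adjoin ℤ {b}) (x : R)
    (_ : (y : R) = 2 * x), ∃ c : Algebra.adjoin ℤ {b}, y = 2 * c := by
  set A := Algebra.adjoin ℤ {b}
  intro y x hy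
  set B : A := ⟨b, Algebra.self_mem_adjoin_singleton ℤ b⟩ with hB
  set T : A := B ^ 3 - 1 with hT
  have hBb : (B : R) = b := rfl
  have hTb : (T : R) = b ^ 3 - 1 := rfl
  have hB12 : B ^ 12 = 4 * t + 3 := by
    apply Subtype.ext
    change b ^ 12 = 4 * ((t : A) : R) + 3
    simpa using hb
  set J : Ideal A := Ideal.span {2, T} with hJ
  have hrad : J.IsRadical :=
    aux_radical b J (Ideal.subset_span (by simp)) (Ideal.subset_span (by simp [hT, hB]))
  -- theta^4 = 2 v
  have hv : T ^ 4 = 2 * (-2 * B ^ 9 + 3 * B ^ 6 - 2 * B ^ 3 + 2 * t + 2) := by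
    linear_combination hB12
  set v : A := -2 * B ^ 9 + 3 * B ^ 6 - 2 * B ^ 3 + 2 * t + 2 with hvdef
  have hvB : ∃ w : A, v * B ^ 6 = 1 + 2 * w := by
    refine ⟨-B ^ 15 + 6 * t + 4 - B ^ 9 + (t + 1) * B ^ 6, ?_⟩
    linear_combination 3 * hB12
  obtain ⟨w, hw⟩ := hvB
  have two_ne : (2 : R) ≠ 0 := two_ne_zero
  have step : ∀ a : A, ∀ z : R, (T : R) ^ 3 * a = 2 * z → a ∈ J := by
    intro a z hz
    have hvR : (T : R) ^ 4 = 2 * v := congrArg Subtype.val hv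
    have hwR : (v : R) * b ^ 6 = 1 + 2 * w := congrArg Subtype.val hw
    have e1 : (v : R) * a = T * z := by
      apply mul_left_cancel₀ two_ne
      linear_combination (T : R) * hz - a * hvR
    have e2 : (a : R) = T * (z * b ^ 6) + 2 * (-w * a) := by
      linear_combination b ^ 6 * e1 - a * hwR
    set p := z * b ^ 6
    set q := -(w : R) * a
    have e3 : ((a ^ 4 : A) : R) = 2 * (v * p ^ 4 + 4 * T ^ 3 * p ^ 3 * q + 12 * T ^ 2 * p ^ 2 * q ^ 2
        + 16 * T * p * q ^ 3 + 8 * q ^ 4) := by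
      have : ((a ^ 4 : A) : R) = (a : R) ^ 4 := rfl
      rw [this, e2]
      linear_combination p ^ 4 * hvR
    obtain ⟨n, c, hc⟩ := aux_pow A (a ^ 4) _ (Algebra.IsIntegral.isIntegral _) e3
    apply hrad
    refine ⟨4 * n, ?_⟩
    rw [pow_mul, hc]
    exact J.mul_mem_right _ (Ideal.subset_span (by simp))
  have ind : ∀ k : ℕ, k ≤ 4 → ∃ p q : A, y = 2 * p + T ^ k * q := by
    intro k
    induction k with
    | zero => intro _; exact ⟨0, y, by ring⟩
    | succ k ih =>
      intro hk
      obtain ⟨p, q, hpq⟩ := ih (by omega)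
      have hR : (y : R) = 2 * p + T ^ k * q := congrArg Subtype.val hpq
      have : q ∈ J := by
        apply step q ((T : R) ^ (3 - k) * (x - p))
        have h3 : (T : R) ^ 3 = T ^ (3 - k) * T ^ k := by rw [← pow_add]; congr 1; omega
        rw [h3]
        linear_combination (T : R) ^ (3 - k) * (hy - hR)
      obtain ⟨r, s, hrs⟩ := Ideal.mem_span_pair.mp this
      refine ⟨p + T ^ k * r, s, ?_⟩
      rw [hpq, ← hrs]; ring
  obtain ⟨p, q, hpq⟩ := ind 4 le_rfl
  exact ⟨p + v * q, by rw [hpq, hv]; ring⟩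

theorem aux_torsion (K : Type*) [Field K] [NumberField K] (α : K)
    (hgen : IntermediateField.adjoin ℚ {α} = ⊤)
    (β : 𝓞 K) (hβ : (β : K) = α) (x : 𝓞 K) :
    ∃ n : ℤ, n ≠ 0 ∧ n • x ∈ Algebra.adjoin ℤ {β} := by
  have hx : (x : K) ∈ Algebra.adjoin ℚ {α} := by
    rw [← IntermediateField.adjoin_simple_toSubalgebra_of_isAlgebraic
      (Algebra.IsAlgebraic.isAlgebraic α), hgen]
    trivial
  have key : ∀ y ∈ Algebra.adjoin ℚ {α}, ∃ n : ℤ, n ≠ 0 ∧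
      ∃ a ∈ Algebra.adjoin ℤ {β}, (n : K) * y = (a : K) := by
    intro y hy
    induction hy using Algebra.adjoin_induction with
    | mem y hy =>
      obtain rfl : y = α := hy
      exact ⟨1, one_ne_zero, β, Algebra.self_mem_adjoin_singleton ℤ β, by simp [hβ]⟩
    | algebraMap r =>
      refine ⟨r.den, by exact_mod_cast r.den_ne_zero, (algebraMap ℤ (𝓞 K) r.num),
        Subalgebra.algebraMap_mem _ _, ?_⟩
      have : ((r.den * r : ℚ) : K) = ((r.num : ℚ) : K) := by rw [Rat.den_mul_eq_num]
      rw [Rat.cast_mul, Rat.cast_natCast, Rat.cast_intCast] at this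
      simp only [eq_ratCast, Int.cast_natCast, eq_intCast, map_intCast]
      exact this
    | add y z _ _ ihy ihz =>
      obtain ⟨n, hn, a, ha, h⟩ := ihy
      obtain ⟨k, hk, c, hc, h'⟩ := ihz
      refine ⟨n * k, mul_ne_zero hn hk, k • a + n • c,
        add_mem (Subalgebra.smul_mem _ ha _) (Subalgebra.smul_mem _ hc _), ?_⟩
      simp [← h, ← h']
      ring
    | mul y z _ _ ihy ihz =>
      obtain ⟨n, hn, a, ha, h⟩ := ihy
      obtain ⟨k, hk, c, hc, h'⟩ := ihz
      refine ⟨n * k, mul_ne_zero hn hk, a * c, mul_mem ha hc, ?_⟩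
      simp [← h, ← h']
      ring
  obtain ⟨n, hn, a, ha, h⟩ := key _ hx
  refine ⟨n, hn, ?_⟩
  convert ha
  apply RingOfIntegers.ext
  simpa using h


/-- Let `m` be a squarefree rational integer with `m ∉ {0, 1, -1}`, `α` a root of the
irreducible polynomial `x^12 − m`, `K = ℚ(α)`, `Z_K` its ring of integers. If
`m ≡ 3 (mod 4)`, then `2` does not divide the index `(Z_K : ℤ[α])`. -/
theorem two_not_dvd_index_of_three_mod_four (m : ℤ) (hsf : Squarefree m)
    (h0 : m ≠ 0) (h1 : m ≠ 1) (h2 : m ≠ -1)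
    (K : Type*) [Field K] [NumberField K] (α : K)
    (hroot : α ^ 12 = (m : K))
    (hgen : IntermediateField.adjoin ℚ {α} = ⊤)
    (β : 𝓞 K) (hβ : (β : K) = α)
    (hmod : m ≡ 3 [ZMOD 4]) :
    ¬ 2 ∣ ((Algebra.adjoin ℤ {β}).toSubring.toAddSubgroup.index) := by
  intro hdvd
  obtain ⟨t, ht⟩ : ∃ t : ℤ, m = 4 * t + 3 := ⟨m / 4, by have := hmod; unfold Int.ModEq at this; omega⟩
  have hb : β ^ 12 = 4 * (t : 𝓞 K) + 3 := by
    apply RingOfIntegers.ext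
    have : (β : K) ^ 12 = 4 * t + 3 := by rw [hβ, hroot, ht]; push_cast; rfl
    simp only [map_pow, map_add, map_mul, map_ofNat, map_intCast]
    exact this
  set H := (Algebra.adjoin ℤ {β}).toSubring.toAddSubgroup with hH
  have hmem : ∀ x, x ∈ H ↔ x ∈ Algebra.adjoin ℤ {β} := fun x => Iff.rfl
  have hfg : Module.Finite ℤ (𝓞 K ⧸ H) :=
    Module.Finite.of_surjective (QuotientAddGroup.mk' H).toIntLinearMap
      (QuotientAddGroup.mk'_surjective H)
  have htors : Module.IsTorsion ℤ (𝓞 K ⧸ H) := by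
    intro x
    obtain ⟨x, rfl⟩ := QuotientAddGroup.mk'_surjective H x
    obtain ⟨n, hn, h⟩ := aux_torsion K α hgen β hβ x
    refine ⟨⟨n, mem_nonZeroDivisors_of_ne_zero hn⟩, ?_⟩
    change n • (QuotientAddGroup.mk' H x) = 0
    rw [← map_zsmul]
    exact (QuotientAddGroup.eq_zero_iff _).mpr h
  have hfin : Finite (𝓞 K ⧸ H) := Module.finite_of_fg_torsion _ htors
  have : Fact (Nat.Prime 2) := ⟨Nat.prime_two⟩
  obtain ⟨g, hg⟩ := exists_prime_addOrderOf_dvd_card' (G := 𝓞 K ⧸ H) 2 hdvd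
  obtain ⟨x, rfl⟩ := QuotientAddGroup.mk'_surjective H g
  have h2x : (2 : ℕ) • (QuotientAddGroup.mk' H x) = 0 := by
    rw [← hg]; exact addOrderOf_nsmul_eq_zero _
  rw [← map_nsmul] at h2x
  have h3 : (2 : ℕ) • x ∈ H := (QuotientAddGroup.eq_zero_iff _).mp h2x
  obtain ⟨c, hc⟩ := aux_main β t hb ⟨(2 : ℕ) • x, h3⟩ x (by simp)
  have h4 : (2 : 𝓞 K) * x = 2 * c := by
    have h7 : (2 : ℕ) • x = 2 * (c : 𝓞 K) := congrArg Subtype.val hc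
    rw [← h7, nsmul_eq_mul, Nat.cast_ofNat]
  have h5 : x = c := mul_left_cancel₀ two_ne_zero h4
  have h6 : QuotientAddGroup.mk' H x = 0 :=
    (QuotientAddGroup.eq_zero_iff _).mpr (h5 ▸ c.2)
  rw [h6, addOrderOf_zero] at hg
  norm_num at hg
end

section
/- Let m be a squarefree rational integer with m ∉ {0, 1, -1}, α a complex root of the irreducible polynomial x^12 − m, K = ℚ(α), and Z_K the ring of integers of K. If m ≡ 1 (mod 3) and m ≢ 1 (mod 9), then 3 does not divide the index (Z_K : ℤ[α]). -/
open Polynomial NumberField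
theorem core {R : Type*} [CommRing R] [IsDomain R] [CharZero R] (b : R) (m : ℤ) (hb : b ^ 12 = (m : R))
    (hmod3 : m ≡ 1 [ZMOD 3]) (hmod9 : ¬ m ≡ 1 [ZMOD 9]) (n : ℕ) (hn : n ≠ 0)
    (hA : ∀ y : R, (n : R) * y ∈ Algebra.adjoin ℤ {b}) (y : R)
    (hy : 3 * y ∈ Algebra.adjoin ℤ {b}) : y ∈ Algebra.adjoin ℤ {b} := by
  set A := Algebra.adjoin ℤ {b} with hAdef
  obtain ⟨u, hu⟩ : ∃ u : ℤ, m ^ 3 - m = 3 * u := by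
    obtain ⟨k, hk⟩ := hmod3.symm.dvd
    exact ⟨m * (m + 1) * k, by linear_combination m * (m+1) * hk⟩
  have hu3 : ¬ (3 : ℤ) ∣ u := by
    rintro ⟨v, rfl⟩
    obtain ⟨k, hk⟩ := hmod3.symm.dvd
    apply hmod9
    obtain rfl : m = 3 * k + 1 := by linarith
    apply Int.ModEq.symm
    rw [Int.modEq_iff_dvd]
    exact ⟨k - v + 3 * k ^ 3 + 3 * k ^ 2, by linear_combination -hu⟩
  let β : A := ⟨b, Algebra.subset_adjoin rfl⟩
  have hβ : β ^ 12 = (m : A) := by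
    apply Subtype.ext; simpa using hb
  let π : A := β ^ 4 - m
  have huA : (m : A) ^ 3 - m = 3 * u := by exact_mod_cast congrArg (Int.cast : ℤ → A) hu
  let w : A := u + m * π ^ 2 + m ^ 2 * π
  have h3w : 3 * w = - π ^ 3 := by
    simp only [w, π]
    linear_combination -huA + hβ
  have hπ0 : π ≠ 0 := by
    intro h
    rw [h] at h3w
    have hu0 : (3 : A) * (u : A) = 0 := by simpa [w, h] using h3w
    have h3 : ((3 * u : ℤ) : A) = 0 := by push_cast; exact hu0
    have h4 : (3 * u : ℤ) = 0 := by
      have := congrArg (Subtype.val) h3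
      have h5 : ((3 * u : ℤ) : R) = 0 := by simpa using this
      exact_mod_cast h5
    exact hu3 (by simp at h4; simp [h4])
  let I : Ideal A := Ideal.span {π, 3}
  have hπI : π ∈ I := Ideal.subset_span (by simp)
  have h3I : (3 : A) ∈ I := Ideal.subset_span (by simp)
  have hcop : ∀ (s : ℤ) (a : A), ¬ (3 : ℤ) ∣ s → (s : A) * a ∈ I → a ∈ I := by
    intro s a hs ha
    have : IsCoprime (3 : ℤ) s := (Int.prime_three.coprime_iff_not_dvd).2 hs
    obtain ⟨p, q, hpq⟩ := this
    have e : (p : A) * 3 + q * s = 1 := by exact_mod_cast congrArg (Int.cast : ℤ → A) hpq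
    have : a = p * a * 3 + q * (s * a) := by linear_combination -a * e
    rw [this]
    exact I.add_mem (I.mul_mem_left _ h3I) (I.mul_mem_left _ ha)
  have hfrob : ∀ a : A, (Ideal.Quotient.mk I a) ^ 9 = Ideal.Quotient.mk I a := by
    have h3q : (3 : A ⧸ I) = 0 := by
      exact Ideal.Quotient.eq_zero_iff_mem.2 h3I
    rintro ⟨a, ha⟩
    induction ha using Algebra.adjoin_induction with
    | mem x hx =>
      obtain rfl : x = b := hx
      change (Ideal.Quotient.mk I β) ^ 9 = Ideal.Quotient.mk I β
      rw [← map_pow, Ideal.Quotient.eq]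
      obtain ⟨k, hk⟩ := hmod3.symm.dvd
      have e : (m : A) - 1 = 3 * k := by exact_mod_cast congrArg (Int.cast : ℤ → A) hk
      have : β ^ 9 - β = (β * (β ^ 4 + m)) * π + (β * (m + 1) * k) * 3 := by
        simp only [π]; linear_combination β * (m + 1) * e
      rw [this]
      exact I.add_mem (I.mul_mem_left _ hπI) (I.mul_mem_left _ h3I)
    | algebraMap r =>
      change (Ideal.Quotient.mk I (r : A)) ^ 9 = Ideal.Quotient.mk I (r : A)
      rw [← map_pow, Ideal.Quotient.eq]
      have : (3 : ℤ) ∣ r ^ 9 - r := by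
        apply (ZMod.intCast_zmod_eq_zero_iff_dvd _ 3).1
        push_cast
        generalize (r : ZMod 3) = t
        revert t; decide
      obtain ⟨k, hk⟩ := this
      have e : (r : A) ^ 9 - r = 3 * k := by exact_mod_cast congrArg (Int.cast : ℤ → A) hk
      rw [e]
      exact I.mul_mem_right _ h3I
    | add x y hx hy ihx ihy =>
      have e : (Ideal.Quotient.mk I ⟨x + y, add_mem hx hy⟩) =
        Ideal.Quotient.mk I ⟨x, hx⟩ + Ideal.Quotient.mk I ⟨y, hy⟩ := by
        rw [← map_add]; rfl
      have hc : ∀ s t : A ⧸ I, (s + t) ^ 3 = s ^ 3 + t ^ 3 := by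
        intro s t; linear_combination (s * t * (s + t)) * h3q
      rw [e]
      generalize Ideal.Quotient.mk I ⟨x, hx⟩ = s at *
      generalize Ideal.Quotient.mk I ⟨y, hy⟩ = t at *
      calc (s + t) ^ 9 = ((s + t) ^ 3) ^ 3 := by ring
        _ = s ^ 9 + t ^ 9 := by rw [hc, hc]; ring
        _ = _ := by rw [ihx, ihy]
    | mul x y hx hy ihx ihy =>
      have e : (Ideal.Quotient.mk I ⟨x * y, mul_mem hx hy⟩) =
        Ideal.Quotient.mk I ⟨x, hx⟩ * Ideal.Quotient.mk I ⟨y, hy⟩ := by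
        rw [← map_mul]; rfl
      rw [e, mul_pow, ihx, ihy]
  have hfrobk : ∀ (k : ℕ) (a : A), (Ideal.Quotient.mk I a) ^ (9 ^ k) = Ideal.Quotient.mk I a := by
    intro k a
    induction k with
    | zero => simp
    | succ k ih => rw [pow_succ, pow_mul, ih, hfrob]
  have h3wR : (3 : R) * (w : R) = - (π : R) ^ 3 := by
    exact congrArg Subtype.val h3w
  have hπR : (π : R) ≠ 0 := fun h => hπ0 (Subtype.ext h)
  have claim : ∀ (a : A) (z : R), (a : R) = π * z → a ∈ I := by
    intro a z haz
    obtain ⟨r, s, hns, hs⟩ := Nat.exists_eq_pow_mul_and_not_dvd hn 3 (by norm_num)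
    have h1 : (a : R) ^ 3 = 3 * (-(w : R) * z ^ 3) := by
      rw [haz]; linear_combination z ^ 3 * h3wR
    have hle : 3 * (r + 1) ≤ 9 ^ (r + 1) := by
      have : r + 1 < 3 ^ (r + 1) := Nat.lt_pow_self (by norm_num)
      have h33 : 3 ≤ 3 ^ (r + 1) := by
        calc 3 = 3 ^ 1 := by norm_num
          _ ≤ _ := Nat.pow_le_pow_right (by norm_num) (by omega)
      calc 3 * (r + 1) ≤ 3 ^ (r+1) * 3 ^ (r+1) := by gcongr
        _ = 9 ^ (r+1) := by rw [← mul_pow]; norm_num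
    obtain ⟨d, hd⟩ := Nat.exists_eq_add_of_le hle
    have h2 : (a : R) ^ (9 ^ (r + 1)) = 3 ^ (r + 1) * ((-(w : R) * z ^ 3) ^ (r + 1) * a ^ d) := by
      rw [hd, pow_add, pow_mul, h1, mul_pow]; ring
    set t := ((-(w : R) * z ^ 3) ^ (r + 1) * a ^ d)
    have h4 : ((s : ℤ) : A) * a ^ (9 ^ (r + 1)) = 3 * ⟨(n : R) * t, hA t⟩ := by
      apply Subtype.ext
      push_cast
      rw [h2, hs, show ((3 : A) : R) = 3 from rfl]; push_cast; ring
    have h5 : a ^ (9 ^ (r+1)) ∈ I := by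
      apply hcop s _ (by exact_mod_cast hns)
      rw [h4]; exact I.mul_mem_right _ h3I
    rw [← Ideal.Quotient.eq_zero_iff_mem] at h5 ⊢
    rw [← hfrobk (r+1) a, ← map_pow, h5]
  have hw : ∀ a : A, w * a ∈ I → a ∈ I := by
    intro a ha
    apply hcop u a hu3
    have : (u : A) * a = w * a - ((m * π + m ^ 2) * a) * π := by simp only [w]; ring
    rw [this]
    exact I.sub_mem ha (I.mul_mem_left _ hπI)
  have mem : ∀ a : A, a ∈ I → ∃ c d : A, a = c * π + d * 3 := by
    intro a ha
    obtain ⟨c, d, h⟩ := Ideal.mem_span_pair.1 ha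
    exact ⟨c, d, h.symm⟩
  let z : A := ⟨3 * y, hy⟩
  have hz : z ∈ I := by
    apply hw
    apply claim _ (-(π : R) ^ 2 * y)
    push_cast
    simp only [z]
    linear_combination y * h3wR
  obtain ⟨a1, b1, e1⟩ := mem z hz
  have e1R : 3 * y = a1 * π + b1 * 3 := congrArg Subtype.val e1
  have ha1 : a1 ∈ I := by
    apply hw
    apply claim _ (-(π : R) * (y - b1))
    apply mul_left_cancel₀ hπR
    push_cast
    linear_combination (y - b1) * h3wR - w * e1R
  obtain ⟨a2, b2, e2⟩ := mem a1 ha1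
  have e2R : (a1 : R) = a2 * π + b2 * 3 := congrArg Subtype.val e2
  have ha2 : a2 ∈ I := by
    apply hw
    apply claim _ (-(y - b1 - b2 * π))
    apply mul_left_cancel₀ (pow_ne_zero 2 hπR)
    push_cast
    linear_combination (y - b1 - b2 * π) * h3wR - w * e1R - w * π * e2R
  obtain ⟨a3, b3, e3⟩ := mem a2 ha2
  have e3R : (a2 : R) = a3 * π + b3 * 3 := congrArg Subtype.val e3
  have hfin : y = ((b1 + b2 * π + b3 * π ^ 2 - a3 * w : A) : R) := by
    apply mul_left_cancel₀ (by exact_mod_cast (by norm_num : (3 : ℕ) ≠ 0) : (3 : R) ≠ 0)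
    push_cast
    linear_combination e1R + π * e2R + π ^ 2 * e3R + a3 * h3wR
  rw [hfin]
  exact Subtype.property _

/-- Let `m` be a squarefree rational integer with `m ∉ {0, 1, -1}`, `α` a root of the
irreducible polynomial `x^12 − m`, `K = ℚ(α)`, `Z_K` its ring of integers. If
`m ≡ 1 (mod 3)` and `m ≢ 1 (mod 9)`, then `3` does not divide the index `(Z_K : ℤ[α])`. -/
theorem three_not_dvd_index_of_one_mod_three (m : ℤ) (hsf : Squarefree m)
    (h0 : m ≠ 0) (h1 : m ≠ 1) (h2 : m ≠ -1)
    (K : Type*) [Field K] [NumberField K] (α : K)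
    (hroot : α ^ 12 = (m : K))
    (hgen : IntermediateField.adjoin ℚ {α} = ⊤)
    (β : 𝓞 K) (hβ : (β : K) = α)
    (hmod3 : m ≡ 1 [ZMOD 3]) (hmod9 : ¬ m ≡ 1 [ZMOD 9]) :
    ¬ 3 ∣ ((Algebra.adjoin ℤ {β}).toSubring.toAddSubgroup.index) := by
  subst hβ
  have hb : β ^ 12 = (m : 𝓞 K) := by
    apply RingOfIntegers.ext
    simpa using hroot
  have hint : IsIntegral ℤ (β : K) := RingOfIntegers.isIntegral_coe β
  have hfin : (Algebra.adjoin ℤ {β}).toSubring.toAddSubgroup.FiniteIndex := by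
    have hintQ : IsIntegral ℚ (β : K) := hint.tower_top
    have htop : Algebra.adjoin ℚ {(β : K)} = ⊤ := by
      rw [← IntermediateField.adjoin_simple_toSubalgebra_of_isAlgebraic hintQ.isAlgebraic, hgen]
      rfl
    let B : PowerBasis ℚ K := PowerBasis.ofAdjoinEqTop hintQ htop
    have hBgen : B.gen = (β : K) := PowerBasis.ofAdjoinEqTop_gen hintQ htop
    have hdint : IsIntegral ℤ (Algebra.discr ℚ B.basis) := by
      apply Algebra.discr_isIntegral
      intro i
      rw [B.basis_eq_pow, hBgen]
      exact hint.pow _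
    obtain ⟨d, hd⟩ := IsIntegrallyClosed.isIntegral_iff.1 hdint
    have hd0 : d ≠ 0 := by
      rintro rfl
      exact Algebra.discr_not_zero_of_basis ℚ B.basis (by rw [← hd]; simp)
    let J : Ideal (𝓞 K) := Ideal.span {(d : 𝓞 K)}
    have hJ : J ≠ ⊥ := by
      simp only [J, ne_eq, Ideal.span_singleton_eq_bot]
      exact_mod_cast hd0
    have : Finite (𝓞 K ⧸ J) := J.finiteQuotientOfFreeOfNeBot hJ
    have hJf : (Submodule.toAddSubgroup J).FiniteIndex := by
      apply AddSubgroup.finiteIndex_iff_finite_quotient.2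
      exact this
    refine AddSubgroup.finiteIndex_of_le (H := Submodule.toAddSubgroup J) ?_
    intro x hx
    obtain ⟨y, rfl⟩ := Ideal.mem_span_singleton'.1 hx
    have h := Algebra.discr_mul_isIntegral_mem_adjoin ℚ (R := ℤ) (B := B)
      (by rw [hBgen]; exact hint) (z := (y : K)) (RingOfIntegers.isIntegral_coe y)
    rw [hBgen, ← hd] at h
    have hmap : (Algebra.adjoin ℤ {β}).map (IsScalarTower.toAlgHom ℤ (𝓞 K) K) =
        Algebra.adjoin ℤ {(β : K)} := by
      rw [AlgHom.map_adjoin, Set.image_singleton]; rfl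
    rw [← hmap] at h
    obtain ⟨t, ht, hte⟩ := h
    have : t = y * d := by
      apply RingOfIntegers.ext
      rw [show (t : K) = _ from hte, Algebra.smul_def]
      simp [mul_comm]
    rw [← this]
    exact ht
  intro hdvd
  have key := core β m hb hmod3 hmod9 _ hfin.index_ne_zero (by
    intro y
    have := AddSubgroup.nsmul_index_mem (Algebra.adjoin ℤ {β}).toSubring.toAddSubgroup y
    rw [nsmul_eq_mul] at this
    exact this)
  have : Fact (Nat.Prime 3) := ⟨Nat.prime_three⟩
  have := AddSubgroup.finiteIndex_iff_finite_quotient.1 hfin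
  obtain ⟨q, hq⟩ := exists_prime_addOrderOf_dvd_card'
    (G := 𝓞 K ⧸ (Algebra.adjoin ℤ {β}).toSubring.toAddSubgroup) 3 hdvd
  obtain ⟨y, rfl⟩ := QuotientAddGroup.mk_surjective q
  have h3 := addOrderOf_nsmul_eq_zero
    (y : 𝓞 K ⧸ (Algebra.adjoin ℤ {β}).toSubring.toAddSubgroup)
  rw [hq, ← QuotientAddGroup.mk_nsmul, QuotientAddGroup.eq_zero_iff, nsmul_eq_mul] at h3
  have hy : y ∈ (Algebra.adjoin ℤ {β}).toSubring.toAddSubgroup := key y (by exact_mod_cast h3)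
  rw [← QuotientAddGroup.eq_zero_iff] at hy
  rw [hy] at hq
  simp at hq
end

section
/- Let m be a squarefree rational integer with m ∉ {0, 1, -1}, α a complex root of the irreducible polynomial x^12 − m, K = ℚ(α), and Z_K the ring of integers of K. If m ≡ −1 (mod 3) and m ≢ −1 (mod 9), then 3 does not divide the index (Z_K : ℤ[α]). -/
open Polynomial NumberField

/-- `X^4+1` is squarefree modulo 3. -/
lemma sqf_aux : Squarefree (X ^ 4 + 1 : (ZMod 3)[X]) := by
  apply Polynomial.Separable.squarefree
  have hd : derivative (X ^ 4 + 1 : (ZMod 3)[X]) = X ^ 3 := by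
    have h3 : (3 : (ZMod 3)[X]) = 0 := by
      have := CharP.cast_eq_zero (ZMod 3)[X] 3
      exact_mod_cast this
    have h4 : derivative (X ^ 4 + 1 : (ZMod 3)[X]) = 4 * X ^ 3 := by
      rw [derivative_add, derivative_one, derivative_X_pow, add_zero]
      norm_num
      exact map_ofNat C 4
    rw [h4]
    linear_combination X ^ 3 * h3
  rw [Polynomial.separable_def, hd]
  exact ⟨1, -X, by ring⟩

/-- Eisenstein irreducibility of `X^12 - m`. -/
lemma irr_aux (m : ℤ) (hsf : Squarefree m) (h1 : m ≠ 1) (h2 : m ≠ -1) :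
    Irreducible (X ^ 12 - C m : ℤ[X]) := by
  have hnu : ¬ IsUnit m := by
    intro h
    rcases Int.isUnit_iff.1 h with h | h
    · exact h1 h
    · exact h2 h
  obtain ⟨p, hp, hpm⟩ := Int.exists_prime_and_dvd (n := m) (by
    intro h; exact hnu (Int.isUnit_iff_natAbs_eq.2 h))
  have hmon : (X ^ 12 - C m : ℤ[X]).Monic := monic_X_pow_sub_C m (by norm_num)
  have hdeg : (X ^ 12 - C m : ℤ[X]).natDegree = 12 := natDegree_X_pow_sub_C
  have hprime : (Ideal.span {p}).IsPrime := (Ideal.span_singleton_prime hp.ne_zero).2 hp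
  refine IsEisensteinAt.irreducible (𝓟 := Ideal.span {p}) ⟨?_, ?_, ?_⟩ hprime
    hmon.isPrimitive (by rw [hdeg]; norm_num)
  · rw [hmon.leadingCoeff]
    exact fun h => hprime.ne_top ((Ideal.eq_top_iff_one _).2 h)
  · intro n hn
    rw [hdeg] at hn
    rw [coeff_sub, coeff_X_pow, if_neg (by omega), coeff_C]
    split_ifs
    · simpa [Ideal.mem_span_singleton] using hpm
    · simp
  · simp only [coeff_sub, coeff_X_pow, coeff_C_zero, Ideal.span_singleton_pow,
      Ideal.mem_span_singleton]
    norm_num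
    intro h
    exact hp.not_isUnit (hsf p (by rwa [← pow_two]))

/-- Every element of `ℤ[β]` with a power in `γ ℤ[β]`, `γ = β^4+1`, lies in `(γ, 3)`. -/
lemma radical_aux {O : Type*} [CommRing O] [IsDomain O] [Module.IsTorsionFree ℤ O] (m : ℤ)
    (hirr : Irreducible (X ^ 12 - C m : ℤ[X])) (hmod3 : m ≡ -1 [ZMOD 3]) (β : O)
    (hβ : β ^ 12 = (m : O)) (g h : ℤ[X]) (n : ℕ)
    (hgh : (aeval β g) ^ n = (β ^ 4 + 1) * aeval β h) :
    ∃ a b : ℤ[X], aeval β g = (β ^ 4 + 1) * aeval β a + 3 * aeval β b := by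
  have hroot : aeval β (X ^ 12 - C m : ℤ[X]) = 0 := by simp [hβ]
  have hint : IsIntegral ℤ β := ⟨X ^ 12 - C m, monic_X_pow_sub_C m (by norm_num), hroot⟩
  have hmin : (X ^ 12 - C m : ℤ[X]) ∣ minpoly ℤ β := by
    obtain ⟨q, hq⟩ := minpoly.isIntegrallyClosed_dvd hint hroot
    rcases hirr.isUnit_or_isUnit hq with hu | hu
    · exact absurd hu (minpoly.not_isUnit ℤ β)
    · obtain ⟨u, rfl⟩ := hu
      exact ⟨↑u⁻¹, by rw [hq, mul_assoc, Units.mul_inv, mul_one]⟩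
  have hd : (X ^ 12 - C m : ℤ[X]) ∣ g ^ n - (X ^ 4 + 1) * h :=
    hmin.trans (minpoly.isIntegrallyClosed_dvd hint (by simp [hgh]))
  let φ := mapRingHom (Int.castRingHom (ZMod 3))
  have hm3 : (m : ZMod 3) = -1 := by
    have := (ZMod.intCast_eq_intCast_iff m (-1) 3).2 hmod3
    simpa using this
  have hf : φ (X ^ 12 - C m) = (X ^ 4 + 1) ^ 3 := by
    have h3 : (3 : (ZMod 3)[X]) = 0 := by
      have := CharP.cast_eq_zero (ZMod 3)[X] 3
      exact_mod_cast this
    have hC : φ (C m) = -1 := by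
      change Polynomial.map _ (C m) = -1
      rw [Polynomial.map_C, eq_intCast, hm3, C_neg, C_1]
    have hX : φ X = X := Polynomial.map_X _
    rw [map_sub, map_pow, hC, hX]
    linear_combination (-X ^ 8 - X ^ 4) * h3
  have hγ : φ (X ^ 4 + 1) = X ^ 4 + 1 := by simp [φ]
  have hd2 : (X ^ 4 + 1 : (ZMod 3)[X]) ∣ φ g ^ n := by
    have h1 := map_dvd φ hd
    rw [hf, map_sub, map_mul, map_pow, hγ] at h1
    have h2 := (dvd_pow_self (X ^ 4 + 1 : (ZMod 3)[X]) (by norm_num : 3 ≠ 0)).trans h1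
    exact (dvd_sub_left (dvd_mul_right _ _)).1 h2
  obtain ⟨q, hq⟩ := sqf_aux.isRadical n _ hd2
  obtain ⟨a, rfl⟩ := map_surjective _ (ZMod.ringHom_surjective (Int.castRingHom (ZMod 3))) q
  have hk : φ (g - (X ^ 4 + 1) * a) = 0 := by
    rw [map_sub, map_mul, hγ, hq, sub_eq_zero]; rfl
  have hk2 : C (3 : ℤ) ∣ g - (X ^ 4 + 1) * a := by
    rw [C_dvd_iff_dvd_coeff]
    intro i
    have := congrArg (fun r => coeff r i) hk
    simp only [φ, coe_mapRingHom, coeff_map, coeff_zero, eq_intCast] at this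
    exact (ZMod.intCast_zmod_eq_zero_iff_dvd _ 3).1 this
  obtain ⟨b, hb⟩ := hk2
  refine ⟨a, b, ?_⟩
  have := congrArg (aeval β) hb
  rw [map_sub, map_mul, map_mul, aeval_C] at this
  simp only [map_add, map_pow, aeval_X, map_one, map_ofNat] at this
  linear_combination this

/-- Integrality: if `γ x ∈ R`, some power of `γ x` lies in `γ R`. -/
lemma integral_aux {O : Type*} [CommRing O] (R : Subalgebra ℤ O) (γ x : O) (hγ : γ ∈ R)
    (hx : IsIntegral ℤ x) (hγx : γ * x ∈ R) : ∃ n : ℕ, ∃ r ∈ R, (γ * x) ^ n = γ * r := by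
  obtain ⟨p, hp, hpx⟩ := hx
  refine ⟨p.natDegree, -∑ i ∈ Finset.range p.natDegree,
    (p.coeff i : O) * (γ ^ (p.natDegree - i - 1) * (γ * x) ^ i), ?_, ?_⟩
  · refine R.neg_mem (R.sum_mem fun i _ => R.mul_mem (intCast_mem R _)
      (R.mul_mem (R.pow_mem hγ _) (R.pow_mem hγx _)))
  · have h := hpx
    rw [eval₂_eq_sum_range, Finset.sum_range_succ, hp.coeff_natDegree] at h
    simp only [map_one, one_mul] at h
    rw [mul_pow, eq_neg_of_add_eq_zero_right h, mul_neg, mul_neg, Finset.mul_sum, Finset.mul_sum]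
    congr 1
    refine Finset.sum_congr rfl fun i hi => ?_
    have hi := Finset.mem_range.1 hi
    obtain ⟨j, hj⟩ : ∃ j, p.natDegree = i + j + 1 := ⟨p.natDegree - i - 1, by omega⟩
    rw [hj, show i + j + 1 - i - 1 = j by omega]
    simp
    ring

/-- The quotient `O / ℤ[β]` has no 3-torsion. -/
lemma torsion_aux {O : Type*} [CommRing O] [IsDomain O] [CharZero O] [Algebra.IsIntegral ℤ O]
    (m : ℤ) (hirr : Irreducible (X ^ 12 - C m : ℤ[X])) (hmod3 : m ≡ -1 [ZMOD 3])
    (hmod9 : ¬ m ≡ -1 [ZMOD 9]) (β : O) (hβ : β ^ 12 = (m : O)) (x : O)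
    (hx : 3 * x ∈ Algebra.adjoin ℤ {β}) : x ∈ Algebra.adjoin ℤ {β} := by
  obtain ⟨k, hk⟩ : ∃ k, m = 3 * k - 1 := ⟨(m + 1) / 3, by rw [Int.ModEq] at hmod3; omega⟩
  have hk3 : IsCoprime (3 : ℤ) k := by
    rw [Prime.coprime_iff_not_dvd Int.prime_three]
    rintro ⟨l, rfl⟩
    apply hmod9
    rw [Int.ModEq]; omega
  set R := Algebra.adjoin ℤ {β} with hR
  have hβR : β ∈ R := Algebra.self_mem_adjoin_singleton ℤ β
  have haev : ∀ y, y ∈ R ↔ ∃ p : ℤ[X], aeval β p = y := by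
    intro y
    rw [hR, Algebra.adjoin_singleton_eq_range_aeval]; rfl
  have haevm : ∀ p : ℤ[X], aeval β p ∈ R := fun p => (haev _).2 ⟨p, rfl⟩
  obtain ⟨γ, hγ⟩ : ∃ γ, γ = β ^ 4 + 1 := ⟨_, rfl⟩
  have hγR : γ ∈ R := hγ ▸ R.add_mem (R.pow_mem hβR 4) R.one_mem
  have hβ' : β ^ 12 = 3 * (k : O) - 1 := by rw [hβ, hk]; push_cast; ring
  have hγv : γ * (γ ^ 2 - 3 * γ + 3) = 3 * k := by
    rw [hγ]; linear_combination hβ'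
  have h3R : (3 : O) ∈ R := by simpa using intCast_mem R 3
  have hkR : (k : O) ∈ R := intCast_mem R k
  have hvR : γ ^ 2 - 3 * γ + 3 ∈ R :=
    R.add_mem (R.sub_mem (R.pow_mem hγR 2) (R.mul_mem h3R hγR)) h3R
  have h30 : (3 : O) ≠ 0 := by norm_num
  have hγ0 : γ ≠ 0 := by
    rintro rfl
    have hk0 : (3 : O) * k = 0 := by rw [← hγv]; ring
    have : k = 0 := by simpa [h30] using hk0
    subst this
    have := hk3.isUnit_of_dvd' dvd_rfl (dvd_zero 3)
    rcases Int.isUnit_iff.1 this with h | h <;> omega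
  obtain ⟨u, v, huv⟩ := hk3
  have huv' : (u : O) * 3 + v * k = 1 := by exact_mod_cast congrArg (Int.cast : ℤ → O) huv
  -- key step
  have key : ∀ z : O, γ * z ∈ R → 3 * z ∈ R → z ∈ R := by
    intro z hz1 hz3
    obtain ⟨n, r, hr, hn⟩ := integral_aux R γ z hγR (Algebra.IsIntegral.isIntegral z) hz1
    obtain ⟨g, hg⟩ := (haev _).1 hz1
    obtain ⟨h, rfl⟩ := (haev _).1 hr
    obtain ⟨a, b, hab⟩ := radical_aux m hirr hmod3 β hβ g h n (by rw [hg, hn, hγ])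
    rw [hg, ← hγ] at hab
    have e : (k : O) * (z - aeval β a) = (γ ^ 2 - 3 * γ + 3) * aeval β b := by
      apply mul_left_cancel₀ hγ0
      linear_combination (k : O) * hab - aeval β b * hγv
    have e2 : z = u * (3 * z) + v * ((γ ^ 2 - 3 * γ + 3) * aeval β b + k * aeval β a) := by
      linear_combination v * e - z * huv'
    rw [e2]
    exact R.add_mem (R.mul_mem (intCast_mem R u) hz3) (R.mul_mem (intCast_mem R v)
      (R.add_mem (R.mul_mem hvR (haevm b)) (R.mul_mem hkR (haevm a))))
  have s3 : γ * (γ * (γ * x)) ∈ R := by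
    have : γ * (γ * (γ * x)) = (γ ^ 2 - γ + k) * (3 * x) := by
      linear_combination x * hγv
    rw [this]
    exact R.mul_mem (R.add_mem (R.sub_mem (R.pow_mem hγR 2) hγR) hkR) hx
  have t1 : 3 * (γ * x) ∈ R := by
    rw [mul_left_comm]; exact R.mul_mem hγR hx
  have t2 : 3 * (γ * (γ * x)) ∈ R := by
    rw [mul_left_comm]; exact R.mul_mem hγR t1
  exact key _ (key _ (key _ s3 t2) t1) hx

/-- `𝓞 K / ℤ[β]` is torsion. -/
lemma denom_aux (K : Type*) [Field K] [NumberField K] (α : K)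
    (hgen : IntermediateField.adjoin ℚ {α} = ⊤)
    (β : 𝓞 K) (hβ : (β : K) = α) (x : 𝓞 K) :
    ∃ d : ℤ, d ≠ 0 ∧ (d : 𝓞 K) * x ∈ Algebra.adjoin ℤ {β} := by
  have hα : IsIntegral ℚ α := Algebra.IsIntegral.isIntegral α
  have h1 : (x : K) ∈ Algebra.adjoin ℚ {α} := by
    rw [← IntermediateField.adjoin_simple_toSubalgebra_of_isAlgebraic hα.isAlgebraic, hgen]
    trivial
  rw [Algebra.adjoin_singleton_eq_range_aeval] at h1
  obtain ⟨p, hp⟩ := h1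
  obtain ⟨b, hb⟩ := IsLocalization.integerNormalization_map_to_map (nonZeroDivisors ℤ) p
  refine ⟨b, nonZeroDivisors.ne_zero b.2, ?_⟩
  rw [Algebra.adjoin_singleton_eq_range_aeval]
  refine ⟨IsLocalization.integerNormalization (nonZeroDivisors ℤ) p, ?_⟩
  apply RingOfIntegers.coe_injective
  have h2 := congrArg (aeval α) hb
  rw [aeval_map_algebraMap] at h2
  have hp' : aeval α p = (x : K) := hp
  have h3 : algebraMap (𝓞 K) K (aeval β (IsLocalization.integerNormalization (nonZeroDivisors ℤ) p))
    = aeval α (IsLocalization.integerNormalization (nonZeroDivisors ℤ) p) := by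
    rw [← hβ, aeval_algebraMap_apply]
  refine h3.trans (h2.trans ?_)
  rw [map_zsmul, hp']
  simp

/-- Let `m` be a squarefree rational integer with `m ∉ {0, 1, -1}`, `α` a root of the
irreducible polynomial `x^12 − m`, `K = ℚ(α)`, `Z_K` its ring of integers. If
`m ≡ −1 (mod 3)` and `m ≢ −1 (mod 9)`, then `3` does not divide the index
`(Z_K : ℤ[α])`. -/
theorem three_not_dvd_index_of_neg_one_mod_three (m : ℤ) (hsf : Squarefree m)
    (h0 : m ≠ 0) (h1 : m ≠ 1) (h2 : m ≠ -1)
    (K : Type*) [Field K] [NumberField K] (α : K)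
    (hroot : α ^ 12 = (m : K))
    (hgen : IntermediateField.adjoin ℚ {α} = ⊤)
    (β : 𝓞 K) (hβ : (β : K) = α)
    (hmod3 : m ≡ -1 [ZMOD 3]) (hmod9 : ¬ m ≡ -1 [ZMOD 9]) :
    ¬ 3 ∣ ((Algebra.adjoin ℤ {β}).toSubring.toAddSubgroup.index) := by
  have hirr := irr_aux m hsf h1 h2
  have hβ12 : β ^ 12 = (m : 𝓞 K) := by
    apply RingOfIntegers.coe_injective
    simp [hβ, hroot]
  set H := (Algebra.adjoin ℤ {β}).toSubring.toAddSubgroup with hH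
  have hmem : ∀ y, y ∈ H ↔ y ∈ Algebra.adjoin ℤ {β} := fun y => Iff.rfl
  have hfin : Finite (𝓞 K ⧸ H) := by
    have : AddGroup.FG (𝓞 K) := Module.Finite.iff_addGroup_fg.1 inferInstance
    apply AddCommGroup.finite_of_fg_isAddTorsion
    intro q
    obtain ⟨x, rfl⟩ := QuotientAddGroup.mk_surjective q
    obtain ⟨d, hd0, hd⟩ := denom_aux K α hgen β hβ x
    rw [isOfFinAddOrder_iff_zsmul_eq_zero]
    refine ⟨d, hd0, ?_⟩
    rw [← QuotientAddGroup.mk_zsmul, QuotientAddGroup.eq_zero_iff, hmem, zsmul_eq_mul]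
    exact hd
  intro hdvd
  haveI : Fact (Nat.Prime 3) := ⟨Nat.prime_three⟩
  rw [AddSubgroup.index] at hdvd
  obtain ⟨q, hq⟩ := exists_prime_addOrderOf_dvd_card' 3 hdvd
  obtain ⟨x, rfl⟩ := QuotientAddGroup.mk_surjective q
  have h3 := addOrderOf_nsmul_eq_zero (x : 𝓞 K ⧸ H)
  rw [hq, ← QuotientAddGroup.mk_nsmul, QuotientAddGroup.eq_zero_iff, hmem, nsmul_eq_mul] at h3
  have hx := torsion_aux m hirr hmod3 hmod9 β hβ12 x (by simpa using h3)
  have h0 : (x : 𝓞 K ⧸ H) = 0 := (QuotientAddGroup.eq_zero_iff x).2 hx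
  rw [h0, addOrderOf_zero] at hq
  omega
end

section
/- Let m be a squarefree rational integer with m ∉ {0, 1, -1}, α a complex root of the irreducible polynomial x^12 − m, K = ℚ(α), and Z_K the ring of integers of K. If m ≡ 1 (mod 4), then for every θ ∈ Z_K generating K over ℚ, the prime 2 divides the index (Z_K : ℤ[θ]); that is, 2 is a common index divisor of K. -/
open Polynomial NumberField

lemma aux_pow_card {K : Type*} [Field K] [NumberField K] (P : Ideal (𝓞 K)) [P.IsMaximal] (n : ℕ)
    (hn : n ≠ 0) (hP : Ideal.absNorm P = n) (x : 𝓞 K) : x ^ n - x ∈ P := by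
  let : Field (𝓞 K ⧸ P) := Ideal.Quotient.field P
  have hc : Nat.card (𝓞 K ⧸ P) = n := by
    rw [← hP, Ideal.absNorm_apply, Submodule.cardQuot_apply]
  have : Finite (𝓞 K ⧸ P) := Nat.finite_of_card_ne_zero (by omega)
  let := Fintype.ofFinite (𝓞 K ⧸ P)
  rw [← Ideal.Quotient.eq_zero_iff_mem, map_sub, map_pow, sub_eq_zero, ← hc,
    Nat.card_eq_fintype_card]
  exact FiniteField.pow_card _

lemma aux_odd {A : Type*} [CommRing A] (P : Ideal A) (hP : P ≠ ⊤) (h2 : (2 : A) ∈ P) (n : ℤ)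
    (hn : (n : A) ∈ P) : ∃ k, n = 2 * k := by
  rcases Int.even_or_odd' n with ⟨k, h | h⟩
  · exact ⟨k, h⟩
  · exfalso
    apply hP
    rw [Ideal.eq_top_iff_one]
    have : (1 : A) = (n : A) - 2 * (k : A) := by rw [h]; push_cast; ring
    rw [this]
    exact P.sub_mem hn (P.mul_mem_right _ h2)

lemma aux_repr {K : Type*} [Field K] [NumberField K] (θ : 𝓞 K)
    (h : ¬ 2 ∣ ((Algebra.adjoin ℤ {θ}).toSubring.toAddSubgroup.index)) (z : 𝓞 K) :
    ∃ g : ℤ[X], ∃ t : 𝓞 K, z = aeval θ g + 2 * t := by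
  have h1 := AddSubgroup.nsmul_index_mem (H := (Algebra.adjoin ℤ {θ}).toSubring.toAddSubgroup) z
  set N := (Algebra.adjoin ℤ {θ}).toSubring.toAddSubgroup.index
  have h2 : N • z ∈ Algebra.adjoin ℤ {θ} := h1
  rw [Algebra.adjoin_singleton_eq_range_aeval] at h2
  obtain ⟨g, hg⟩ := h2
  obtain ⟨k, hk⟩ : ∃ k, N = 2 * k + 1 := by
    exact ⟨N / 2, by omega⟩
  refine ⟨g, -(k * z), ?_⟩
  have : aeval θ g = N • z := hg
  rw [this, hk, nsmul_eq_mul]; push_cast; ring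

lemma aux_lin {A : Type*} [CommRing A] (I : Ideal A) (θ : A) (h : θ ^ 2 + θ + 1 ∈ I)
    (g : ℤ[X]) : ∃ a b : ℤ, aeval θ g - (a + b * θ) ∈ I := by
  induction g using Polynomial.induction_on with
  | C a => exact ⟨a, 0, by simp⟩
  | add p q hp hq =>
    obtain ⟨a, b, h1⟩ := hp
    obtain ⟨c, d, h2⟩ := hq
    refine ⟨a + c, b + d, ?_⟩
    have := I.add_mem h1 h2
    convert this using 1
    simp; ring
  | monomial n a hp =>
    obtain ⟨c, d, h1⟩ := hp
    refine ⟨-d, c - d, ?_⟩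
    have := I.add_mem (I.mul_mem_right θ h1) (I.mul_mem_left (d : A) h)
    convert this using 1
    simp; ring

lemma aux_quad {K : Type*} [Field K] [NumberField K] (θ : 𝓞 K)
    (h : ¬ 2 ∣ ((Algebra.adjoin ℤ {θ}).toSubring.toAddSubgroup.index))
    (P : Ideal (𝓞 K)) [hm : P.IsMaximal] (h2 : (2 : 𝓞 K) ∈ P)
    (w : 𝓞 K) (hw : w ^ 2 + w + 1 ∈ P)
    (hP : Ideal.absNorm P = 4) : θ ^ 2 + θ + 1 ∈ P := by
  have h4 := aux_pow_card P 4 (by norm_num) hP θ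
  have hf : θ * ((θ - 1) * (θ ^ 2 + θ + 1)) ∈ P := by convert h4 using 1; ring
  -- if θ is congruent to an integer then so is everything
  have key : ∀ n : ℤ, θ - n ∈ P → False := by
    intro n hn
    obtain ⟨g, t, hg⟩ := aux_repr θ h w
    have h3 : aeval θ g - ((g.eval n : ℤ) : 𝓞 K) ∈ P := by
      have := P.mem_of_dvd (Polynomial.sub_dvd_eval_sub θ (n : 𝓞 K) (g.map (algebraMap ℤ (𝓞 K)))) hn
      rw [eval_map_algebraMap] at this
      rw [Polynomial.eval_intCast_map] at this
      simpa using this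
    set N := g.eval n
    have h5 : w - N ∈ P := by
      rw [hg]
      have := P.add_mem h3 (P.mul_mem_right t h2)
      convert this using 1; ring
    have h6 : (((N ^ 2 + N + 1 : ℤ)) : 𝓞 K) ∈ P := by
      have := P.sub_mem hw (P.mul_mem_right (w + N + 1) h5)
      convert this using 1; push_cast; ring
    obtain ⟨k, hk⟩ := aux_odd P hm.ne_top h2 _ h6
    have : N ^ 2 + N = N * (N + 1) := by ring
    have := Int.even_mul_succ_self N
    obtain ⟨r, hr⟩ := this
    omega
  rcases hm.isPrime.mem_or_mem hf with h' | h'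
  · exact (key 0 (by simpa using h')).elim
  rcases hm.isPrime.mem_or_mem h' with h' | h'
  · exact (key 1 (by simpa using h')).elim
  · exact h'

lemma aux_unique {K : Type*} [Field K] [NumberField K] (θ : 𝓞 K)
    (h : ¬ 2 ∣ ((Algebra.adjoin ℤ {θ}).toSubring.toAddSubgroup.index))
    (P Q : Ideal (𝓞 K)) [hm : P.IsMaximal] [hm' : Q.IsMaximal] (h2 : (2 : 𝓞 K) ∈ P)
    (h2' : (2 : 𝓞 K) ∈ Q) (w : 𝓞 K) (hw : w ^ 2 + w + 1 ∈ P) (hw' : w ^ 2 + w + 1 ∈ Q)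
    (hP : Ideal.absNorm P = 4) (hQ : Ideal.absNorm Q = 4) : P = Q := by
  have hθ := aux_quad θ h P h2 w hw hP
  have hθ' := aux_quad θ h Q h2' w hw' hQ
  refine hm.eq_of_le hm'.ne_top ?_
  intro z hz
  obtain ⟨g, t, hg⟩ := aux_repr θ h z
  obtain ⟨a, b, hab⟩ := aux_lin (P ⊓ Q) θ ⟨hθ, hθ'⟩ g
  have h3 : (a + b * θ : 𝓞 K) ∈ P := by
    have := P.sub_mem (P.sub_mem hz hab.1) (P.mul_mem_right t h2)
    convert this using 1; rw [hg]; ring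
  have h4 : ((a ^ 2 - a * b + b ^ 2 : ℤ) : 𝓞 K) ∈ P := by
    have := P.add_mem (P.mul_mem_right (a - b - b * θ : 𝓞 K) h3) (P.mul_mem_left (b ^ 2 : 𝓞 K) hθ)
    convert this using 1; push_cast; ring
  obtain ⟨k, hk⟩ := aux_odd P hm.ne_top h2 _ h4
  have h5 : (∃ a', a = 2 * a') ∧ ∃ b', b = 2 * b' := by
    have he : Even (a ^ 2 - a * b + b ^ 2) := ⟨k, by rw [hk]; ring⟩
    have : Even a ∧ Even b := by
      clear * - he
      rcases Int.even_or_odd a with ha | ha <;> rcases Int.even_or_odd b with hb | hb <;>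
        simp_all [Int.even_add, Int.even_sub, Int.even_mul, Int.even_pow, ← Int.not_even_iff_odd]
    exact ⟨this.1.exists_two_nsmul _ |>.imp (by simp), this.2.exists_two_nsmul _ |>.imp (by simp)⟩
  obtain ⟨⟨a', rfl⟩, b', rfl⟩ := h5
  have := Q.add_mem (Q.add_mem hab.2 (Q.mul_mem_right (a' + b' * θ : 𝓞 K) h2')) (Q.mul_mem_right t h2')
  convert this using 1; rw [hg]; push_cast; ring

lemma aux_norm_form {K : Type*} [Field K] [NumberField K]
    (P : Ideal (𝓞 K)) [hm : P.IsMaximal] (h2 : (2 : 𝓞 K) ∈ P)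
    (hN : Ideal.absNorm (Ideal.span {(2 : 𝓞 K)}) = 2 ^ 12) :
    ∃ r, 1 ≤ r ∧ Ideal.absNorm P = 2 ^ r := by
  have hd : Ideal.absNorm P ∣ 2 ^ 12 := by
    rw [← hN]
    exact Ideal.absNorm_dvd_absNorm_of_le ((Ideal.span_singleton_le_iff_mem _).2 h2)
  obtain ⟨r, -, hr⟩ := (Nat.dvd_prime_pow Nat.prime_two).1 hd
  refine ⟨r, ?_, hr⟩
  by_contra hlt
  have : r = 0 := by omega
  subst this
  exact hm.ne_top (Ideal.absNorm_eq_one_iff.1 (by simpa using hr))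

lemma aux_norm_form2 {K : Type*} [Field K] [NumberField K]
    (P : Ideal (𝓞 K)) [hm : P.IsMaximal] (h2 : (2 : 𝓞 K) ∈ P)
    (hN : Ideal.absNorm (Ideal.span {(2 : 𝓞 K)}) = 2 ^ 12)
    (w : 𝓞 K) (hw : w ^ 2 + w + 1 ∈ P) :
    ∃ r, 2 ≤ r ∧ Ideal.absNorm P = 2 ^ r := by
  obtain ⟨r, h1, hr⟩ := aux_norm_form P h2 hN
  refine ⟨r, ?_, hr⟩
  by_contra hlt
  have : r = 1 := by omega
  subst this
  have h3 := aux_pow_card P 2 (by norm_num) (by simpa using hr) w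
  apply hm.ne_top
  rw [Ideal.eq_top_iff_one]
  have := P.sub_mem (P.sub_mem hw h3) (P.mul_mem_right w h2)
  convert this using 1; ring

lemma aux_sq {A : Type*} [CommRing A] (P : Ideal A) [hm : P.IsMaximal] (h2 : (2 : A) ∈ P)
    (e t : A) (he : e ∈ P) (ht : t ∉ P) (h : e ^ 2 = 2 * t) : (2 : A) ∈ P ^ 2 := by
  obtain ⟨a, p, hp, hap⟩ := hm.exists_inv ht
  have h1 : e * e ∈ P ^ 2 := by rw [sq]; exact Ideal.mul_mem_mul he he
  have h3 : 2 * p ∈ P ^ 2 := by rw [sq]; exact Ideal.mul_mem_mul h2 hp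
  have := (P ^ 2).add_mem ((P ^ 2).mul_mem_left a h1) h3
  convert this using 1
  linear_combination (-2 : A) * hap - a * h

lemma aux_coprime {A : Type*} [CommRing A] (P Q : Ideal A) [hm : P.IsMaximal] [hm' : Q.IsMaximal]
    (x : A) (hx : x ∈ P) (hx' : x ∉ Q) : IsCoprime P Q := by
  rw [Ideal.isCoprime_iff_sup_eq]
  exact hm.coprime_of_ne hm' (fun h => hx' (h ▸ hx))

lemma aux_case5 {K : Type*} [Field K] [NumberField K] (θ : 𝓞 K)
    (h : ¬ 2 ∣ ((Algebra.adjoin ℤ {θ}).toSubring.toAddSubgroup.index))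
    (hN : Ideal.absNorm (Ideal.span {(2 : 𝓞 K)}) = 2 ^ 12)
    (P Q T : Ideal (𝓞 K)) [hP : P.IsMaximal] [hQ : Q.IsMaximal] [hT : T.IsMaximal]
    (hP2 : (2 : 𝓞 K) ∈ P) (hQ2 : (2 : 𝓞 K) ∈ Q) (hT2 : (2 : 𝓞 K) ∈ T)
    (hPs : (2 : 𝓞 K) ∈ P ^ 2) (hQs : (2 : 𝓞 K) ∈ Q ^ 2) (hTs : (2 : 𝓞 K) ∈ T ^ 2)
    (hPQ : IsCoprime P Q) (hPT : IsCoprime P T) (hQT : IsCoprime Q T)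
    (w : 𝓞 K) (hwP : w ^ 2 + w + 1 ∈ P) (hwQ : w ^ 2 + w + 1 ∈ Q) (hwT : w ^ 2 + w + 1 ∈ T) :
    False := by
  have cop : ∀ I J : Ideal (𝓞 K), I.IsMaximal → IsCoprime I J → I ≠ J := by
    intro I J hI hc hIJ
    subst hIJ
    exact hI.ne_top (by simpa [Ideal.isCoprime_iff_sup_eq] using hc)
  have dv : ∀ I : Ideal (𝓞 K), 2 ∈ I → I ∣ Ideal.span {(2 : 𝓞 K)} := fun I hI =>
    Ideal.dvd_iff_le.2 ((Ideal.span_singleton_le_iff_mem _).2 hI)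
  have hd : P ^ 2 * Q ^ 2 * T ^ 2 ∣ Ideal.span {(2 : 𝓞 K)} :=
    IsCoprime.mul_dvd (IsCoprime.mul_left hPT.pow hQT.pow)
      (IsCoprime.mul_dvd hPQ.pow (dv _ hPs) (dv _ hQs)) (dv _ hTs)
  have hd' := Ideal.absNorm_dvd_absNorm_of_le (Ideal.dvd_iff_le.1 hd)
  obtain ⟨a, ha, ha'⟩ := aux_norm_form2 P hP2 hN w hwP
  obtain ⟨b, hb, hb'⟩ := aux_norm_form2 Q hQ2 hN w hwQ
  obtain ⟨c, hc, hc'⟩ := aux_norm_form2 T hT2 hN w hwT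
  rw [hN, map_mul, map_mul, map_pow, map_pow, map_pow, ha', hb', hc', ← pow_mul, ← pow_mul,
    ← pow_mul, ← pow_add, ← pow_add] at hd'
  have hle := Nat.pow_dvd_pow_iff_le_right (by norm_num) |>.1 hd'
  have h1 : ¬ (a = 2 ∧ b = 2) := by
    rintro ⟨rfl, rfl⟩
    exact cop P Q hP hPQ (aux_unique θ h P Q hP2 hQ2 w hwP hwQ ha' hb')
  omega

lemma aux_case1 {K : Type*} [Field K] [NumberField K] (θ : 𝓞 K)
    (h : ¬ 2 ∣ ((Algebra.adjoin ℤ {θ}).toSubring.toAddSubgroup.index))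
    (hN : Ideal.absNorm (Ideal.span {(2 : 𝓞 K)}) = 2 ^ 12)
    (P Q T U V : Ideal (𝓞 K)) [hP : P.IsMaximal] [hQ : Q.IsMaximal] [hT : T.IsMaximal]
    [hU : U.IsMaximal] [hV : V.IsMaximal]
    (hP2 : (2 : 𝓞 K) ∈ P) (hQ2 : (2 : 𝓞 K) ∈ Q) (hT2 : (2 : 𝓞 K) ∈ T) (hU2 : (2 : 𝓞 K) ∈ U)
    (hV2 : (2 : 𝓞 K) ∈ V)
    (hTs : (2 : 𝓞 K) ∈ T ^ 2) (hVs : (2 : 𝓞 K) ∈ V ^ 2)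
    (hPQ : IsCoprime P Q) (hPT : IsCoprime P T) (hQT : IsCoprime Q T)
    (hPU : IsCoprime P U) (hQU : IsCoprime Q U) (hTU : IsCoprime T U)
    (hPV : IsCoprime P V) (hQV : IsCoprime Q V) (hTV : IsCoprime T V) (hUV : IsCoprime U V)
    (w : 𝓞 K) (hwP : w ^ 2 + w + 1 ∈ P) (hwQ : w ^ 2 + w + 1 ∈ Q) (hwT : w ^ 2 + w + 1 ∈ T) :
    False := by
  have cop : ∀ I J : Ideal (𝓞 K), I.IsMaximal → IsCoprime I J → I ≠ J := by
    intro I J hI hc hIJ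
    subst hIJ
    exact hI.ne_top (by simpa [Ideal.isCoprime_iff_sup_eq] using hc)
  have dv : ∀ I : Ideal (𝓞 K), 2 ∈ I → I ∣ Ideal.span {(2 : 𝓞 K)} := fun I hI =>
    Ideal.dvd_iff_le.2 ((Ideal.span_singleton_le_iff_mem _).2 hI)
  have hd : P * Q * T ^ 2 * U * V ^ 2 ∣ Ideal.span {(2 : 𝓞 K)} := by
    refine IsCoprime.mul_dvd ?_ (IsCoprime.mul_dvd ?_ (IsCoprime.mul_dvd ?_ (IsCoprime.mul_dvd hPQ
      (dv _ hP2) (dv _ hQ2)) (dv _ hTs)) (dv _ hU2)) (dv _ hVs)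
    · exact ((hPV.pow_right.mul_left hQV.pow_right).mul_left hTV.pow).mul_left hUV.pow_right
    · exact (hPU.mul_left hQU).mul_left hTU.pow_left
    · exact hPT.pow_right.mul_left hQT.pow_right
  have hd' := Ideal.absNorm_dvd_absNorm_of_le (Ideal.dvd_iff_le.1 hd)
  obtain ⟨a, ha, ha'⟩ := aux_norm_form2 P hP2 hN w hwP
  obtain ⟨b, hb, hb'⟩ := aux_norm_form2 Q hQ2 hN w hwQ
  obtain ⟨c, hc, hc'⟩ := aux_norm_form2 T hT2 hN w hwT
  obtain ⟨d, hd, hdd⟩ := aux_norm_form U hU2 hN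
  obtain ⟨e, he, hee⟩ := aux_norm_form V hV2 hN
  rw [hN, map_mul, map_mul, map_mul, map_mul, map_pow, map_pow, ha', hb', hc', hdd, hee,
    ← pow_mul, ← pow_mul, ← pow_add, ← pow_add, ← pow_add, ← pow_add] at hd'
  have hle := Nat.pow_dvd_pow_iff_le_right (by norm_num) |>.1 hd'
  have h1 : ¬ (a = 2 ∧ b = 2) := by
    rintro ⟨rfl, rfl⟩
    exact cop P Q hP hPQ (aux_unique θ h P Q hP2 hQ2 w hwP hwQ ha' hb')
  have h3 : ¬ (a = 2 ∧ c = 2) := by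
    rintro ⟨rfl, rfl⟩
    exact cop P T hP hPT (aux_unique θ h P T hP2 hT2 w hwP hwT ha' hc')
  have h4 : ¬ (b = 2 ∧ c = 2) := by
    rintro ⟨rfl, rfl⟩
    exact cop Q T hQ hQT (aux_unique θ h Q T hQ2 hT2 w hwQ hwT hb' hc')
  omega

lemma aux_ker_max {K : Type*} [Field K] [NumberField K] {k : Type*} [Field k] [CharP k 2]
    (f : 𝓞 K →+* k) : (RingHom.ker f).IsMaximal ∧ (2 : 𝓞 K) ∈ RingHom.ker f := by
  have h2 : (2 : 𝓞 K) ∈ RingHom.ker f := by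
    rw [RingHom.mem_ker, map_ofNat]; exact CharTwo.two_eq_zero
  refine ⟨Ideal.IsPrime.isMaximal (RingHom.ker_isPrime f) ?_, h2⟩
  intro h
  rw [h, Ideal.mem_bot] at h2
  exact two_ne_zero h2

lemma aux_ker_cop {K : Type*} [Field K] [NumberField K] {k : Type*} [Field k] [CharP k 2]
    (f g : 𝓞 K →+* k) (x : 𝓞 K) (hx : f x = 0) (hx' : g x ≠ 0) :
    IsCoprime (RingHom.ker f) (RingHom.ker g) := by
  have := (aux_ker_max f).1
  have := (aux_ker_max g).1
  exact aux_coprime _ _ x hx hx'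

lemma aux_intCast {k : Type*} [Field k] [CharP k 2] (c : ℤ) :
    (Even c → (c : k) = 0) ∧ (Odd c → (c : k) = 1) := by
  have h2 : (2 : k) = 0 := CharTwo.two_eq_zero
  constructor
  · rintro ⟨r, rfl⟩; push_cast; linear_combination (r : k) * h2
  · rintro ⟨r, rfl⟩; push_cast; linear_combination (r : k) * h2

/-- The main argument, with the embeddings abstracted. -/
lemma aux_core {K : Type*} [Field K] [NumberField K] (θ : 𝓞 K)
    (h : ¬ 2 ∣ ((Algebra.adjoin ℤ {θ}).toSubring.toAddSubgroup.index))
    (hN : Ideal.absNorm (Ideal.span {(2 : 𝓞 K)}) = 2 ^ 12)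
    {R : Type*} [CommRing R] [IsDomain R] [CharZero R] {k : Type*} [Field k] [CharP k 2]
    (F : R →+* k) (z i : R) (hz : z ^ 2 + z + 1 = 0) (hi : i ^ 2 = -1)
    (m c : ℤ) (hm : m = 1 + 4 * c) (a n : 𝓞 K) (ha : a ^ 12 = m) (hn : 2 * n = 1 + a ^ 6)
    (κ : Even c → ∃ q : 𝓞 K, 2 * q = n * (a ^ 3 - 1))
    (hex : ∃ y : R, y ^ 12 = m)
    (H : ∀ y : R, y ^ 12 = m → ∃ f : 𝓞 K →+* R, f a = y) : False := by
  have h2 : (2 : k) = 0 := CharTwo.two_eq_zero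
  have h2R : (2 : R) ≠ 0 := two_ne_zero
  have h2K : (2 : 𝓞 K) ≠ 0 := two_ne_zero
  have hnn : n ^ 2 = n + c := by
    apply mul_left_cancel₀ (mul_ne_zero h2K h2K)
    have : (m : 𝓞 K) = 1 + 4 * c := by rw [hm]; push_cast; ring
    linear_combination (2 * n + 1 + a ^ 6) * hn + ha + this - 2 * hn
  -- normalise the root
  obtain ⟨y, hy, hFy⟩ : ∃ y : R, y ^ 12 = m ∧ F y = 1 := by
    obtain ⟨y, hy⟩ := hex
    have hY : F y ^ 12 = 1 := by
      have h3 : F y ^ 12 = (m : k) := by simpa using congrArg F hy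
      rw [h3, hm]; push_cast
      linear_combination 2 * (c : k) * h2
    have hY3 : (F y ^ 3 - 1) ^ 4 = 0 := by
      linear_combination hY + (-2 * F y ^ 9 + 3 * F y ^ 6 - 2 * F y ^ 3 + 1) * h2
    have hY3' := pow_eq_zero_iff (four_ne_zero) |>.1 hY3
    have hw : F z ^ 2 + F z + 1 = 0 := by simpa using congrArg F hz
    have hz3 : z ^ 3 = 1 := by linear_combination (z - 1) * hz
    have hz12 : z ^ 12 = 1 := by linear_combination (z ^ 9 + z ^ 6 + z ^ 3 + 1) * hz3
    have hfac : (F y - 1) * ((F y - F z) * (F y + F z + 1)) = 0 := by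
      linear_combination hY3' - (F y - 1) * hw
    rcases mul_eq_zero.1 hfac with h3 | h3
    · exact ⟨y, hy, sub_eq_zero.1 h3⟩
    rcases mul_eq_zero.1 h3 with h3 | h3
    · refine ⟨y * z * z, by rw [mul_pow, mul_pow, hy, hz12, mul_one, mul_one], ?_⟩
      rw [map_mul, map_mul]
      linear_combination F z ^ 2 * h3 + (F z - 1) * hw
    · refine ⟨y * z, by rw [mul_pow, hy, hz12, mul_one], ?_⟩
      rw [map_mul]
      linear_combination F z * h3 - hw
  have hw : F z ^ 2 + F z + 1 = 0 := by simpa using congrArg F hz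
  have hFi : F i = 1 := by
    have : F i ^ 2 = -1 := by simpa using congrArg F hi
    have : (F i - 1) ^ 2 = 0 := by linear_combination this - F i * h2
    exact sub_eq_zero.1 (pow_eq_zero_iff (two_ne_zero) |>.1 this)
  have hz3 : z ^ 3 = 1 := by linear_combination (z - 1) * hz
  have hz12 : z ^ 12 = 1 := by linear_combination (z ^ 9 + z ^ 6 + z ^ 3 + 1) * hz3
  have hi4 : i ^ 4 = 1 := by linear_combination (i ^ 2 - 1) * hi
  have hw0 : F z ≠ 0 := by intro h0; rw [h0] at hw; simp at hw
  have hw1 : F z - 1 ≠ 0 := by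
    intro h0
    have : F z = 1 := by linear_combination h0
    rw [this] at hw
    have : (1 : k) = 0 := by linear_combination hw - h2
    exact one_ne_zero this
  -- the equation giving ramification
  have hram : (a ^ 3 - 1) ^ 2 = 2 * (n - a ^ 3) := by linear_combination - hn
  have fn : ∀ f g : 𝓞 K →+* R, f a ^ 6 = g a ^ 6 → f n = g n := by
    intro f g hfg
    apply mul_left_cancel₀ h2R
    have h3 := congrArg f hn
    have h4 := congrArg g hn
    simp only [map_mul, map_ofNat, map_add, map_one, map_pow] at h3 h4
    rw [h3, h4, hfg]
  have fn' : ∀ f g : 𝓞 K →+* R, f a ^ 6 = - g a ^ 6 → f n = 1 - g n := by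
    intro f g hfg
    apply mul_left_cancel₀ h2R
    have h3 := congrArg f hn
    have h4 := congrArg g hn
    simp only [map_mul, map_ofNat, map_add, map_one, map_pow] at h3 h4
    linear_combination h3 + h4 + hfg
  rcases Int.even_or_odd c with hc | hc
  · obtain ⟨q, hq⟩ := κ hc
    obtain ⟨d, hd⟩ := hc
    have hqq : q ^ 2 + n * q = n * d := by
      apply mul_left_cancel₀ (mul_ne_zero h2K h2K)
      have : (c : 𝓞 K) = d + d := by rw [hd]; push_cast; ring
      linear_combination (2 * q + n * (a ^ 3 - 1) + 2 * n) * hq - n ^ 2 * hn + 2 * n * hnn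
        + 2 * n * this
    -- choose y so that n maps to 1
    obtain ⟨y, f0, hy, hFy, hf0, hf0n⟩ : ∃ (y : R) (f : 𝓞 K →+* R), y ^ 12 = m ∧ F y = 1 ∧ f a = y ∧
        F (f n) = 1 := by
      obtain ⟨f, hf⟩ := H y hy
      have h3 : F (f n) * (F (f n) - 1) = 0 := by
        have h4 := congrArg (fun x => F (f x)) hnn
        simp only [map_pow, map_add, map_intCast, (aux_intCast (k := k) c).1 ⟨d, hd⟩] at h4
        linear_combination h4
      rcases mul_eq_zero.1 h3 with h3 | h3
      · have hy' : (i * y) ^ 12 = (m : R) := by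
          linear_combination i ^ 12 * hy + m * (i ^ 8 + i ^ 4 + 1) * hi4
        obtain ⟨g, hg⟩ := H (i * y) hy'
        refine ⟨i * y, g, hy', by rw [map_mul, hFi, hFy, one_mul], hg, ?_⟩
        rw [fn' g f (by
          rw [hg, hf]
          linear_combination y ^ 6 * (i ^ 4 - i ^ 2 + 1) * hi), map_sub, h3, map_one, sub_zero]
      · exact ⟨y, f, hy, hFy, hf, sub_eq_zero.1 h3⟩
    obtain ⟨f1, hf1⟩ := H (y * z) (by rw [mul_pow, hy, hz12, mul_one])
    obtain ⟨f2, hf2⟩ := H (- (y * z)) (by rw [neg_pow, mul_pow, hy, hz12]; norm_num)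
    obtain ⟨f3, hf3⟩ := H (i * y * z) (by
      linear_combination (i ^ 12 * y ^ 12) * hz12 + i ^ 12 * hy + m * (i ^ 8 + i ^ 4 + 1) * hi4)
    obtain ⟨f5, hf5⟩ := H (i * y) (by
      linear_combination i ^ 12 * hy + m * (i ^ 8 + i ^ 4 + 1) * hi4)
    have e1 : F (f1 n) = 1 := by
      rw [fn f1 f0 (by rw [hf1, hf0]; linear_combination y ^ 6 * (z ^ 3 + 1) * hz3), hf0n]
    have e2 : F (f2 n) = 1 := by
      rw [fn f2 f0 (by rw [hf2, hf0]; linear_combination y ^ 6 * (z ^ 3 + 1) * hz3), hf0n]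
    have e3 : F (f3 n) = 0 := by
      rw [fn' f3 f0 (by
        rw [hf3, hf0]
        linear_combination i ^ 6 * y ^ 6 * (z ^ 3 + 1) * hz3 + y ^ 6 * (i ^ 4 - i ^ 2 + 1) * hi),
        map_sub, hf0n, map_one, sub_self]
    have e5 : F (f5 n) = 0 := by
      rw [fn' f5 f0 (by
        rw [hf5, hf0]
        linear_combination y ^ 6 * (i ^ 4 - i ^ 2 + 1) * hi),
        map_sub, hf0n, map_one, sub_self]
    have a0 : F (f0 a) = 1 := by rw [hf0, hFy]
    have a1 : F (f1 a) = F z := by rw [hf1, map_mul, hFy, one_mul]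
    have a2 : F (f2 a) = F z := by
      rw [hf2, map_neg, map_mul, hFy, one_mul]; linear_combination - F z * h2
    have a3 : F (f3 a) = F z := by rw [hf3, map_mul, map_mul, hFy, hFi, one_mul, one_mul]
    have a5 : F (f5 a) = 1 := by rw [hf5, map_mul, hFy, hFi, one_mul]
    -- the values of q
    have hq12 : F (f2 q) = F (f1 q) + 1 := by
      have : f2 q = - f1 q - f1 n := by
        apply mul_left_cancel₀ h2R
        have h3 := congrArg f1 hq
        have h4 := congrArg f2 hq
        have h5 : f2 n = f1 n := fn f2 f1 (by rw [hf1, hf2]; ring)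
        simp only [map_mul, map_ofNat, map_sub, map_one, map_pow] at h3 h4
        rw [h5, hf2] at h4
        rw [hf1] at h3
        linear_combination h3 + h4
      rw [this, map_sub, map_neg, e1]
      linear_combination (-F (f1 q) - 1) * h2
    have hs : F (f1 q) ^ 2 + F (f1 q) = d := by
      have := congrArg (fun x => F (f1 x)) hqq
      simpa [e1] using this
    obtain ⟨x, hx1, hx2⟩ : ∃ x : 𝓞 K, F (f1 x) = 0 ∧ F (f2 x) = 1 := by
      rcases Int.even_or_odd d with hd | hd
      · rw [(aux_intCast d).1 hd] at hs
        have : F (f1 q) * (F (f1 q) + 1) = 0 := by linear_combination hs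
        rcases mul_eq_zero.1 this with h3 | h3
        · exact ⟨q, h3, by rw [hq12, h3]; ring⟩
        · exact ⟨q + 1, by simpa using h3, by
            simp only [map_add, map_one, hq12]; linear_combination h3⟩
      · rw [(aux_intCast d).2 hd] at hs
        have : (F (f1 q) - F z) * (F (f1 q) + F z + 1) = 0 := by
          linear_combination hs - hw + h2
        rcases mul_eq_zero.1 this with h3 | h3
        · exact ⟨q - a, by simpa [a1] using h3, by
            simp only [map_sub, hq12, a2]; linear_combination h3⟩
        · exact ⟨q + a + 1, by simpa [a1] using h3, by
            simp only [map_add, map_one, hq12, a2]; linear_combination h3⟩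
    have m0 := aux_ker_max (F.comp f0)
    have m1 := aux_ker_max (F.comp f1)
    have m2 := aux_ker_max (F.comp f2)
    have m3 := aux_ker_max (F.comp f3)
    have m5 := aux_ker_max (F.comp f5)
    have := m0.1
    have := m1.1
    have := m2.1
    have := m3.1
    have := m5.1
    have hwz : F z ^ 3 = 1 := by simpa using congrArg F hz3
    refine aux_case1 θ h hN (RingHom.ker (F.comp f1)) (RingHom.ker (F.comp f2))
      (RingHom.ker (F.comp f3)) (RingHom.ker (F.comp f0)) (RingHom.ker (F.comp f5))
      m1.2 m2.2 m3.2 m0.2 m5.2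
      (aux_sq _ m3.2 (a ^ 3 - 1) (n - a ^ 3) ?_ ?_ hram)
      (aux_sq _ m5.2 (a ^ 3 - 1) (n - a ^ 3) ?_ ?_ hram)
      (aux_ker_cop _ _ x ?_ ?_) (aux_ker_cop _ _ (n - 1) ?_ ?_) (aux_ker_cop _ _ (n - 1) ?_ ?_)
      (aux_ker_cop _ _ (a - 1) ?_ ?_).symm (aux_ker_cop _ _ (a - 1) ?_ ?_).symm
      (aux_ker_cop _ _ (a - 1) ?_ ?_).symm
      (aux_ker_cop _ _ (a - 1) ?_ ?_).symm (aux_ker_cop _ _ (a - 1) ?_ ?_).symm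
      (aux_ker_cop _ _ (a - 1) ?_ ?_).symm (aux_ker_cop _ _ (n - 1) ?_ ?_)
      a ?_ ?_ ?_ <;>
    simp [RingHom.mem_ker, a0, a1, a2, a3, a5, e1, e2, e3, e5, hf0n, hx1, hx2, hwz, hw, hw1]
  · have hc1 := (aux_intCast (k := k) c).2 hc
    obtain ⟨f0, hf0⟩ := H y hy
    -- choose the root of unity to match n
    obtain ⟨z, hz, hw, hw0, hw1, hf0n⟩ : ∃ z : R, z ^ 3 = 1 ∧ F z ^ 2 + F z + 1 = 0 ∧ F z ≠ 0 ∧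
        F z - 1 ≠ 0 ∧ F (f0 n) = F z := by
      have h3 : (F (f0 n) - F z) * (F (f0 n) + F z + 1) = 0 := by
        have h4 := congrArg (fun x => F (f0 x)) hnn
        simp only [map_pow, map_add, map_intCast, hc1] at h4
        linear_combination h4 - hw + (F (f0 n) + 1) * h2
      rcases mul_eq_zero.1 h3 with h3 | h3
      · exact ⟨z, hz3, hw, hw0, hw1, sub_eq_zero.1 h3⟩
      · have h5 : F (z ^ 2) = F z + 1 := by
          rw [map_pow]; linear_combination hw - (F z + 1) * h2
        refine ⟨z ^ 2, by linear_combination (z ^ 3 + 1) * hz3, ?_, ?_, ?_, ?_⟩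
        · rw [h5]; linear_combination hw + (F z + 1) * h2
        · rw [map_pow]; exact pow_ne_zero _ hw0
        · rw [h5]; simpa using hw0
        · rw [h5]; linear_combination h3 - (F z + 1) * h2
    have hz12 : z ^ 12 = 1 := by linear_combination (z ^ 9 + z ^ 6 + z ^ 3 + 1) * hz
    obtain ⟨f1, hf1⟩ := H (y * z) (by rw [mul_pow, hy, hz12, mul_one])
    obtain ⟨f2, hf2⟩ := H (y * z * z) (by rw [mul_pow, mul_pow, hy, hz12, mul_one, mul_one])
    have e1 : F (f1 n) = F z := by
      rw [fn f1 f0 (by rw [hf1, hf0]; linear_combination y ^ 6 * (z ^ 3 + 1) * hz), hf0n]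
    have e2 : F (f2 n) = F z := by
      rw [fn f2 f0 (by
        rw [hf2, hf0]
        linear_combination y ^ 6 * (z ^ 3 + 1) * (z ^ 6 + 1) * hz), hf0n]
    have a0 : F (f0 a) = 1 := by rw [hf0, hFy]
    have a1 : F (f1 a) = F z := by rw [hf1, map_mul, hFy, one_mul]
    have a2 : F (f2 a) = F z + 1 := by
      rw [hf2, map_mul, map_mul, hFy, one_mul]; linear_combination hw - (F z + 1) * h2
    have m0 := aux_ker_max (F.comp f0)
    have m1 := aux_ker_max (F.comp f1)
    have m2 := aux_ker_max (F.comp f2)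
    have := m0.1
    have := m1.1
    have := m2.1
    have hwz : F z ^ 3 = 1 := by simpa using congrArg F hz
    have hwz' : (F z + 1) ^ 3 = 1 := by
      linear_combination hwz + 3 * hw - h2
    refine aux_case5 θ h hN (RingHom.ker (F.comp f0)) (RingHom.ker (F.comp f1))
      (RingHom.ker (F.comp f2)) m0.2 m1.2 m2.2
      (aux_sq _ m0.2 (a ^ 3 - 1) (n - a ^ 3) ?_ ?_ hram)
      (aux_sq _ m1.2 (a ^ 3 - 1) (n - a ^ 3) ?_ ?_ hram)
      (aux_sq _ m2.2 (a ^ 3 - 1) (n - a ^ 3) ?_ ?_ hram)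
      (aux_ker_cop _ _ (a - 1) ?_ ?_) (aux_ker_cop _ _ (a - 1) ?_ ?_)
      (aux_ker_cop _ _ (a - n) ?_ ?_) n ?_ ?_ ?_ <;>
    simp [RingHom.mem_ker, a0, a1, a2, e1, e2, hf0n, hwz, hwz', hw, hw0, hw1]

lemma aux_irr (m : ℤ) (hsf : Squarefree m) (h0 : m ≠ 0) (h1 : m ≠ 1) (h2 : m ≠ -1) :
    Irreducible ((X ^ 12 - C (m : ℚ)) : ℚ[X]) := by
  have hu : ¬ IsUnit m := by rw [Int.isUnit_iff]; tauto
  obtain ⟨p, hp, hpm⟩ := WfDvdMonoid.exists_irreducible_factor hu h0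
  have hpp := hp.prime
  have hmon : (X ^ 12 - C m : ℤ[X]).Monic := monic_X_pow_sub_C m (by norm_num)
  have hdeg : (X ^ 12 - C m : ℤ[X]).natDegree = 12 := natDegree_X_pow_sub_C
  have hE : (X ^ 12 - C m : ℤ[X]).IsEisensteinAt (Ideal.span {p}) := by
    refine ⟨?_, ?_, ?_⟩
    · rw [hmon.leadingCoeff, Ideal.mem_span_singleton]
      exact fun h => hp.not_isUnit (isUnit_of_dvd_one h)
    · intro n hn
      rw [hdeg] at hn
      rw [Ideal.mem_span_singleton, coeff_sub, coeff_X_pow, coeff_C, if_neg (by omega)]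
      split_ifs
      · simpa using hpm
      · simp
    · rw [Ideal.span_singleton_pow, Ideal.mem_span_singleton]
      simp only [coeff_sub, coeff_X_pow, coeff_C]
      intro h
      have h3 : p * p ∣ m := by simpa [sq] using h
      exact hp.not_isUnit (hsf p h3)
  have hirr : Irreducible (X ^ 12 - C m : ℤ[X]) :=
    hE.irreducible ((Ideal.span_singleton_prime hpp.ne_zero).2 hpp) hmon.isPrimitive
      (by rw [hdeg]; norm_num)
  have := (hmon.irreducible_iff_irreducible_map_fraction_map (K := ℚ)).1 hirr
  simpa using this

theorem aux_main_s13 (m : ℤ) (hsf : Squarefree m)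
    (h0 : m ≠ 0) (h1 : m ≠ 1) (h2 : m ≠ -1)
    (K : Type*) [Field K] [NumberField K] (α : K)
    (hroot : α ^ 12 = (m : K))
    (hgen : IntermediateField.adjoin ℚ {α} = ⊤)
    (hmod : m ≡ 1 [ZMOD 4]) (θ : 𝓞 K) 
    (hθ : ¬ 2 ∣ ((Algebra.adjoin ℤ {θ}).toSubring.toAddSubgroup.index)) : False := by
  have hirr := aux_irr m hsf h0 h1 h2
  have hmin : X ^ 12 - C (m : ℚ) = minpoly ℚ α :=
    minpoly.eq_of_irreducible_of_monic hirr (by simp [hroot]) (monic_X_pow_sub_C _ (by norm_num))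
  have hint : IsIntegral ℤ α := ⟨X ^ 12 - C m, monic_X_pow_sub_C _ (by norm_num), by
    rw [eval₂_sub, eval₂_X_pow, eval₂_C, hroot]; simp⟩
  have hfin : Module.finrank ℚ K = 12 := by
    rw [← IntermediateField.finrank_top', ← hgen, IntermediateField.adjoin.finrank
      (Algebra.IsIntegral.isIntegral α), ← hmin]
    exact natDegree_X_pow_sub_C
  have hN : Ideal.absNorm (Ideal.span {(2 : 𝓞 K)}) = 2 ^ 12 := by
    have : (2 : 𝓞 K) = algebraMap ℤ (𝓞 K) 2 := by simp
    rw [Ideal.absNorm_span_singleton, this, Algebra.norm_algebraMap, RingOfIntegers.rank, hfin]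
    norm_num
  obtain ⟨c, hc⟩ : ∃ c, m = 1 + 4 * c := by
    obtain ⟨c, hc⟩ := hmod.symm.dvd
    exact ⟨c, by linarith⟩
  -- integral elements
  obtain ⟨a, haα⟩ : ∃ a : 𝓞 K, (a : K) = α := ⟨⟨α, hint⟩, rfl⟩
  have ha : a ^ 12 = (m : 𝓞 K) := by
    apply RingOfIntegers.ext; simpa [haα] using hroot
  have hmK : (m : K) = 1 + 4 * c := by rw [hc]; push_cast; ring
  have hn' : ((1 + α ^ 6) / 2) ^ 2 - (1 + α ^ 6) / 2 - c = 0 := by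
    field_simp; linear_combination hroot + hmK
  obtain ⟨n, hnK⟩ : ∃ n : 𝓞 K, (n : K) = (1 + α ^ 6) / 2 :=
    ⟨⟨(1 + α ^ 6) / 2, ⟨X ^ 2 - X - C c, by monicity!, by
      rw [eval₂_sub, eval₂_sub, eval₂_X_pow, eval₂_C, eval₂_X]; simpa using hn'⟩⟩, rfl⟩
  have hn : 2 * n = 1 + a ^ 6 := by
    apply RingOfIntegers.ext; simp [haα, hnK]; rw [map_ofNat]; field_simp
  have κ : Even c → ∃ q : 𝓞 K, 2 * q = n * (a ^ 3 - 1) := by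
    rintro ⟨d, hd⟩
    have hcd : (c : K) = 2 * d := by rw [hd]; push_cast; ring
    have h3 : IsIntegral (𝓞 K) ((n : K) * (α ^ 3 - 1) / 2) := by
      refine ⟨X ^ 2 + C n * X - C (n * d), by monicity!, ?_⟩
      rw [eval₂_sub, eval₂_add, eval₂_mul, eval₂_C, eval₂_C, eval₂_X_pow, eval₂_X, map_mul, map_intCast]
      have hnK' : algebraMap (𝓞 K) K n = (1 + α ^ 6) / 2 := hnK
      rw [hnK, hnK']
      linear_combination (1 + α ^ 6) / 16 * (hroot + hmK + 4 * hcd)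
    have h4 : IsIntegral ℤ ((n : K) * (α ^ 3 - 1) / 2) := isIntegral_trans _ h3
    obtain ⟨q, hq⟩ : ∃ q : 𝓞 K, (q : K) = (n : K) * (α ^ 3 - 1) / 2 := ⟨⟨_, h4⟩, rfl⟩
    refine ⟨q, ?_⟩
    apply RingOfIntegers.ext; simp [haα, hq]; rw [map_ofNat]; field_simp
  -- the ambient ring
  let Ω := AlgebraicClosure K
  let R := integralClosure ℤ Ω
  have h2R : ¬ IsUnit (2 : R) := by
    intro hu
    obtain ⟨b, hb⟩ := hu.exists_right_inv
    have hb' : (2 : Ω) * (b : Ω) = 1 := congrArg (fun x : R => (x : Ω)) hb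
    have hbi : IsIntegral ℤ (algebraMap ℚ Ω (1 / 2)) := by
      have : algebraMap ℚ Ω (1 / 2) = (b : Ω) := by
        rw [map_div₀, map_one, map_ofNat, eq_comm, eq_div_iff two_ne_zero]; linear_combination hb'
      rw [this]; exact b.2
    have := (isIntegral_algebraMap_iff (algebraMap ℚ Ω).injective).1 hbi
    obtain ⟨t, ht⟩ := IsIntegrallyClosed.isIntegral_iff.1 this
    have h5 : (2 * t : ℚ) = 1 := by simp at ht; rw [ht]; norm_num
    have h6 : 2 * t = 1 := by exact_mod_cast h5
    omega
  obtain ⟨M, hM, hM2⟩ := exists_max_ideal_of_mem_nonunits h2R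
  let _ : Field (R ⧸ M) := Ideal.Quotient.field M
  have hchar : CharP (R ⧸ M) 2 := by
    refine CharTwo.of_one_ne_zero_of_two_eq_zero one_ne_zero ?_
    have := Ideal.Quotient.eq_zero_iff_mem.2 hM2
    exact this
  obtain ⟨z', hz'⟩ := IsAlgClosed.exists_root (X ^ 2 + X + 1 : Polynomial Ω) (by
    have : (X ^ 2 + X + 1 : Polynomial Ω).degree = 2 := by compute_degree!
    rw [this]; norm_num)
  obtain ⟨i', hi'⟩ := IsAlgClosed.exists_pow_nat_eq (-1 : Ω) (n := 2) (by norm_num)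
  have hz'' : z' ^ 2 + z' + 1 = 0 := by simpa using hz'
  let z : R := ⟨z', ⟨X ^ 2 + X + 1, by monicity!, by simpa using hz'⟩⟩
  let i : R := ⟨i', ⟨X ^ 2 + 1, by monicity!, by simp [hi']⟩⟩
  have hR : CharZero R := inferInstance
  refine aux_core θ hθ hN (Ideal.Quotient.mk M) z i (Subtype.ext (hz''))
    (Subtype.ext (hi')) m c hc a n ha hn κ ?_ ?_
  · refine ⟨⟨algebraMap K Ω α, hint.map (IsScalarTower.toAlgHom ℤ K Ω)⟩, Subtype.ext ?_⟩
    have := congrArg (algebraMap K Ω) hroot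
    simpa using this
  · intro y hy
    have hy' : (y : Ω) ^ 12 = m := by simpa using congrArg (fun x : R => (x : Ω)) hy
    obtain ⟨σ, hσ⟩ := IntermediateField.exists_algHom_of_splits_of_aeval (F := ℚ) (E := K) (K := Ω)
      (x := α) (y := (y : Ω))
      (fun s => ⟨Algebra.IsIntegral.isIntegral s, IsAlgClosed.splits _⟩)
      (by rw [← hmin]; simp [hy'])
    refine ⟨((σ.restrictScalars ℤ).mapIntegralClosure : integralClosure ℤ K →ₐ[ℤ] R).toRingHom, ?_⟩
    apply Subtype.ext
    rw [← hσ, ← haα]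
    rfl

/-- Let `m` be a squarefree rational integer with `m ∉ {0, 1, -1}`, `α` a root of the
irreducible polynomial `x^12 − m`, `K = ℚ(α)`, `Z_K` its ring of integers. If
`m ≡ 1 (mod 4)`, then for every `θ ∈ Z_K` generating `K` over `ℚ`, the prime `2`
divides the index `(Z_K : ℤ[θ])`; that is, `2` is a common index divisor of `K`. -/
theorem two_common_index_divisor_of_one_mod_four (m : ℤ) (hsf : Squarefree m)
    (h0 : m ≠ 0) (h1 : m ≠ 1) (h2 : m ≠ -1)
    (K : Type*) [Field K] [NumberField K] (α : K)
    (hroot : α ^ 12 = (m : K))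
    (hgen : IntermediateField.adjoin ℚ {α} = ⊤)
    (hmod : m ≡ 1 [ZMOD 4]) :
    ∀ θ : 𝓞 K, IntermediateField.adjoin ℚ {(θ : K)} = ⊤ →
      2 ∣ ((Algebra.adjoin ℤ {θ}).toSubring.toAddSubgroup.index) := by
  intro θ _
  by_contra hθ
  exact aux_main_s13 m hsf h0 h1 h2 K α hroot hgen hmod θ hθ
end

section
/- Let m be a squarefree rational integer with m ∉ {0, 1, -1}, α a complex root of the irreducible polynomial x^12 − m, K = ℚ(α), and Z_K the ring of integers of K. If m ≡ 1 (mod 9) or m ≡ −1 (mod 9), then for every θ ∈ Z_K generating K over ℚ, the prime 3 divides the index (Z_K : ℤ[θ]); that is, 3 is a common index divisor of K. -/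
open Polynomial NumberField

namespace ThreeIndex

lemma lift_root {Ω F : Type*} [Field Ω] [IsAlgClosed Ω] [Field F] (π : 𝓞 Ω →+* F) (n : ℕ) :
    ∀ (p : (𝓞 Ω)[X]) (_ : p.Monic) (_ : p.natDegree = n) (c : F) (_ : p.eval₂ π c = 0),
      ∃ a : 𝓞 Ω, p.eval a = 0 ∧ π a = c := by
  induction n with
  | zero =>
    intro p hp hn c hc
    rw [hp.natDegree_eq_zero.1 hn] at hc
    simp at hc
  | succ n ih =>
    intro p hp hn c hc
    have hmap : (p.map (algebraMap (𝓞 Ω) Ω)).Monic := hp.map _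
    have hdeg : (p.map (algebraMap (𝓞 Ω) Ω)).degree ≠ 0 := by
      rw [hp.degree_map, degree_eq_natDegree hp.ne_zero, hn]
      exact_mod_cast Nat.succ_ne_zero n
    obtain ⟨r, hr⟩ := IsAlgClosed.exists_root _ hdeg
    have hr' : p.eval₂ (algebraMap (𝓞 Ω) Ω) r = 0 := by
      rw [eval₂_eq_eval_map]; exact hr
    have hint : IsIntegral (𝓞 Ω) r := ⟨p, hp, hr'⟩
    have hintZ : IsIntegral ℤ r := isIntegral_trans (R := ℤ) (A := 𝓞 Ω) r hint
    let a : 𝓞 Ω := ⟨r, hintZ⟩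
    have ha : p.eval a = 0 := by
      apply RingOfIntegers.coe_injective
      have := hom_eval₂ p (RingHom.id _) (algebraMap (𝓞 Ω) Ω) a
      rw [RingHom.comp_id] at this
      rw [map_zero]
      exact this.trans hr'
    obtain ⟨q, hq⟩ := dvd_iff_isRoot.2 ha
    have hqm : q.Monic := (monic_X_sub_C a).of_mul_monic_left (hq ▸ hp)
    have hqn : q.natDegree = n := by
      have := (monic_X_sub_C a).natDegree_mul hqm
      rw [← hq, hn, natDegree_X_sub_C] at this
      omega
    rw [hq, eval₂_mul] at hc
    rcases mul_eq_zero.1 hc with h | h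
    · exact ⟨a, ha, by simp at h; exact (sub_eq_zero.1 h).symm⟩
    · obtain ⟨b, hb, hb'⟩ := ih q hqm hqn c h
      exact ⟨b, by rw [hq, eval_mul, hb, mul_zero], hb'⟩

lemma exists_residue (Ω : Type*) [Field Ω] [CharZero Ω] :
    ∃ M : Ideal (𝓞 Ω), M.IsMaximal ∧ (3 : 𝓞 Ω) ∈ M := by
  have h3 : ¬ IsUnit (3 : 𝓞 Ω) := by
    rintro ⟨u, hu⟩
    have h1 : (3 : 𝓞 Ω) * (u⁻¹ : (𝓞 Ω)ˣ) = 1 := by rw [← hu]; simp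
    have h2 : (3 : Ω) * ((u⁻¹ : (𝓞 Ω)ˣ) : 𝓞 Ω) = 1 := by
      have := congrArg (algebraMap (𝓞 Ω) Ω) h1
      rwa [map_mul, map_one, map_ofNat] at this
    have h4 : algebraMap ℚ Ω (1/3) = (((u⁻¹ : (𝓞 Ω)ˣ) : 𝓞 Ω) : Ω) := by
      have : (3:Ω) ≠ 0 := by norm_num
      rw [map_div₀, map_one, map_ofNat]; field_simp; exact h2.symm
    have h5 : IsIntegral ℤ (algebraMap ℚ Ω (1/3)) := by
      rw [h4]; exact RingOfIntegers.isIntegral_coe _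
    have h6 : IsIntegral ℤ (1/3 : ℚ) :=
      (isIntegral_algebraMap_iff (algebraMap ℚ Ω).injective).1 h5
    obtain ⟨n, hn⟩ := IsIntegrallyClosed.isIntegral_iff.1 h6
    have h7 : (3 * n : ℚ) = 1 := by
      have : (n:ℚ) = 1/3 := by simpa using hn
      rw [this]; norm_num
    have h8 : 3 * n = 1 := by exact_mod_cast h7
    omega
  obtain ⟨M, hM, h⟩ := exists_max_ideal_of_mem_nonunits h3
  exact ⟨M, hM, h⟩

lemma irred (m : ℤ) (hsf : Squarefree m) (h0 : m ≠ 0) (h1 : m ≠ 1) (h2 : m ≠ -1) :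
    Irreducible (X ^ 12 - C (m : ℚ) : ℚ[X]) := by
  have hu : ¬ IsUnit m := by rw [Int.isUnit_iff]; tauto
  obtain ⟨p, hp, hpm⟩ := WfDvdMonoid.exists_irreducible_factor hu h0
  have hpp : Prime p := hp.prime
  have hm : (X ^ 12 - C m : ℤ[X]).Monic := monic_X_pow_sub_C m (by norm_num)
  have hnd : (X ^ 12 - C m : ℤ[X]).natDegree = 12 := natDegree_X_pow_sub_C
  have hE : (X ^ 12 - C m : ℤ[X]).IsEisensteinAt (Ideal.span {p}) := by
    refine ⟨?_, ?_, ?_⟩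
    · rw [hm.leadingCoeff, Ideal.mem_span_singleton]
      exact fun h => hpp.not_isUnit (isUnit_of_dvd_one h)
    · intro n hn
      rw [hnd] at hn
      rw [coeff_sub, coeff_X_pow, if_neg hn.ne, coeff_C, Ideal.mem_span_singleton]
      split_ifs
      · simpa using hpm
      · simp
    · rw [Ideal.span_singleton_pow, Ideal.mem_span_singleton]
      simp only [coeff_sub, coeff_X_pow, coeff_C]
      norm_num
      intro h
      exact hpp.not_isUnit (hsf p (by rwa [← sq]))
  have := hE.irreducible ((Ideal.span_singleton_prime hpp.ne_zero).2 hpp) hm.isPrimitive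
    (by rw [hnd]; norm_num)
  have h := (hm.irreducible_iff_irreducible_map_fraction_map (K := ℚ)).1 this
  simpa using h

lemma cubic {L : Type*} [Field L] [CharZero L] {g b s : L} (h : 3 * g = 1 + b + b ^ 2)
    (hb : b ^ 3 = 1 + 9 * s) : g ^ 3 - g ^ 2 - 3 * s * g - 3 * s ^ 2 = 0 := by
  have k : g * (b - 1) = 3 * s := by linear_combination (1/3 : L) * hb + (1/3 : L) * (b - 1) * h
  have k2 : (b - 1) ^ 2 = 3 * g - 3 * (b - 1) - 3 := by linear_combination -h
  linear_combination (-1/3 : L) * g ^ 2 * k2 + (1/3 : L) * (g * (b-1) + 3 * s) * k + g * k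

lemma cubic' {L : Type*} [Field L] [CharZero L] {g s : L} (hs : s ≠ 0)
    (h : g ^ 3 - g ^ 2 - 3 * s * g - 3 * s ^ 2 = 0) :
    ∃ b, 3 * g = 1 + b + b ^ 2 ∧ b ^ 3 = 1 + 9 * s := by
  have hg : g ≠ 0 := by
    rintro rfl
    apply hs
    have : s ^ 2 = 0 := by linear_combination (-1/3 : L) * h
    exact pow_eq_zero_iff (by norm_num) |>.1 this
  have e1 : 3 * g = 1 + (1 + 3 * s / g) + (1 + 3 * s / g) ^ 2 := by
    field_simp
    linear_combination 3 * h
  refine ⟨1 + 3 * s / g, e1, ?_⟩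
  have : g * (3 * s / g) = 3 * s := by field_simp
  linear_combination -(3 * s / g) * e1 + 3 * this

/-- the homomorphisms to the residue field -/
lemma exists_hom {K : Type*} [Field K] [NumberField K] {Ω : Type*} [Field Ω] [CharZero Ω]
    [IsAlgClosed Ω] {F : Type*} [Field F] [CharP F 3] (π : 𝓞 Ω →+* F)
    {m ε s : ℤ} (hs : s ≠ 0) (hε : ε ^ 2 = 1) (hm : m = ε * (1 + 9 * s))
    {α : K} (hmin : minpoly ℚ α = X ^ 12 - C (m : ℚ)) {A γ : 𝓞 K} (hA : (A : K) = α)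
    (hγ : 3 * γ = 1 + ε * A ^ 4 + A ^ 8) (c : F) (hc : c ^ 4 = ε) (t : F) (ht : t = 0 ∨ t = 1) :
    ∃ φ : 𝓞 K →+* F, φ A = c ∧ φ γ = t := by
  have h3 : (3 : F) = 0 := by exact_mod_cast CharP.cast_eq_zero F 3
  have hsΩ : (s : Ω) ≠ 0 := by exact_mod_cast hs
  obtain ⟨g, hg, hgt⟩ := lift_root π 3 (X ^ 3 - X ^ 2 - C (3 * (s : 𝓞 Ω)) * X - C (3 * (s : 𝓞 Ω) ^ 2))
    (by monicity!) (by compute_degree!) t (by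
      simp only [eval₂_sub, eval₂_mul, eval₂_C, eval₂_X_pow, eval₂_X]
      simp only [map_mul, map_ofNat]
      rw [h3]
      rcases ht with rfl | rfl <;> simp)
  have hgΩ : (g : Ω) ^ 3 - (g : Ω) ^ 2 - 3 * s * g - 3 * (s : Ω) ^ 2 = 0 := by
    have := congrArg (algebraMap (𝓞 Ω) Ω) hg
    simp only [eval_sub, eval_mul, eval_C, eval_X, eval_pow] at this
    simpa only [map_sub, map_mul, map_ofNat,
      map_pow, map_intCast, map_zero] using this
  obtain ⟨b0, hb1, hb2⟩ := cubic' hsΩ hgΩ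
  have hb0 : IsIntegral ℤ b0 := by
    apply IsIntegral.of_pow (n := 3) (by norm_num)
    rw [hb2]
    exact_mod_cast isIntegral_algebraMap (R := ℤ) (A := Ω) (x := 1 + 9 * s)
  obtain ⟨b, rfl⟩ : ∃ b : 𝓞 Ω, (b : Ω) = b0 := ⟨⟨b0, hb0⟩, rfl⟩
  have hb1' : 3 * g = 1 + b + b ^ 2 := by
    apply RingOfIntegers.coe_injective
    rw [map_mul, map_add, map_add, map_pow, map_one, map_ofNat]
    exact hb1
  have hπb : π b = 1 := by
    have h := congrArg π hb1'
    simp only [map_mul, map_add, map_pow, map_one, map_ofNat] at h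
    have : (π b - 1) ^ 2 = 0 := by linear_combination -h + (π g - π b) * h3
    exact sub_eq_zero.1 (pow_eq_zero_iff (by norm_num) |>.1 this)
  obtain ⟨a, ha, hac⟩ := lift_root π 4 (X ^ 4 - C ((ε : 𝓞 Ω) * b)) (by monicity!)
    (by compute_degree!) c (by
      simp only [eval₂_sub, eval₂_C, eval₂_X_pow]
      simp only [map_mul, map_intCast, hπb, hc]; ring)
  have haΩ : (a : Ω) ^ 4 = ε * b := by
    have := congrArg (algebraMap (𝓞 Ω) Ω) ha
    simp at this
    exact sub_eq_zero.1 this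
  have hεΩ : (ε : Ω) ^ 2 = 1 := by exact_mod_cast hε
  have hroot : (a : Ω) ^ 12 = m := by
    rw [hm]; push_cast
    have : (a : Ω) ^ 12 = (a ^ 4) ^ 3 := by ring
    rw [this, haΩ]
    linear_combination ε ^ 3 * hb2 + ε * (1 + 9 * s) * hεΩ
  obtain ⟨ψ, hψ⟩ := IntermediateField.exists_algHom_of_splits_of_aeval (F := ℚ) (E := K) (K := Ω)
    (x := α) (y := (a : Ω))
    (fun x => ⟨Algebra.IsIntegral.isIntegral x, IsAlgClosed.splits _⟩) (by rw [hmin]; simp [hroot])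
  let Φ : 𝓞 K →+* 𝓞 Ω := RingOfIntegers.mapRingHom (ψ : K →+* Ω)
  have hΦA : Φ A = a := by
    apply RingOfIntegers.coe_injective
    change ψ (A : K) = a
    rw [hA, hψ]
  have hΦγ : Φ γ = g := by
    have h := congrArg Φ hγ
    simp only [map_mul, map_add, map_pow, map_one, map_ofNat, hΦA, map_intCast] at h
    have ha4 : a ^ 4 = ε * b := by
      apply RingOfIntegers.coe_injective
      simpa using haΩ
    have hε' : (ε : 𝓞 Ω) ^ 2 = 1 := by exact_mod_cast hε
    have : (3 : 𝓞 Ω) * (Φ γ - g) = 0 := by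
      linear_combination h - hb1' + (a ^ 4 + ε * b + ε) * ha4 + (b + b ^ 2) * hε'
    rcases mul_eq_zero.1 this with h | h
    · exact absurd h (by norm_num)
    · exact sub_eq_zero.1 h
  exact ⟨π.comp Φ, by simp [hΦA, hac], by simp [hΦγ, hgt]⟩

end ThreeIndex
namespace ThreeIndex

lemma hom_ext_of_index {R F : Type*} [CommRing R] [Field F] [CharP F 3] (θ : R)
    (h : ¬ 3 ∣ ((Algebra.adjoin ℤ {θ}).toSubring.toAddSubgroup.index)) (φ ψ : R →+* F)
    (he : φ θ = ψ θ) : φ = ψ := by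
  ext x
  set H := (Algebra.adjoin ℤ {θ}).toSubring.toAddSubgroup
  have hx : H.index • x ∈ H := H.nsmul_index_mem x
  have key : ∀ y ∈ Algebra.adjoin ℤ {θ}, φ y = ψ y := by
    intro y hy
    induction hy using Algebra.adjoin_induction with
    | mem y hy => rw [Set.mem_singleton_iff.1 hy, he]
    | algebraMap r => simp
    | add a b _ _ ha hb => rw [map_add, map_add, ha, hb]
    | mul a b _ _ ha hb => rw [map_mul, map_mul, ha, hb]
  have h1 := key _ hx
  rw [map_nsmul, map_nsmul, nsmul_eq_mul, nsmul_eq_mul] at h1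
  exact mul_left_cancel₀ (fun h0 => h ((CharP.cast_eq_zero_iff F 3 _).1 h0)) h1

lemma ker_facts {K : Type*} [Field K] [NumberField K] (hK : Module.finrank ℚ K = 12)
    {F : Type*} [Field F] [CharP F 3] (φ : 𝓞 K →+* F) :
    (RingHom.ker φ).IsMaximal ∧ ∃ k, 1 ≤ k ∧ Ideal.absNorm (RingHom.ker φ) = 3 ^ k ∧
      ∀ x, φ x ^ 3 ^ k = φ x := by
  have h3F : (3 : F) = 0 := by exact_mod_cast CharP.cast_eq_zero F 3
  have h3 : (3 : 𝓞 K) ∈ RingHom.ker φ := by rw [RingHom.mem_ker, map_ofNat, h3F]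
  have hbot : RingHom.ker φ ≠ ⊥ := by
    intro h
    rw [h, Ideal.mem_bot] at h3
    norm_num at h3
  have hprime : (RingHom.ker φ).IsPrime := RingHom.ker_isPrime φ
  have hmax : (RingHom.ker φ).IsMaximal := hprime.isMaximal hbot
  refine ⟨hmax, ?_⟩
  have hdvd : Ideal.absNorm (RingHom.ker φ) ∣ 3 ^ 12 := by
    have h1 := Ideal.absNorm_dvd_absNorm_of_le
      ((Ideal.span_singleton_le_iff_mem _).2 h3)
    have h2 : Ideal.absNorm (Ideal.span {(3 : 𝓞 K)}) = 3 ^ 12 := by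
      have := Ideal.absNorm_span_natCast (S := 𝓞 K) 3
      rw [RingOfIntegers.rank, hK] at this
      exact_mod_cast this
    rwa [h2] at h1
  obtain ⟨k, -, hk⟩ := (Nat.dvd_prime_pow Nat.prime_three).1 hdvd
  refine ⟨k, ?_, hk, ?_⟩
  · rcases Nat.eq_zero_or_pos k with rfl | h
    · rw [pow_zero, Ideal.absNorm_eq_one_iff] at hk
      exact absurd hk hprime.ne_top
    · exact h
  · intro x
    let _ := Ideal.Quotient.field (RingHom.ker φ)
    have hcard : Nat.card (𝓞 K ⧸ RingHom.ker φ) = 3 ^ k := by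
      rw [← hk, Ideal.absNorm_apply, Submodule.cardQuot_apply]
    have : Finite (𝓞 K ⧸ RingHom.ker φ) := Nat.finite_of_card_ne_zero (by rw [hcard]; positivity)
    let _ := Fintype.ofFinite (𝓞 K ⧸ RingHom.ker φ)
    have h := FiniteField.pow_card (Ideal.Quotient.mk (RingHom.ker φ) x)
    rw [← Nat.card_eq_fintype_card, hcard, ← map_pow, Ideal.Quotient.eq, RingHom.mem_ker,
      map_sub, map_pow] at h
    exact sub_eq_zero.1 h

lemma norm_bound {K : Type*} [Field K] [NumberField K] (hK : Module.finrank ℚ K = 12)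
    {F : Type*} [Field F] [CharP F 3] {A γ : 𝓞 K} {ε : ℤ} (hε : ε ^ 2 = 1)
    (hγ : 3 * γ = 1 + ε * A ^ 4 + A ^ 8) {n : ℕ} (φ : Fin n → Bool → (𝓞 K →+* F))
    (z : Fin n → 𝓞 K) (hz : ∀ j j' t, φ j' t (z j) = 0 ↔ j' = j)
    (hA : ∀ j t, φ j t A ^ 4 = ε) (hγφ : ∀ j t, φ j t γ = if t then 1 else 0)
    (k : Fin n → Bool → ℕ) (hk : ∀ j t, Ideal.absNorm (RingHom.ker (φ j t)) = 3 ^ k j t) :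
    ∑ j, (k j true + 2 * k j false) ≤ 12 := by
  have h3F : (3 : F) = 0 := by exact_mod_cast CharP.cast_eq_zero F 3
  have h3 : ∀ j t, (3 : 𝓞 K) ∈ RingHom.ker (φ j t) := by
    intro j t; rw [RingHom.mem_ker, map_ofNat, h3F]
  let e : Fin n × Bool → ℕ := fun i => if i.2 then 1 else 2
  let P : Fin n × Bool → Ideal (𝓞 K) := fun i => RingHom.ker (φ i.1 i.2)
  have hmax : ∀ i, (P i).IsMaximal := fun i => (ker_facts hK _).1
  have hεO : (ε : 𝓞 K) ^ 2 = 1 := by exact_mod_cast hε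
  have hεF : (ε : F) ^ 2 = 1 := by rw [← Int.cast_pow, hε, Int.cast_one]
  have hdvd : ∀ i ∈ Finset.univ, P i ^ e i ∣ Ideal.span {(3 : 𝓞 K)} := by
    rintro ⟨j, t⟩ -
    rw [Ideal.dvd_span_singleton]
    cases t with
    | true => simpa [e, P] using h3 j true
    | false =>
      change (3 : 𝓞 K) ∈ P (j, false) ^ 2
      have hb : ε * A ^ 4 - 1 ∈ P (j, false) := by
        change φ j false _ = 0
        simp only [map_sub, map_mul, map_pow, map_one, map_intCast, hA]
        linear_combination hεF
      have hw : γ - ε * A ^ 4 ∉ P (j, false) := by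
        change ¬ (φ j false _ = 0)
        simp only [map_sub, map_mul, map_pow, map_intCast, hA, hγφ]
        intro h
        have : (1 : F) = 0 := by
          simp at h
          rw [h] at hεF
          simp at hεF
        exact one_ne_zero this
      obtain ⟨u, hu⟩ := (hmax (j, false)).exists_inv hw
      obtain ⟨q, hq, hu⟩ := hu
      have hsq : 3 * (γ - ε * A ^ 4) ∈ P (j, false) ^ 2 := by
        have : 3 * (γ - ε * A ^ 4) = (ε * A ^ 4 - 1) ^ 2 := by
          linear_combination hγ - A ^ 8 * hεO
        rw [this]
        exact Ideal.pow_mem_pow hb 2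
      have : (3 : 𝓞 K) = u * (3 * (γ - ε * A ^ 4)) + 3 * q := by
        linear_combination -3 * hu
      rw [this]
      refine Ideal.add_mem _ (Ideal.mul_mem_left _ _ hsq) ?_
      rw [pow_two]
      exact Ideal.mul_mem_mul (h3 j false) hq
  have hcop : Set.Pairwise (↑(Finset.univ : Finset (Fin n × Bool)))
      (Function.onFun IsCoprime fun i => P i ^ e i) := by
    rintro ⟨j, t⟩ - ⟨j', t'⟩ - hne
    apply IsCoprime.pow
    rw [Ideal.isCoprime_iff_sup_eq]
    apply Ideal.IsMaximal.coprime_of_ne (hmax _) (hmax _)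
    intro heq
    apply hne
    have hj : j' = j := by
      rw [← hz j j' t']
      change z j ∈ P (j', t')
      rw [← heq]
      exact (hz j j t).2 rfl
    subst hj
    have ht : t = t' := by
      by_contra hne
      have h1 : γ ∈ P (j', t) ↔ γ ∈ P (j', t') := by rw [heq]
      change φ j' t γ = 0 ↔ φ j' t' γ = 0 at h1
      rw [hγφ, hγφ] at h1
      cases t <;> cases t' <;> simp at h1 hne
    rw [ht]
  have hprod := Finset.prod_dvd_of_coprime hcop hdvd
  have h2 : Ideal.absNorm (Ideal.span {(3 : 𝓞 K)}) = 3 ^ 12 := by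
    have := Ideal.absNorm_span_natCast (S := 𝓞 K) 3
    rw [RingOfIntegers.rank, hK] at this
    exact_mod_cast this
  have h4 := Ideal.absNorm_dvd_absNorm_of_le (Ideal.le_of_dvd hprod)
  rw [h2, map_prod] at h4
  have h5 : ∏ i, Ideal.absNorm (P i ^ e i) = 3 ^ (∑ i : Fin n × Bool, k i.1 i.2 * e i) := by
    rw [← Finset.prod_pow_eq_pow_sum]
    refine Finset.prod_congr rfl fun i _ => ?_
    rw [map_pow, hk, ← pow_mul]
  rw [h5] at h4
  have h6 := (Nat.pow_dvd_pow_iff_le_right (by norm_num)).1 h4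
  rw [Fintype.sum_prod_type] at h6
  refine le_trans (le_of_eq ?_) h6
  refine Finset.sum_congr rfl fun j _ => ?_
  simp [e, mul_comm]

end ThreeIndex
namespace ThreeIndex

lemma exists_pow_eq_neg_one {Ω F : Type*} [Field Ω] [IsAlgClosed Ω] [Field F] (π : 𝓞 Ω →+* F)
    {n : ℕ} (hn : 0 < n) : ∃ c : F, c ^ n = -1 := by
  obtain ⟨r, hr⟩ := IsAlgClosed.exists_pow_nat_eq (-1 : Ω) hn
  have hint : IsIntegral ℤ r := IsIntegral.of_pow hn (by rw [hr]; exact isIntegral_one.neg)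
  let a : 𝓞 Ω := ⟨r, hint⟩
  have ha : a ^ n = -1 := by
    apply RingOfIntegers.coe_injective
    rw [map_pow, map_neg, map_one]
    exact hr
  exact ⟨π a, by rw [← map_pow, ha, map_neg, map_one]⟩

lemma core_one {K : Type*} [Field K] [NumberField K] (hK : Module.finrank ℚ K = 12)
    {F : Type*} [Field F] [CharP F 3] {A γ : 𝓞 K}
    (hγ : 3 * γ = 1 + ((1 : ℤ) : 𝓞 K) * A ^ 4 + A ^ 8)
    (hex : ∀ c : F, c ^ 4 = ((1 : ℤ) : F) → ∀ t : F, t = 0 ∨ t = 1 →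
      ∃ φ : 𝓞 K →+* F, φ A = c ∧ φ γ = t) (i : F) (hi : i ^ 2 = -1) (θ : 𝓞 K)
    (h : ¬ 3 ∣ ((Algebra.adjoin ℤ {θ}).toSubring.toAddSubgroup.index)) : False := by
  have h3 : (3 : F) = 0 := by exact_mod_cast CharP.cast_eq_zero F 3
  have h10 : (1 : F) ≠ 0 := one_ne_zero
  let cs : Fin 3 → F := ![1, -1, i]
  have hcs : ∀ j, cs j ^ 4 = ((1 : ℤ) : F) := by
    intro j
    fin_cases j <;> simp [cs] <;> grind
  have hex' : ∀ (j : Fin 3) (t : Bool), ∃ φ : 𝓞 K →+* F, φ A = cs j ∧ φ γ = if t then 1 else 0 :=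
    fun j t => hex _ (hcs j) _ (by cases t <;> simp)
  choose φ hφA hφγ using hex'
  choose k hk1 hk hkp using fun j t => (ker_facts hK (φ j t)).2
  have hb := norm_bound hK (by norm_num) hγ φ ![A - 1, A + 1, A ^ 2 + 1]
    (by
      intro j j' t
      fin_cases j <;> fin_cases j' <;> simp [hφA, cs] <;> grind)
    (by intro j t; rw [hφA, hcs]) hφγ k hk
  have h2 : ∀ t, 2 ≤ k 2 t := by
    intro t
    by_contra hlt
    have h1 : k 2 t = 1 := by have := hk1 2 t; omega
    have := hkp 2 t A
    rw [h1, hφA] at this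
    simp [cs] at this
    grind
  have hone : ∀ (j : Fin 2) t, k j.castSucc t = 1 := by
    have a1 := hk1 0 true
    have a2 := hk1 0 false
    have a3 := hk1 1 true
    have a4 := hk1 1 false
    have a5 := h2 true
    have a6 := h2 false
    simp only [Fin.sum_univ_three] at hb
    intro j t
    fin_cases j <;> cases t <;> simp <;> omega
  classical
  let v : Fin 2 × Bool → F := fun x => φ x.1.castSucc x.2 θ
  have hinj : Function.Injective v := by
    rintro ⟨j, t⟩ ⟨j', t'⟩ he
    have he' := hom_ext_of_index θ h _ _ he
    have e1 := congrArg (fun f => f A) he'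
    have e2 := congrArg (fun f => f γ) he'
    simp only [hφA, hφγ] at e1 e2
    have ht : t = t' := by
      cases t <;> cases t' <;> simp at e2 ⊢
    have hj : j = j' := by
      fin_cases j <;> fin_cases j' <;> simp [cs] at e1 ⊢ <;> grind
    rw [ht, hj]
  have hmem : ∀ x, v x ∈ ({0, 1, -1} : Finset F) := by
    intro x
    have := hkp x.1.castSucc x.2 θ
    rw [hone] at this
    change v x ^ 3 ^ 1 = v x at this
    have : v x * ((v x - 1) * (v x + 1)) = 0 := by linear_combination this
    simp only [Finset.mem_insert, Finset.mem_singleton]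
    rcases mul_eq_zero.1 this with h | h
    · exact Or.inl h
    · rcases mul_eq_zero.1 h with h | h
      · exact Or.inr (Or.inl (sub_eq_zero.1 h))
      · exact Or.inr (Or.inr (eq_neg_of_add_eq_zero_left h))
  have hc := Finset.card_le_card_of_injOn (s := Finset.univ) v (fun x _ => hmem x) hinj.injOn
  have hc3 : ({0, 1, -1} : Finset F).card ≤ 3 := Finset.card_le_three
  rw [Finset.card_univ, Fintype.card_prod, Fintype.card_fin, Fintype.card_bool] at hc
  omega

lemma core_neg_one {K : Type*} [Field K] [NumberField K] (hK : Module.finrank ℚ K = 12)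
    {F : Type*} [Field F] [CharP F 3] {A γ : 𝓞 K}
    (hγ : 3 * γ = 1 + ((-1 : ℤ) : 𝓞 K) * A ^ 4 + A ^ 8)
    (hex : ∀ c : F, c ^ 4 = ((-1 : ℤ) : F) → ∀ t : F, t = 0 ∨ t = 1 →
      ∃ φ : 𝓞 K →+* F, φ A = c ∧ φ γ = t) (c : F) (hc4 : c ^ 4 = -1)
    (hc2 : c ^ 2 + c - 1 = 0) (θ : 𝓞 K)
    (h : ¬ 3 ∣ ((Algebra.adjoin ℤ {θ}).toSubring.toAddSubgroup.index)) : False := by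
  have h3 : (3 : F) = 0 := by exact_mod_cast CharP.cast_eq_zero F 3
  have h10 : (1 : F) ≠ 0 := one_ne_zero
  let cs : Fin 2 → F := ![c, -c]
  have hcs : ∀ j, cs j ^ 4 = ((-1 : ℤ) : F) := by
    intro j
    fin_cases j <;> simp [cs, hc4]
    grind
  have hcs3 : ∀ j, cs j ^ 3 ≠ cs j := by
    intro j
    fin_cases j <;> simp [cs] <;> grind
  have hex' : ∀ (j : Fin 2) (t : Bool), ∃ φ : 𝓞 K →+* F, φ A = cs j ∧ φ γ = if t then 1 else 0 :=
    fun j t => hex _ (hcs j) _ (by cases t <;> simp)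
  choose φ hφA hφγ using hex'
  choose k hk1 hk hkp using fun j t => (ker_facts hK (φ j t)).2
  have hb := norm_bound hK (by norm_num) hγ φ ![A ^ 2 + A - 1, A ^ 2 - A - 1]
    (by
      intro j j' t
      fin_cases j <;> fin_cases j' <;> simp [hφA, cs] <;> grind)
    (by intro j t; rw [hφA, hcs]) hφγ k hk
  have h2 : ∀ j t, 2 ≤ k j t := by
    intro j t
    by_contra hlt
    have h1 : k j t = 1 := by have := hk1 j t; omega
    have := hkp j t A
    rw [h1, hφA] at this
    exact hcs3 j (by simpa using this)
  have htwo : ∀ j t, k j t = 2 := by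
    have a1 := h2 0 true
    have a2 := h2 0 false
    have a3 := h2 1 true
    have a4 := h2 1 false
    simp only [Fin.sum_univ_two] at hb
    intro j t
    fin_cases j <;> cases t <;> simp <;> omega
  have h9 : ∀ j t, φ j t θ ^ 9 = φ j t θ := by
    intro j t
    have := hkp j t θ
    rw [htwo] at this
    simpa using this
  have hn3 : ∀ j t, φ j t θ ^ 3 ≠ φ j t θ := by
    intro j t he
    have he' := hom_ext_of_index θ h ((frobenius F 3).comp (φ j t)) (φ j t)
      (by simpa [frobenius_def] using he)
    have e1 := congrArg (fun f => f A) he'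
    simp [frobenius_def, hφA] at e1
    exact hcs3 j e1
  classical
  let Φ : Fin 2 × Bool × Bool → (𝓞 K →+* F) := fun x =>
    if x.2.2 then (frobenius F 3).comp (φ x.1 x.2.1) else φ x.1 x.2.1
  let v : Fin 2 × Bool × Bool → F := fun x => Φ x θ
  have hinj : Function.Injective v := by
    rintro ⟨j, t, r⟩ ⟨j', t', r'⟩ he
    have he' := hom_ext_of_index θ h _ _ he
    have e1 := congrArg (fun f => f A) he'
    have e2 := congrArg (fun f => f γ) he'
    have ht : t = t' := by
      cases t <;> cases t' <;> cases r <;> cases r' <;>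
        simp [Φ, hφγ, frobenius_def] at e2 ⊢
    have hj : j = j' ∧ r = r' := by
      fin_cases j <;> fin_cases j' <;> cases r <;> cases r' <;>
        simp [Φ, hφA, cs, frobenius_def] at e1 ⊢ <;> grind
    rw [ht, hj.1, hj.2]
  let p : F[X] := X ^ 6 + X ^ 4 + X ^ 2 + 1
  have hp : p.natDegree = 6 := by simp only [p]; compute_degree!
  have hp0 : p ≠ 0 := by
    intro h0
    rw [h0] at hp
    simp at hp
  have hmem : ∀ x, v x ∈ p.roots.toFinset := by
    rintro ⟨j, t, r⟩
    rw [Multiset.mem_toFinset, mem_roots hp0]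
    have e9 := h9 j t
    have e3 := hn3 j t
    have hy : φ j t θ ^ 6 + φ j t θ ^ 4 + φ j t θ ^ 2 + 1 = 0 := by
      have : (φ j t θ ^ 3 - φ j t θ) *
          (φ j t θ ^ 6 + φ j t θ ^ 4 + φ j t θ ^ 2 + 1) = 0 := by
        linear_combination e9
      exact (mul_eq_zero.1 this).resolve_left (sub_ne_zero.2 e3)
    have hr : v (j, t, r) ^ 6 + v (j, t, r) ^ 4 + v (j, t, r) ^ 2 + 1 = 0 := by
      cases r with
      | false => exact hy
      | true =>
        have := congrArg (frobenius F 3) hy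
        simp only [map_add, map_pow, map_one, map_zero] at this
        exact this
    simpa [p, IsRoot] using hr
  have hc := Finset.card_le_card_of_injOn (s := Finset.univ) v (fun x _ => hmem x) hinj.injOn
  have hc6 : p.roots.toFinset.card ≤ 6 :=
    (Multiset.toFinset_card_le _).trans ((card_roots' p).trans hp.le)
  simp at hc
  omega

end ThreeIndex

/-- Let `m` be a squarefree rational integer with `m ∉ {0, 1, -1}`, `α` a root of the
irreducible polynomial `x^12 − m`, `K = ℚ(α)`, `Z_K` its ring of integers. If
`m ≡ ±1 (mod 9)`, then for every `θ ∈ Z_K` generating `K` over `ℚ`, the prime `3`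
divides the index `(Z_K : ℤ[θ])`; that is, `3` is a common index divisor of `K`. -/
theorem three_common_index_divisor_of_pm_one_mod_nine (m : ℤ) (hsf : Squarefree m)
    (h0 : m ≠ 0) (h1 : m ≠ 1) (h2 : m ≠ -1)
    (K : Type*) [Field K] [NumberField K] (α : K)
    (hroot : α ^ 12 = (m : K))
    (hgen : IntermediateField.adjoin ℚ {α} = ⊤)
    (hmod : m ≡ 1 [ZMOD 9] ∨ m ≡ -1 [ZMOD 9]) :
    ∀ θ : 𝓞 K, IntermediateField.adjoin ℚ {(θ : K)} = ⊤ →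
      3 ∣ ((Algebra.adjoin ℤ {θ}).toSubring.toAddSubgroup.index) := by
  intro θ _
  by_contra h
  have hmin : minpoly ℚ α = X ^ 12 - C (m : ℚ) :=
    (minpoly.eq_of_irreducible_of_monic (ThreeIndex.irred m hsf h0 h1 h2) (by simp [hroot])
      (monic_X_pow_sub_C _ (by norm_num))).symm
  have hK : Module.finrank ℚ K = 12 := by
    have := IntermediateField.adjoin.finrank (K := ℚ) (Algebra.IsIntegral.isIntegral α)
    rw [hgen, IntermediateField.finrank_top', hmin, natDegree_X_pow_sub_C] at this
    exact this
  have hAint : IsIntegral ℤ α := by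
    apply IsIntegral.of_pow (n := 12) (by norm_num)
    rw [hroot]
    exact isIntegral_algebraMap (R := ℤ) (A := K) (x := m)
  obtain ⟨A, hA⟩ : ∃ A : 𝓞 K, (A : K) = α := ⟨⟨α, hAint⟩, rfl⟩
  have hγex : ∀ ε s : ℤ, ε ^ 2 = 1 → m = ε * (1 + 9 * s) →
      ∃ γ : 𝓞 K, 3 * γ = 1 + ε * A ^ 4 + A ^ 8 := by
    intro ε s hε hm
    have hεK : (ε : K) ^ 2 = 1 := by exact_mod_cast hε
    have hmK : (m : K) = ε * (1 + 9 * s) := by rw [hm]; push_cast; ring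
    have e1 : 3 * ((1 + ε * α ^ 4 + α ^ 8) / 3) = 1 + (ε * α ^ 4) + (ε * α ^ 4) ^ 2 := by
      linear_combination -α ^ 8 * hεK
    have e2 : (ε * α ^ 4) ^ 3 = 1 + 9 * (s : K) := by
      linear_combination ε ^ 3 * hroot + ε ^ 3 * hmK + (ε ^ 2 + 1) * (1 + 9 * (s : K)) * hεK
    have e3 := ThreeIndex.cubic e1 e2
    have hint : IsIntegral ℤ ((1 + ε * α ^ 4 + α ^ 8) / 3) := by
      refine ⟨X ^ 3 - X ^ 2 - C (3 * s) * X - C (3 * s ^ 2), by monicity!, ?_⟩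
      simp only [eval₂_sub, eval₂_mul, eval₂_C, eval₂_X_pow, eval₂_X]
      simpa using e3
    refine ⟨⟨_, hint⟩, ?_⟩
    apply RingOfIntegers.coe_injective
    simp only [map_mul, map_add, map_pow, map_one, map_ofNat, map_intCast, hA]
    change 3 * ((1 + ε * α ^ 4 + α ^ 8) / 3) = _
    ring
  let Ω := AlgebraicClosure ℚ
  obtain ⟨M, hM, h3M⟩ := ThreeIndex.exists_residue Ω
  let _ : Field (𝓞 Ω ⧸ M) := Ideal.Quotient.field M
  have h3F : ((3 : ℕ) : 𝓞 Ω ⧸ M) = 0 := by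
    have := Ideal.Quotient.eq_zero_iff_mem.2 h3M
    rw [map_ofNat] at this
    exact_mod_cast this
  have : CharP (𝓞 Ω ⧸ M) 3 := by
    refine ringChar.of_eq ?_
    rcases (Nat.dvd_prime Nat.prime_three).1 (ringChar.dvd h3F) with h | h
    · exact absurd h CharP.ringChar_ne_one
    · exact h
  let π : 𝓞 Ω →+* 𝓞 Ω ⧸ M := Ideal.Quotient.mk M
  rcases hmod with hmod | hmod
  · obtain ⟨s, hs⟩ := hmod.symm.dvd
    have hs0 : s ≠ 0 := by rintro rfl; omega
    have hm : m = 1 * (1 + 9 * s) := by omega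
    obtain ⟨γ, hγ⟩ := hγex 1 s (by norm_num) hm
    obtain ⟨i, hi⟩ := ThreeIndex.exists_pow_eq_neg_one π (n := 2) (by norm_num)
    exact ThreeIndex.core_one hK hγ
      (ThreeIndex.exists_hom π hs0 (by norm_num) hm hmin hA hγ) i hi θ h
  · obtain ⟨s, hs⟩ := hmod.symm.dvd
    have hs0 : s ≠ 0 := by rintro rfl; omega
    have hm : m = -1 * (1 + 9 * (-s)) := by omega
    obtain ⟨γ, hγ⟩ := hγex (-1) (-s) (by norm_num) hm
    obtain ⟨c, hc⟩ := ThreeIndex.exists_pow_eq_neg_one π (n := 4) (by norm_num)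
    have hex := ThreeIndex.exists_hom π (neg_ne_zero.2 hs0) (by norm_num) hm hmin hA hγ
    have h3 : (3 : 𝓞 Ω ⧸ M) = 0 := by exact_mod_cast h3F
    have : (c ^ 2 + c - 1) * (c ^ 2 - c - 1) = 0 := by
      linear_combination hc - c ^ 2 * h3
    rcases mul_eq_zero.1 this with h' | h'
    · exact ThreeIndex.core_neg_one hK hγ hex c hc h' θ h
    · exact ThreeIndex.core_neg_one hK hγ hex (-c) (by linear_combination hc)
        (by linear_combination h') θ h
end

section
/- Let m be a squarefree rational integer with m ∉ {0, 1, -1}, α a complex root of the irreducible polynomial x^12 − m, K = ℚ(α), and Z_K the ring of integers of K. If m ≡ 1 (mod 8), then there are at least three distinct prime ideals of Z_K lying above 2 each having residue degree 2. -/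
open Polynomial NumberField

lemma irr_int (m : ℤ) (hsf : Squarefree m) (h1 : m ≠ 1) (h2 : m ≠ -1) (n : ℕ) (hn : 0 < n) :
    Irreducible (X ^ n - C m : ℤ[X]) := by
  have hu : ¬ IsUnit m := by
    rw [Int.isUnit_iff]; tauto
  obtain ⟨p, hp, hpm⟩ := Int.exists_prime_and_dvd (n := m) (by
    intro h; exact hu (Int.isUnit_iff_natAbs_eq.mpr h))
  have hmon : (X ^ n - C m : ℤ[X]).Monic := monic_X_pow_sub_C m hn.ne'
  have hdeg : (X ^ n - C m : ℤ[X]).natDegree = n := natDegree_X_pow_sub_C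
  have hE : (X ^ n - C m : ℤ[X]).IsEisensteinAt (Ideal.span {p}) := by
    refine ⟨?_, ?_, ?_⟩
    · rw [hmon.leadingCoeff, Ideal.mem_span_singleton]
      exact fun h => hp.not_isUnit (isUnit_of_dvd_one h)
    · intro k hk
      rw [hdeg] at hk
      rw [coeff_sub, coeff_X_pow, if_neg hk.ne, coeff_C, Ideal.mem_span_singleton]
      split_ifs
      · simpa using hpm
      · simp
    · rw [coeff_sub, coeff_X_pow, if_neg hn.ne, coeff_C_zero, Ideal.span_singleton_pow,
        Ideal.mem_span_singleton]
      intro h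
      rw [zero_sub, dvd_neg, sq] at h
      exact hp.not_isUnit (hsf p h)
  exact hE.irreducible ((Ideal.span_singleton_prime hp.ne_zero).2 hp) hmon.isPrimitive
    (by rw [hdeg]; exact hn)

lemma minpoly_int (m : ℤ) (hsf : Squarefree m) (h1 : m ≠ 1) (h2 : m ≠ -1) (n : ℕ) (hn : 0 < n)
    {E : Type*} [Field E] [NumberField E] (d : E) (hd : d ^ n = m) :
    minpoly ℚ d = (X ^ n - C m : ℤ[X]).map (algebraMap ℤ ℚ) := by
  have hmon : (X ^ n - C m : ℤ[X]).Monic := monic_X_pow_sub_C m hn.ne'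
  symm
  apply minpoly.eq_of_irreducible_of_monic
  · exact (hmon.irreducible_iff_irreducible_map_fraction_map).1 (irr_int m hsf h1 h2 n hn)
  · simp [hd]
  · exact hmon.map _

lemma exists_neg (m : ℤ) (hsf : Squarefree m) (h1 : m ≠ 1) (h2 : m ≠ -1) (n : ℕ) (hn : 0 < n)
    (hev : Even n)
    {E : Type*} [Field E] [NumberField E] (d : 𝓞 E) (hd : (d : E) ^ n = m)
    (pb : PowerBasis ℚ E) (hpb : pb.gen = d) :
    ∃ σ : 𝓞 E →+* 𝓞 E, σ d = -d := by
  have h : aeval (-d : E) (minpoly ℚ pb.gen) = 0 := by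
    rw [hpb, minpoly_int m hsf h1 h2 n hn _ hd]
    simp [hev.neg_pow, hd]
  refine ⟨RingOfIntegers.mapRingHom (pb.lift (-d : E) h).toRingHom, ?_⟩
  apply RingOfIntegers.ext
  have := pb.lift_gen (-d : E) h
  rw [hpb] at this
  simpa using this

lemma exists_prime_of_root (m : ℤ) (hsf : Squarefree m) (h1 : m ≠ 1) (h2 : m ≠ -1)
    (n : ℕ) (hn : 0 < n)
    {E : Type*} [Field E] [NumberField E] (d : 𝓞 E) (hd : (d : E) ^ n = m)
    {k : Type*} [Field k] [CharP k 2] (r : k) (hr : r ^ n = (m : k)) (t : ℤ[X])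
    (ht : aeval r t = 0) :
    ∃ Q : Ideal (𝓞 E), Q.IsPrime ∧ (2 : 𝓞 E) ∈ Q ∧ aeval d t ∈ Q := by
  have hdi : IsIntegral ℤ d := RingOfIntegers.isIntegral d
  have hmp : minpoly ℤ d = X ^ n - C m := by
    apply Polynomial.map_injective (algebraMap ℤ ℚ) (algebraMap ℤ ℚ).injective_int
    rw [← minpoly_int m hsf h1 h2 n hn _ hd, minpoly.isIntegrallyClosed_eq_field_fractions ℚ E hdi]
  let pb := Algebra.adjoin.powerBasis' hdi
  have hg : pb.gen = ⟨d, Algebra.subset_adjoin (Set.mem_singleton d)⟩ :=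
    Algebra.adjoin.powerBasis'_gen hdi
  have hgen : minpoly ℤ pb.gen = X ^ n - C m := by
    rw [← hmp]
    have := minpoly.algebraMap_eq (A := ℤ) (B := Algebra.adjoin ℤ {d}) (B' := 𝓞 E)
      Subtype.val_injective pb.gen
    rw [← this, hg]; rfl
  have h0 : aeval r (minpoly ℤ pb.gen) = 0 := by
    rw [hgen]; simp [hr]
  let φ := pb.lift r h0
  have hφ : φ pb.gen = r := pb.lift_gen r h0
  have : Algebra.IsIntegral (Algebra.adjoin ℤ {d}) (𝓞 E) := Algebra.IsIntegral.tower_top ℤ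
  have hpr : (RingHom.ker φ.toRingHom).IsPrime := RingHom.ker_isPrime _
  obtain ⟨Q, -, hQ, hQc⟩ := Ideal.exists_ideal_over_prime_of_isIntegral
    (S := 𝓞 E) (RingHom.ker φ.toRingHom) ⊥ (by
      intro x hx
      have : x = 0 := Subtype.val_injective (by simpa using hx)
      rw [this]; exact zero_mem _)
  refine ⟨Q, hQ, ?_, ?_⟩
  · have : (2 : Algebra.adjoin ℤ {d}) ∈ RingHom.ker φ.toRingHom := by
      rw [RingHom.mem_ker, map_ofNat]
      exact CharTwo.two_eq_zero
    rw [← hQc, Ideal.mem_comap, map_ofNat] at this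
    exact this
  · have : aeval pb.gen t ∈ RingHom.ker φ.toRingHom := by
      rw [RingHom.mem_ker]
      change φ (aeval pb.gen t) = 0
      rw [← aeval_algHom_apply, hφ, ht]
    rw [← hQc, Ideal.mem_comap, ← aeval_algebraMap_apply, hg] at this
    exact this

lemma half_sq {R : Type*} [CommRing R] [IsDomain R] [CharZero R] {m n : ℤ} (hn : m = 1 + 8 * n)
    {a A : R} (ha : a ^ 2 = m) (hA : 2 * A = 1 + a) : A * (A - 1) = 2 * n := by
  have h4 : (4 : R) ≠ 0 := by norm_num
  apply mul_left_cancel₀ h4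
  have : a = 2 * A - 1 := by rw [hA]; ring
  rw [this, hn] at ha
  push_cast at ha
  linear_combination ha

lemma exists_half {E : Type*} [Field E] [NumberField E] {m n : ℤ} (hn : m = 1 + 8 * n)
    (a : 𝓞 E) (ha : a ^ 2 = m) : ∃ A : 𝓞 E, 2 * A = 1 + a := by
  have haE : (a : E) ^ 2 = 1 + 8 * n := by
    have := congrArg (algebraMap (𝓞 E) E) ha
    rw [hn] at this
    simpa only [map_pow, map_intCast, Int.cast_add, Int.cast_mul, Int.cast_one, Int.cast_ofNat, map_add, map_mul, map_one, map_ofNat] using this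
  have hI : IsIntegral ℤ ((1 + (a : E)) / 2) := by
    refine ⟨X ^ 2 - X - C (2 * n), ?_, ?_⟩
    · monicity!
    · rw [eval₂_sub, eval₂_sub, eval₂_pow, eval₂_X, eval₂_C]
      simp only [map_mul, eq_intCast, map_ofNat]
      linear_combination haE / 4
  obtain ⟨A, hA⟩ : ∃ A : 𝓞 E, (A : E) = (1 + (a : E)) / 2 := ⟨⟨_, hI⟩, rfl⟩
  refine ⟨A, ?_⟩
  apply RingOfIntegers.coe_injective
  simp only [map_mul, map_ofNat, map_add, map_one, hA]
  ring

lemma levelE (m : ℤ) (hsf : Squarefree m) (h1 : m ≠ 1) (h2 : m ≠ -1) (n : ℤ) (hn : m = 1 + 8 * n)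
    {E : Type*} [Field E] [NumberField E] (d : 𝓞 E) (hd : (d : E) ^ 6 = m)
    (pb : PowerBasis ℚ E) (hpb : pb.gen = d) (A : 𝓞 E) (hA : 2 * A = 1 + d ^ 3)
    {k : Type*} [Field k] [CharP k 2] (r : k) (hr : r ^ 6 = 1) (s : ℤ[X])
    (ht : aeval (r ^ 2) s = 0) :
    ∃ Q Q' : Ideal (𝓞 E), Q.IsPrime ∧ Q'.IsPrime ∧ (2 : 𝓞 E) ∈ Q ∧ (2 : 𝓞 E) ∈ Q' ∧
      aeval (d ^ 2) s ∈ Q ∧ aeval (d ^ 2) s ∈ Q' ∧ A - 1 ∈ Q ∧ A ∈ Q' := by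
  have hm : (m : k) = 1 := by
    rw [hn]; push_cast
    have : (2 : k) = 0 := CharTwo.two_eq_zero
    linear_combination 4 * n * this
  obtain ⟨Q, hQ, h2Q, hsQ⟩ := exists_prime_of_root m hsf h1 h2 6 (by norm_num) d hd r
    (by rw [hr, hm]) (s.comp (X ^ 2)) (by rw [aeval_comp]; simpa using ht)
  rw [aeval_comp, map_pow, aeval_X] at hsQ
  have hd' : (d ^ 3) ^ 2 = (m : 𝓞 E) := by
    apply RingOfIntegers.coe_injective
    rw [← pow_mul, map_pow]
    simpa using hd
  have hAA := half_sq hn hd' hA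
  obtain ⟨σ, hσ⟩ := exists_neg m hsf h1 h2 6 (by norm_num) (by decide) d hd pb hpb
  have hσA : σ A = 1 - A := by
    have h20 : (2 : 𝓞 E) ≠ 0 := by norm_num
    apply mul_left_cancel₀ h20
    have := congrArg σ hA
    simp only [map_mul, map_ofNat, map_add, map_one, map_pow, hσ] at this
    rw [this]
    linear_combination hA
  have h2c : (2 : 𝓞 E) ∈ Q.comap σ := by
    rw [Ideal.mem_comap, map_ofNat]; exact h2Q
  have hsc : aeval (d ^ 2) s ∈ Q.comap σ := by
    rw [Ideal.mem_comap]
    have : σ (aeval (d ^ 2) s) = aeval (d ^ 2) s := by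
      have := aeval_algHom_apply σ.toIntAlgHom (d ^ 2) s
      simp only [map_pow, RingHom.toIntAlgHom_apply, hσ] at this
      rw [← this]; simp
    rw [this]; exact hsQ
  have hmem : A * (A - 1) ∈ Q := by
    rw [hAA]; exact Q.mul_mem_right _ h2Q
  rcases hQ.mem_or_mem hmem with h | h
  · refine ⟨Q.comap σ, Q, inferInstance, hQ, h2c, h2Q, hsc, hsQ, ?_, h⟩
    rw [Ideal.mem_comap, map_sub, hσA, map_one]
    have := Q.neg_mem h
    convert this using 1; ring
  · refine ⟨Q, Q.comap σ, hQ, inferInstance, h2Q, h2c, hsQ, hsc, h, ?_⟩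
    rw [Ideal.mem_comap, hσA]
    have := Q.neg_mem h
    convert this using 1; ring

lemma levelK (m : ℤ) (hsf : Squarefree m) (h1 : m ≠ 1) (h2 : m ≠ -1) (n : ℤ) (hn : m = 1 + 8 * n)
    {K : Type*} [Field K] [NumberField K] (α A : 𝓞 K) (hα : α ^ 12 = m) (hA : 2 * A = 1 + α ^ 6)
    {k : Type*} [Field k] [CharP k 2] (r : k) (hr : r ^ 6 = 1) (s : ℤ[X])
    (ht : aeval (r ^ 2) s = 0) :
    ∃ Q Q' : Ideal (𝓞 K), Q.IsPrime ∧ Q'.IsPrime ∧ (2 : 𝓞 K) ∈ Q ∧ (2 : 𝓞 K) ∈ Q' ∧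
      aeval (α ^ 4) s ∈ Q ∧ aeval (α ^ 4) s ∈ Q' ∧ A - 1 ∈ Q ∧ A ∈ Q' := by
  let x : K := (α : K) ^ 2
  have hx6 : x ^ 6 = m := by
    have := congrArg (algebraMap (𝓞 K) K) hα
    simp only [map_pow, map_intCast] at this
    rw [← this]; ring
  have hxi : IsIntegral ℚ x := Algebra.IsIntegral.isIntegral x
  have hxz : IsIntegral ℤ x := (RingOfIntegers.isIntegral_coe α).pow 2
  let E := IntermediateField.adjoin ℚ {x}
  let g : E := IntermediateField.AdjoinSimple.gen ℚ x
  have hgz : IsIntegral ℤ g := by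
    refine (isIntegral_algebraMap_iff (A := E) (B := K) (algebraMap E K).injective).1 ?_
    exact hxz
  let d : 𝓞 E := ⟨g, hgz⟩
  have hd : (d : E) ^ 6 = m := by
    apply (algebraMap E K).injective
    rw [map_pow, map_intCast]; exact hx6
  have hdα : algebraMap (𝓞 E) (𝓞 K) d = α ^ 2 := by
    apply RingOfIntegers.coe_injective
    rw [map_pow]; rfl
  have hd' : (d ^ 3) ^ 2 = (m : 𝓞 E) := by
    apply RingOfIntegers.coe_injective
    rw [← pow_mul, map_pow]
    simpa using hd
  obtain ⟨B, hB⟩ := exists_half hn (d ^ 3) hd'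
  have hBA : algebraMap (𝓞 E) (𝓞 K) B = A := by
    have h20 : (2 : 𝓞 K) ≠ 0 := by norm_num
    apply mul_left_cancel₀ h20
    have := congrArg (algebraMap (𝓞 E) (𝓞 K)) hB
    simp only [map_mul, map_ofNat, map_add, map_one, map_pow, hdα] at this
    rw [this, hA]; ring
  obtain ⟨Q, Q', hQ, hQ', h2Q, h2Q', hs, hs', hBQ, hBQ'⟩ := levelE m hsf h1 h2 n hn d hd
    (IntermediateField.adjoin.powerBasis hxi) (IntermediateField.adjoin.powerBasis_gen hxi)
    B hB r hr s ht
  have lift : ∀ Q : Ideal (𝓞 E), Q.IsPrime → ∃ P : Ideal (𝓞 K), P.IsPrime ∧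
      P.comap (algebraMap (𝓞 E) (𝓞 K)) = Q := by
    intro Q hQ
    have : Algebra.IsIntegral (𝓞 E) (𝓞 K) := inferInstance
    obtain ⟨P, -, hP, hPc⟩ := Ideal.exists_ideal_over_prime_of_isIntegral
      (S := 𝓞 K) Q ⊥ (by
        intro y hy
        have : y = 0 := by
          apply RingOfIntegers.coe_injective
          apply (algebraMap E K).injective
          have h := congrArg (algebraMap (𝓞 K) K) (show algebraMap (𝓞 E) (𝓞 K) y = 0 from hy)
          rw [map_zero] at h
          rw [map_zero, map_zero]
          exact h
        rw [this]; exact zero_mem _)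
    exact ⟨P, hP, hPc⟩
  have hs_eq : algebraMap (𝓞 E) (𝓞 K) (aeval (d ^ 2) s) = aeval (α ^ 4) s := by
    rw [← aeval_algebraMap_apply, map_pow, hdα, ← pow_mul]
  obtain ⟨P, hP, hPc⟩ := lift Q hQ
  obtain ⟨P', hP', hPc'⟩ := lift Q' hQ'
  refine ⟨P, P', hP, hP', ?_, ?_, ?_, ?_, ?_, ?_⟩
  · rw [← hPc, Ideal.mem_comap, map_ofNat] at h2Q; exact h2Q
  · rw [← hPc', Ideal.mem_comap, map_ofNat] at h2Q'; exact h2Q'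
  · rw [← hPc, Ideal.mem_comap, hs_eq] at hs; exact hs
  · rw [← hPc', Ideal.mem_comap, hs_eq] at hs'; exact hs'
  · rw [← hPc, Ideal.mem_comap, map_sub, map_one, hBA] at hBQ; exact hBQ
  · rw [← hPc', Ideal.mem_comap, hBA] at hBQ'; exact hBQ'

lemma exists_b {K : Type*} [Field K] [NumberField K] {n : ℤ} (α A : 𝓞 K)
    (hA : 2 * A = 1 + α ^ 6) (hAA : A * (A - 1) = 2 * n) :
    ∃ b : 𝓞 K, 2 * b = A * (1 + α ^ 3) ∧ b ^ 2 = A * b + A * n := by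
  have e1 : 2 * (A : K) = 1 + (α : K) ^ 6 := by
    have := congrArg (algebraMap (𝓞 K) K) hA
    simpa only [map_mul, map_ofNat, map_add, map_one, map_pow] using this
  have e2 : (A : K) * ((A : K) - 1) = 2 * n := by
    have := congrArg (algebraMap (𝓞 K) K) hAA
    simpa only [map_mul, map_ofNat, map_sub, map_one, map_intCast] using this
  have hq : ((A : K) * (1 + (α : K) ^ 3) / 2) ^ 2 =
      A * ((A : K) * (1 + (α : K) ^ 3) / 2) + A * n := by
    linear_combination (-(A : K) ^ 2 / 4) * e1 + (A : K) / 2 * e2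
  have hI : IsIntegral (𝓞 K) ((A : K) * (1 + (α : K) ^ 3) / 2) := by
    refine ⟨X ^ 2 - C A * X - C (A * (n : 𝓞 K)), ?_, ?_⟩
    · monicity!
    · rw [eval₂_sub, eval₂_sub, eval₂_mul, eval₂_pow, eval₂_X, eval₂_C, eval₂_C, map_mul,
        map_intCast]
      linear_combination hq
  obtain ⟨b, hb⟩ := IsIntegrallyClosed.isIntegral_iff.1 hI
  refine ⟨b, ?_, ?_⟩
  · apply RingOfIntegers.coe_injective
    simp only [map_mul, map_ofNat, map_add, map_one, map_pow, hb]
    ring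
  · apply RingOfIntegers.coe_injective
    simp only [map_mul, map_add, map_pow, map_intCast, hb]
    exact hq

section norms
variable {K : Type*} [Field K] [NumberField K]

lemma ne_bot_of_two {P : Ideal (𝓞 K)} (h2 : (2 : 𝓞 K) ∈ P) : P ≠ ⊥ := by
  rintro rfl
  simp at h2

lemma not_one_mem {P : Ideal (𝓞 K)} (hP : P.IsPrime) : (1 : 𝓞 K) ∉ P :=
  fun h => hP.ne_top ((Ideal.eq_top_iff_one P).2 h)

lemma norm_ge_two {P : Ideal (𝓞 K)} (hP : P.IsPrime) (h2 : (2 : 𝓞 K) ∈ P) :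
    2 ≤ Ideal.absNorm P := by
  have h0 : Ideal.absNorm P ≠ 0 := fun h => ne_bot_of_two h2 (Ideal.absNorm_eq_zero_iff.1 h)
  have h1 : Ideal.absNorm P ≠ 1 := fun h => hP.ne_top (Ideal.absNorm_eq_one_iff.1 h)
  omega

lemma norm_ge_four {P : Ideal (𝓞 K)} (hP : P.IsPrime) (h2 : (2 : 𝓞 K) ∈ P) (x : 𝓞 K)
    (hx : x ^ 2 + x + 1 ∈ P) : 4 ≤ Ideal.absNorm P := by
  have hge := norm_ge_two hP h2
  have h3 : Ideal.absNorm P ≠ 3 := by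
    intro h
    have := Ideal.absNorm_mem P
    rw [h] at this
    have h' := P.sub_mem this h2
    apply not_one_mem hP
    convert h' using 1
    push_cast; ring
  have h2' : Ideal.absNorm P ≠ 2 := by
    intro h
    rw [Ideal.absNorm_apply, Submodule.cardQuot_apply] at h
    obtain ⟨y, hy, huniq⟩ := (Nat.card_eq_two_iff' (0 : 𝓞 K ⧸ P)).1 h
    have h1y := huniq 1 (by
      intro h1
      exact not_one_mem hP (Ideal.Quotient.eq_zero_iff_mem.1 h1))
    by_cases hx0 : Ideal.Quotient.mk P x = 0
    · have hxP := Ideal.Quotient.eq_zero_iff_mem.1 hx0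
      apply not_one_mem hP
      have := P.sub_mem hx (P.mul_mem_left (x + 1) hxP)
      convert this using 1; ring
    · have hx1 := huniq _ hx0
      rw [← h1y] at hx1
      have hxP : x - 1 ∈ P := Ideal.Quotient.eq.1 (by simpa using hx1)
      apply not_one_mem hP
      have := P.sub_mem (P.sub_mem hx (P.mul_mem_left (x + 2) hxP)) h2
      convert this using 1; ring
  omega

lemma coprime_of_ne {P Q : Ideal (𝓞 K)} (hP : P.IsPrime) (hQ : Q.IsPrime)
    (h2 : (2 : 𝓞 K) ∈ P) (h2' : (2 : 𝓞 K) ∈ Q) (h : P ≠ Q) : IsCoprime P Q :=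
  Ideal.isCoprime_iff_sup_eq.2 (Ideal.IsMaximal.coprime_of_ne
    (hP.isMaximal (ne_bot_of_two h2)) (hQ.isMaximal (ne_bot_of_two h2')) h)

lemma two_mem_sq {α A : 𝓞 K} (hA : 2 * A = 1 + α ^ 6) {P : Ideal (𝓞 K)} (hP : P.IsPrime)
    (h2 : (2 : 𝓞 K) ∈ P) (hAP : A ∈ P) : (2 : 𝓞 K) ∈ P ^ 2 := by
  have hmax := hP.isMaximal (ne_bot_of_two h2)
  have e : (α ^ 3 + 1) ^ 2 = (A + α ^ 3) * 2 := by linear_combination -hA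
  have h1 : α ^ 3 + 1 ∈ P := by
    apply hP.mem_of_pow_mem 2
    rw [e]; exact P.mul_mem_left _ h2
  have h3 : (A + α ^ 3) * 2 ∈ P ^ 2 := by
    rw [← e]; exact Ideal.pow_mem_pow h1 2
  rcases Ideal.IsMaximal.mul_mem_pow P h3 with h | h
  · exfalso
    apply not_one_mem hP
    have := P.sub_mem (P.add_mem h1 hAP) h
    convert this using 1; ring
  · exact h

lemma split_ne {n : ℤ} {A b x : 𝓞 K} (hb : b ^ 2 = A * b + A * n)
    {τ : 𝓞 K →+* 𝓞 K} (hτb : τ b = A - b) (hτx : τ x = x)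
    {P : Ideal (𝓞 K)} (hP : P.IsPrime) (h2 : (2 : 𝓞 K) ∈ P) (hAP : A - 1 ∈ P)
    (hx : x ^ 2 + x - n ∈ P) : P ≠ P.comap τ := by
  intro heq
  have hprod : (b + x) * (b - x - 1) ∈ P := by
    have := P.sub_mem (P.mul_mem_left (b + n) hAP) hx
    convert this using 1
    linear_combination hb
  have key : b + x ∈ P → b - x - 1 ∈ P → False := by
    intro h h'
    apply not_one_mem hP
    have := P.sub_mem (P.sub_mem h h') (P.mul_mem_left x h2)
    convert this using 1; ring
  rcases hP.mem_or_mem hprod with h | h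
  · have h' := h
    rw [heq, Ideal.mem_comap, map_add, hτb, hτx] at h'
    refine key h ?_
    have := P.sub_mem hAP h'
    convert this using 1; ring
  · have h' := h
    rw [heq, Ideal.mem_comap, map_sub, map_sub, hτb, hτx, map_one] at h'
    refine key ?_ h
    have := P.sub_mem hAP h'
    convert this using 1; ring

end norms

lemma final_arith {a b c e f : ℕ} (ha : 4 ≤ a) (hb : 4 ≤ b) (hc : 4 ≤ c) (he : 2 ≤ e) (hf : 4 ≤ f)
    (h : a * (b * (c ^ 2 * (e ^ 2 * f))) ≤ 2 ^ 12) : a = 4 ∧ b = 4 ∧ c = 4 := by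
  refine ⟨?_, ?_, ?_⟩
  · by_contra hne
    have ha' : 5 ≤ a := by omega
    have : 5 * (4 * (4 ^ 2 * (2 ^ 2 * 4))) ≤ a * (b * (c ^ 2 * (e ^ 2 * f))) := by gcongr
    omega
  · by_contra hne
    have hb' : 5 ≤ b := by omega
    have : 4 * (5 * (4 ^ 2 * (2 ^ 2 * 4))) ≤ a * (b * (c ^ 2 * (e ^ 2 * f))) := by gcongr
    omega
  · by_contra hne
    have hc' : 5 ≤ c := by omega
    have : 4 * (4 * (5 ^ 2 * (2 ^ 2 * 4))) ≤ a * (b * (c ^ 2 * (e ^ 2 * f))) := by gcongr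
    omega

/-- Let `m` be a squarefree rational integer with `m ∉ {0, 1, -1}`, `α` a root of the
irreducible polynomial `x^12 − m`, `K = ℚ(α)`, `Z_K` its ring of integers. If
`m ≡ 1 (mod 8)`, then there are at least three distinct prime ideals of `Z_K` lying
above `2`, each of residue degree `2` (equivalently, of absolute norm `2^2`). -/
theorem three_primes_above_two_of_one_mod_eight (m : ℤ) (hsf : Squarefree m)
    (h0 : m ≠ 0) (h1 : m ≠ 1) (h2 : m ≠ -1)
    (K : Type*) [Field K] [NumberField K] (α : K)
    (hroot : α ^ 12 = (m : K))
    (hgen : IntermediateField.adjoin ℚ {α} = ⊤)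
    (hmod : m ≡ 1 [ZMOD 8]) :
    ∃ p₁ p₂ p₃ : Ideal (𝓞 K),
      p₁ ≠ p₂ ∧ p₁ ≠ p₃ ∧ p₂ ≠ p₃ ∧
      p₁.IsPrime ∧ p₂.IsPrime ∧ p₃.IsPrime ∧
      (2 : 𝓞 K) ∈ p₁ ∧ (2 : 𝓞 K) ∈ p₂ ∧ (2 : 𝓞 K) ∈ p₃ ∧
      Ideal.absNorm p₁ = 2 ^ 2 ∧ Ideal.absNorm p₂ = 2 ^ 2 ∧ Ideal.absNorm p₃ = 2 ^ 2 := by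
  obtain ⟨n, hn⟩ : ∃ n : ℤ, m = 1 + 8 * n := by
    obtain ⟨n, hn⟩ := hmod.symm.dvd
    exact ⟨n, by linarith⟩
  have hαi : IsIntegral ℤ α := by
    refine ⟨X ^ 12 - C m, monic_X_pow_sub_C m (by norm_num), ?_⟩
    rw [eval₂_sub, eval₂_pow, eval₂_X, eval₂_C, hroot]
    simp
  obtain ⟨a, ha⟩ : ∃ a : 𝓞 K, (a : K) = α := ⟨⟨α, hαi⟩, rfl⟩
  have ha12 : a ^ 12 = m := by
    apply RingOfIntegers.coe_injective
    have ha' : algebraMap (𝓞 K) K a = α := ha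
    rw [map_pow, ha', hroot, map_intCast]
  have hαQ : IsIntegral ℚ α := Algebra.IsIntegral.isIntegral α
  -- the degree
  have hrank : Module.finrank ℤ (𝓞 K) = 12 := by
    rw [RingOfIntegers.rank, ← IntermediateField.finrank_top', ← hgen,
      IntermediateField.adjoin.finrank hαQ,
      minpoly_int m hsf h1 h2 12 (by norm_num) α hroot,
      (monic_X_pow_sub_C m (by norm_num)).natDegree_map, natDegree_X_pow_sub_C]
  -- the automorphism
  obtain ⟨τ, hτ⟩ : ∃ τ : 𝓞 K →+* 𝓞 K, τ a = -a := by
    refine exists_neg m hsf h1 h2 12 (by norm_num) (by decide) a (by rw [ha, hroot])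
      ((IntermediateField.adjoin.powerBasis hαQ).map
        ((IntermediateField.equivOfEq hgen).trans IntermediateField.topEquiv)) ?_
    rw [PowerBasis.map_gen, IntermediateField.adjoin.powerBasis_gen, ha]
    rfl
  have h20 : (2 : 𝓞 K) ≠ 0 := by norm_num
  have ha6 : (a ^ 6) ^ 2 = (m : 𝓞 K) := by rw [← ha12]; ring
  obtain ⟨A, hA⟩ := exists_half hn (a ^ 6) ha6
  have hAA := half_sq hn ha6 hA
  obtain ⟨b, hb2, hb⟩ := exists_b a A hA hAA
  have hτA : τ A = A := by
    apply mul_left_cancel₀ h20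
    have := congrArg τ hA
    simp only [map_mul, map_ofNat, map_add, map_one, map_pow, hτ] at this
    rw [this, hA]; ring
  have hτb : τ b = A - b := by
    apply mul_left_cancel₀ h20
    have := congrArg τ hb2
    simp only [map_mul, map_ofNat, map_add, map_one, map_pow, hτ, hτA] at this
    rw [this]; linear_combination hb2
  have hτ2 : ∀ P : Ideal (𝓞 K), (2 : 𝓞 K) ∈ P → (2 : 𝓞 K) ∈ P.comap τ := by
    intro P h; rw [Ideal.mem_comap, map_ofNat]; exact h
  have hτ4 : τ (a ^ 4) = a ^ 4 := by rw [map_pow, hτ]; ring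
  -- the starting primes
  obtain ⟨ω, hω⟩ : ∃ ω : AlgebraicClosure (ZMod 2), ω ^ 2 + ω + 1 = 0 := by
    obtain ⟨ω, hω⟩ := IsAlgClosed.exists_root
      (X ^ 2 + X + 1 : (AlgebraicClosure (ZMod 2))[X]) (by
        have : (X ^ 2 + X + 1 : (AlgebraicClosure (ZMod 2))[X]).degree = 2 := by compute_degree!
        rw [this]; norm_num)
    exact ⟨ω, by simpa [IsRoot] using hω⟩
  have : CharP (AlgebraicClosure (ZMod 2)) 2 := charP_of_injective_algebraMap
    (algebraMap (ZMod 2) (AlgebraicClosure (ZMod 2))).injective 2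
  obtain ⟨P, R, hP, hR, hP2, hR2, hPs, hRs, hPA, hRA⟩ :=
    levelK m hsf h1 h2 n hn a A ha12 hA ω
      (by linear_combination (ω ^ 4 - ω ^ 3 + ω - 1) * hω) (X ^ 2 + X + 1)
      (by simp; linear_combination (ω ^ 2 - ω + 1) * hω)
  obtain ⟨P1, R1, hP1, hR1, hP12, hR12, hP1s, hR1s, hP1A, hR1A⟩ :=
    levelK m hsf h1 h2 n hn a A ha12 hA (1 : ZMod 2) (by simp) (X - 1) (by simp)
  have es : aeval (a ^ 4) (X ^ 2 + X + 1 : ℤ[X]) = (a ^ 4) ^ 2 + a ^ 4 + 1 := by simp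
  have es1 : aeval (a ^ 4) (X - 1 : ℤ[X]) = a ^ 4 - 1 := by simp
  rw [es] at hPs hRs
  rw [es1] at hP1s hR1s
  -- separating conditions
  have sepA : ∀ I J : Ideal (𝓞 K), I.IsPrime → A - 1 ∈ I → A ∈ J → I ≠ J := by
    rintro I _ hI h h' rfl
    apply not_one_mem hI
    have := I.sub_mem h' h
    convert this using 1; ring
  have seps : ∀ I J : Ideal (𝓞 K), I.IsPrime → (2 : 𝓞 K) ∈ I → a ^ 4 - 1 ∈ I →
      (a ^ 4) ^ 2 + a ^ 4 + 1 ∈ J → I ≠ J := by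
    rintro I _ hI h2I h h' rfl
    apply not_one_mem hI
    have := I.sub_mem (I.sub_mem h' (I.mul_mem_left (a ^ 4 + 2) h)) h2I
    convert this using 1; ring
  have hparity : ∀ I : Ideal (𝓞 K), (2 : 𝓞 K) ∈ I → Odd n → ((n : 𝓞 K) + 1 ∈ I) := by
    rintro I h2I ⟨k, hk⟩
    have := I.mul_mem_left ((k : 𝓞 K) + 1) h2I
    convert this using 1
    rw [hk]; push_cast; ring
  have hparity' : ∀ I : Ideal (𝓞 K), (2 : 𝓞 K) ∈ I → Even n → ((n : 𝓞 K) ∈ I) := by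
    rintro I h2I ⟨k, hk⟩
    have := I.mul_mem_left (k : 𝓞 K) h2I
    convert this using 1
    rw [hk]; push_cast; ring
  have hPne : P ≠ P.comap τ := by
    rcases Int.even_or_odd n with hev | hod
    · refine split_ne hb hτb (x := 0) (map_zero τ) hP hP2 hPA ?_
      have := P.neg_mem (hparity' P hP2 hev)
      convert this using 1; ring
    · refine split_ne hb hτb hτ4 hP hP2 hPA ?_
      have := P.sub_mem hPs (hparity P hP2 hod)
      convert this using 1; ring
  have hPτA : A - 1 ∈ P.comap τ := by
    rw [Ideal.mem_comap, map_sub, hτA, map_one]; exact hPA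
  have hPτs : (a ^ 4) ^ 2 + a ^ 4 + 1 ∈ P.comap τ := by
    rw [Ideal.mem_comap, map_add, map_add, map_pow, hτ4, map_one]; exact hPs
  have hPτ : (P.comap τ).IsPrime := inferInstance
  have hPτ2 := hτ2 P hP2
  -- the auxiliary ideal
  obtain ⟨I, hI4, hI2, hIcop⟩ : ∃ I : Ideal (𝓞 K), 4 ≤ Ideal.absNorm I ∧ I ∣ Ideal.span {2} ∧
      ∀ J : Ideal (𝓞 K), J.IsPrime → (2 : 𝓞 K) ∈ J →
        (A ∈ J ∨ (a ^ 4) ^ 2 + a ^ 4 + 1 ∈ J) → IsCoprime J I := by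
    have aux : ∀ L : Ideal (𝓞 K), L.IsPrime → (2 : 𝓞 K) ∈ L → A - 1 ∈ L → a ^ 4 - 1 ∈ L →
        ∀ J : Ideal (𝓞 K), J.IsPrime → (2 : 𝓞 K) ∈ J →
        (A ∈ J ∨ (a ^ 4) ^ 2 + a ^ 4 + 1 ∈ J) → IsCoprime J L := by
      intro L hL h2L hAL hsL J hJ h2J hor
      refine (coprime_of_ne hL hJ h2L h2J ?_).symm
      rcases hor with h | h
      · exact sepA L J hL hAL h
      · exact seps L J hL h2L hsL h
    rcases Int.even_or_odd n with hev | hod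
    · have hne : P1 ≠ P1.comap τ := by
        refine split_ne hb hτb (x := 0) (map_zero τ) hP1 hP12 hP1A ?_
        have := P1.neg_mem (hparity' P1 hP12 hev)
        convert this using 1; ring
      have hp' : (P1.comap τ).IsPrime := inferInstance
      have hA' : A - 1 ∈ P1.comap τ := by
        rw [Ideal.mem_comap, map_sub, hτA, map_one]; exact hP1A
      have hs' : a ^ 4 - 1 ∈ P1.comap τ := by
        rw [Ideal.mem_comap, map_sub, hτ4, map_one]; exact hP1s
      refine ⟨P1 * P1.comap τ, ?_, ?_, ?_⟩
      · rw [map_mul]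
        have h1 := norm_ge_two hP1 hP12
        have h2 := norm_ge_two hp' (hτ2 _ hP12)
        calc 4 = 2 * 2 := rfl
          _ ≤ _ := Nat.mul_le_mul h1 h2
      · refine (coprime_of_ne hP1 hp' hP12 (hτ2 _ hP12) hne).mul_dvd ?_ ?_
        · rw [Ideal.dvd_span_singleton]; exact hP12
        · rw [Ideal.dvd_span_singleton]; exact hτ2 _ hP12
      · intro J hJ h2J hor
        exact (aux P1 hP1 hP12 hP1A hP1s J hJ h2J hor).mul_right
          (aux _ hp' (hτ2 _ hP12) hA' hs' J hJ h2J hor)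
    · refine ⟨P1, ?_, ?_, aux P1 hP1 hP12 hP1A hP1s⟩
      · refine norm_ge_four hP1 hP12 b ?_
        have := P1.add_mem (P1.add_mem (P1.mul_mem_left (b + n) hP1A) (P1.mul_mem_left b hP12))
          (hparity P1 hP12 hod)
        convert this using 1
        linear_combination hb
      · rw [Ideal.dvd_span_singleton]; exact hP12
  -- the product
  have cPP := coprime_of_ne hP hPτ hP2 hPτ2 hPne
  have cPR := coprime_of_ne hP hR hP2 hR2 (sepA _ _ hP hPA hRA)
  have cPR1 := coprime_of_ne hP hR1 hP2 hR12 (sepA _ _ hP hPA hR1A)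
  have cPI := hIcop P hP hP2 (Or.inr hPs)
  have cP'R := coprime_of_ne hPτ hR hPτ2 hR2 (sepA _ _ hPτ hPτA hRA)
  have cP'R1 := coprime_of_ne hPτ hR1 hPτ2 hR12 (sepA _ _ hPτ hPτA hR1A)
  have cP'I := hIcop _ hPτ hPτ2 (Or.inr hPτs)
  have cRR1 := coprime_of_ne hR hR1 hR2 hR12 (seps _ _ hR1 hR12 hR1s hRs).symm
  have cRI := hIcop R hR hR2 (Or.inr hRs)
  have cR1I := hIcop R1 hR1 hR12 (Or.inl hR1A)
  have dP : P ∣ Ideal.span {2} := by rw [Ideal.dvd_span_singleton]; exact hP2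
  have dP' : P.comap τ ∣ Ideal.span {2} := by rw [Ideal.dvd_span_singleton]; exact hPτ2
  have dR : R ^ 2 ∣ Ideal.span {2} := by
    rw [Ideal.dvd_span_singleton]; exact two_mem_sq hA hR hR2 hRA
  have dR1 : R1 ^ 2 ∣ Ideal.span {2} := by
    rw [Ideal.dvd_span_singleton]; exact two_mem_sq hA hR1 hR12 hR1A
  have hdvd : P * (P.comap τ * (R ^ 2 * (R1 ^ 2 * I))) ∣ Ideal.span {(2 : 𝓞 K)} := by
    have d1 : R1 ^ 2 * I ∣ Ideal.span {(2 : 𝓞 K)} := (cR1I.pow_left).mul_dvd dR1 hI2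
    have d2 : R ^ 2 * (R1 ^ 2 * I) ∣ Ideal.span {(2 : 𝓞 K)} :=
      ((cRR1.pow_right.mul_right cRI).pow_left).mul_dvd dR d1
    have d3 : P.comap τ * (R ^ 2 * (R1 ^ 2 * I)) ∣ Ideal.span {(2 : 𝓞 K)} :=
      (cP'R.pow_right.mul_right (cP'R1.pow_right.mul_right cP'I)).mul_dvd dP' d2
    exact (cPP.mul_right (cPR.pow_right.mul_right (cPR1.pow_right.mul_right cPI))).mul_dvd dP d3
  have hN := map_dvd Ideal.absNorm hdvd
  have hspan : Ideal.absNorm (Ideal.span {(2 : 𝓞 K)}) = 2 ^ 12 := by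
    have := Ideal.absNorm_span_natCast (S := 𝓞 K) 2
    rw [hrank] at this
    exact_mod_cast this
  rw [hspan] at hN
  simp only [map_mul, map_pow] at hN
  have hle := Nat.le_of_dvd (by norm_num) hN
  obtain ⟨r1, r2, r3⟩ := final_arith (norm_ge_four hP hP2 _ hPs) (norm_ge_four hPτ hPτ2 _ hPτs)
    (norm_ge_four hR hR2 _ hRs) (norm_ge_two hR1 hR12) hI4 hle
  exact ⟨P, P.comap τ, R, hPne, sepA _ _ hP hPA hRA, sepA _ _ hPτ hPτA hRA, hP, hPτ, hR,
    hP2, hPτ2, hR2, r1, r2, r3⟩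
end
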